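/- There exists an integer Γ such that every finite simple (C4, diamond, theta, pyramid, prism, even wheel)-free graph G satisfies ta(G) ≤ Γ, where ta denotes the tree independence number. -/

import Mathlib

open SimpleGraph

namespace Paper

variable {V : Type*}

/-- `G` contains an induced subgraph isomorphic to `H`. -/
def ContainsInduced {W : Type*} (G : SimpleGraph V) (H : SimpleGraph W) : Prop :=
  ∃ S : Set V, Nonempty (G.induce S ≃g H)

/-- `G` is `H`-free: no induced subgraph of `G` is isomorphic to `H`. -/
def Free {W : Type*} (G : SimpleGraph V) (H : SimpleGraph W) : Prop :=
  ¬ ContainsInduced G H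

/-- The diamond: `K₄` minus an edge. -/
def diamond : SimpleGraph (Fin 4) :=
  (⊤ : SimpleGraph (Fin 4)).deleteEdges {s(0, 1)}

/-- `S` induces a hole (an induced cycle of length at least 4) in `G`. -/
def IsHoleSet (G : SimpleGraph V) (S : Set V) : Prop :=
  ∃ n : ℕ, 4 ≤ n ∧ Nonempty (G.induce S ≃g cycleGraph n)

/-- `G` contains an even hole. -/
def HasEvenHole (G : SimpleGraph V) : Prop :=
  ∃ S : Set V, ∃ n : ℕ, 4 ≤ n ∧ Even n ∧ Nonempty (G.induce S ≃g cycleGraph n)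

/-- The union of the vertex sets of two walks induces a hole in `G`. -/
def PairHole (G : SimpleGraph V) {a b c d : V} (P : G.Walk a b) (Q : G.Walk c d) : Prop :=
  IsHoleSet G {v | v ∈ P.support ∨ v ∈ Q.support}

/-- `G` contains a theta. -/
def HasTheta (G : SimpleGraph V) : Prop :=
  ∃ (a b : V) (P₁ P₂ P₃ : G.Walk a b),
    a ≠ b ∧ ¬ G.Adj a b ∧
    P₁.IsPath ∧ P₂.IsPath ∧ P₃.IsPath ∧
    PairHole G P₁ P₂ ∧ PairHole G P₁ P₃ ∧ PairHole G P₂ P₃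

/-- `G` contains a pyramid. -/
def HasPyramid (G : SimpleGraph V) : Prop :=
  ∃ (a b₁ b₂ b₃ : V) (P₁ : G.Walk a b₁) (P₂ : G.Walk a b₂) (P₃ : G.Walk a b₃),
    G.Adj b₁ b₂ ∧ G.Adj b₁ b₃ ∧ G.Adj b₂ b₃ ∧
    a ≠ b₁ ∧ a ≠ b₂ ∧ a ≠ b₃ ∧
    P₁.IsPath ∧ P₂.IsPath ∧ P₃.IsPath ∧
    PairHole G P₁ P₂ ∧ PairHole G P₁ P₃ ∧ PairHole G P₂ P₃

/-- `G` contains a prism. -/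
def HasPrism (G : SimpleGraph V) : Prop :=
  ∃ (a₁ a₂ a₃ b₁ b₂ b₃ : V) (P₁ : G.Walk a₁ b₁) (P₂ : G.Walk a₂ b₂) (P₃ : G.Walk a₃ b₃),
    G.Adj a₁ a₂ ∧ G.Adj a₁ a₃ ∧ G.Adj a₂ a₃ ∧
    G.Adj b₁ b₂ ∧ G.Adj b₁ b₃ ∧ G.Adj b₂ b₃ ∧
    ({a₁, a₂, a₃} : Set V) ∩ {b₁, b₂, b₃} = ∅ ∧
    P₁.IsPath ∧ P₂.IsPath ∧ P₃.IsPath ∧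
    PairHole G P₁ P₂ ∧ PairHole G P₁ P₃ ∧ PairHole G P₂ P₃

/-- The neighbors of `v` inside the set `S`. -/
def nbrsIn (G : SimpleGraph V) (S : Set V) (v : V) : Set V :=
  {u | u ∈ S ∧ G.Adj v u}

/-- `(S, v)` is a wheel of `G`: `S` is a hole and `v ∉ S` has at least 3 neighbors in `S`. -/
def IsWheel (G : SimpleGraph V) (S : Set V) (v : V) : Prop :=
  IsHoleSet G S ∧ v ∉ S ∧ 3 ≤ (nbrsIn G S v).ncard

/-- `(S, v)` is an even wheel of `G`. -/
def IsEvenWheel (G : SimpleGraph V) (S : Set V) (v : V) : Prop :=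
  IsWheel G S v ∧ Even (nbrsIn G S v).ncard

def HasWheel (G : SimpleGraph V) : Prop := ∃ (S : Set V) (v : V), IsWheel G S v

def HasEvenWheel (G : SimpleGraph V) : Prop := ∃ (S : Set V) (v : V), IsEvenWheel G S v

/-- A bug: a wheel whose hub has exactly three neighbors in the hole,
exactly two of which are adjacent. -/
def IsBug (G : SimpleGraph V) (S : Set V) (v : V) : Prop :=
  IsWheel G S v ∧ ∃ x y z : V, x ≠ y ∧ x ≠ z ∧ y ≠ z ∧
    nbrsIn G S v = {x, y, z} ∧ G.Adj x y ∧ ¬ G.Adj x z ∧ ¬ G.Adj y z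

/-- A twin wheel: the neighbors of the hub in the hole induce a path of length two. -/
def IsTwinWheel (G : SimpleGraph V) (S : Set V) (v : V) : Prop :=
  IsWheel G S v ∧ ∃ x y z : V, x ≠ y ∧ x ≠ z ∧ y ≠ z ∧
    nbrsIn G S v = {x, y, z} ∧ G.Adj x y ∧ G.Adj y z ∧ ¬ G.Adj x z

/-- A universal wheel: the hub is adjacent to every vertex of the hole. -/
def IsUniversalWheel (G : SimpleGraph V) (S : Set V) (v : V) : Prop :=
  IsWheel G S v ∧ ∀ u ∈ S, G.Adj v u

/-- `G` is a member of the class 𝒞 of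
(C4, diamond, theta, pyramid, prism, even wheel)-free graphs. -/
def InC (G : SimpleGraph V) : Prop :=
  Free G (cycleGraph 4) ∧ Free G diamond ∧ ¬ HasTheta G ∧ ¬ HasPyramid G ∧
    ¬ HasPrism G ∧ ¬ HasEvenWheel G

/-- The independence number of `G`. -/
noncomputable def indepNum (G : SimpleGraph V) : ℕ :=
  sSup {n | ∃ S : Set V, (S.Pairwise fun u v => ¬ G.Adj u v) ∧ S.ncard = n}

/-- The clique number of `G`. -/
noncomputable def cliqueNum (G : SimpleGraph V) : ℕ :=
  sSup {n | ∃ S : Set V, G.IsClique S ∧ S.ncard = n}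

/-- The (vertex) clique cover number of `G`: the minimum number of parts in a
partition of the vertex set of `G` into cliques. -/
noncomputable def cliqueCoverNum (G : SimpleGraph V) : ℕ :=
  sInf {n | ∃ F : Finset (Set V), F.card = n ∧ (∀ C ∈ F, G.IsClique C) ∧
    ∀ v : V, ∃! C : Set V, C ∈ F ∧ v ∈ C}

/-- A tree decomposition of `G`. -/
structure TreeDecomp (G : SimpleGraph V) where
  ι : Type
  tree : SimpleGraph ι
  tree_acyclic : tree.IsAcyclic
  tree_connected : tree.Connected
  bag : ι → Set V
  bag_cover : ∀ v : V, ∃ t, v ∈ bag t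
  bag_edge : ∀ ⦃u v : V⦄, G.Adj u v → ∃ t, u ∈ bag t ∧ v ∈ bag t
  bag_subtree : ∀ v : V, (tree.induce {t | v ∈ bag t}).Connected

/-- The treewidth of `G`: the minimum over tree decompositions of (max bag size − 1). -/
noncomputable def treewidth (G : SimpleGraph V) : ℕ :=
  sInf {k | ∃ D : TreeDecomp G, ∀ t, (D.bag t).ncard ≤ k + 1}

/-- The tree independence number of `G`. -/
noncomputable def treeIndepNum (G : SimpleGraph V) : ℕ :=
  sInf {k | ∃ D : TreeDecomp G, ∀ t, indepNum (G.induce (D.bag t)) ≤ k}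

/-- The tree clique cover number of `G`. -/
noncomputable def treeCliqueCoverNum (G : SimpleGraph V) : ℕ :=
  sInf {k | ∃ D : TreeDecomp G, ∀ t, cliqueCoverNum (G.induce (D.bag t)) ≤ k}

/-- A weight function on a finite graph: values in `[0,1]` summing to `1`. -/
def IsWeightFn [Fintype V] (w : V → ℝ) : Prop :=
  (∀ v, 0 ≤ w v ∧ w v ≤ 1) ∧ ∑ v, w v = 1

/-- The weight of a set of vertices. -/
noncomputable def wSet (w : V → ℝ) (S : Set V) : ℝ := ∑ᶠ x ∈ S, w x

/-- `X` is a `(w, c)`-balanced separator of `G`: every connected component of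
`G − X` has weight at most `c`. -/
def IsBalancedSep (G : SimpleGraph V) (w : V → ℝ) (c : ℝ) (X : Set V) : Prop :=
  ∀ D : (G.induce Xᶜ).ConnectedComponent, wSet w (Subtype.val '' D.supp) ≤ c

/-- `G` has a clique cutset: a clique `C` such that `G − C` is disconnected. -/
def HasCliqueCutset (G : SimpleGraph V) : Prop :=
  ∃ C : Set V, G.IsClique C ∧ ¬ (G.induce Cᶜ).Preconnected

/-- The closed neighborhood of `v`. -/
def closedNbhd (G : SimpleGraph V) (v : V) : Set V := insert v (G.neighborSet v)

/-- The (open) neighborhood of a set `S`: vertices outside `S` with a neighbor in `S`. -/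
def setNbhd (G : SimpleGraph V) (S : Set V) : Set V :=
  {v | v ∉ S ∧ ∃ u ∈ S, G.Adj v u}

/-- `(A, C, B)` is a separation of `G`. -/
def IsSeparation (G : SimpleGraph V) (A C B : Set V) : Prop :=
  A ∪ C ∪ B = Set.univ ∧ Disjoint A C ∧ Disjoint A B ∧ Disjoint C B ∧
    ∀ a ∈ A, ∀ b ∈ B, ¬ G.Adj a b

/-- `v` is a balanced vertex with respect to `w`: every connected component of
`G − N[v]` has weight at most `1/2`. -/
def IsBalancedVtx (G : SimpleGraph V) (w : V → ℝ) (v : V) : Prop :=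
  ∀ D : (G.induce (closedNbhd G v)ᶜ).ConnectedComponent,
    wSet w (Subtype.val '' D.supp) ≤ 1 / 2


section Part1
variable {V : Type*}

/-- Induced path, as a list. -/
def IP (G : SimpleGraph V) : List V → Prop
  | [] => True
  | a :: l => IP G l ∧ ∀ x ∈ l, a ≠ x ∧ (G.Adj a x ↔ l.head? = some x)

/-- Hole, as a (cyclic) list. -/
def HL (G : SimpleGraph V) : List V → Prop
  | [] => False
  | a :: l => IP G l ∧ 3 ≤ l.length ∧
      ∀ x ∈ l, a ≠ x ∧ (G.Adj a x ↔ l.head? = some x ∨ l.getLast? = some x)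

variable {G : SimpleGraph V}

@[simp] theorem getLast?_cons_app {a b : V} {X Y : List V} :
    (a :: (X ++ b :: Y)).getLast? = (b :: Y).getLast? := by
  rw [← List.cons_append, List.getLast?_append_of_ne_nil _ (by simp)]

@[simp] theorem getLast?_app {b : V} {X Y : List V} :
    (X ++ b :: Y).getLast? = (b :: Y).getLast? := by
  rw [List.getLast?_append_of_ne_nil _ (by simp)]

@[simp] theorem IP_nil : IP G [] ↔ True := Iff.rfl

theorem IP_cons {a : V} {l : List V} : IP G (a :: l) ↔
    IP G l ∧ ∀ x ∈ l, a ≠ x ∧ (G.Adj a x ↔ l.head? = some x) := Iff.rfl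

theorem HL_cons {a : V} {l : List V} : HL G (a :: l) ↔ IP G l ∧ 3 ≤ l.length ∧
      ∀ x ∈ l, a ≠ x ∧ (G.Adj a x ↔ l.head? = some x ∨ l.getLast? = some x) := Iff.rfl

@[simp] theorem IP_single {a : V} : IP G [a] := by simp [IP]

theorem IP_append {A B : List V} : IP G (A ++ B) ↔ IP G A ∧ IP G B ∧
    ∀ a ∈ A, ∀ b ∈ B, a ≠ b ∧ (G.Adj a b ↔ A.getLast? = some a ∧ B.head? = some b) := by
  induction A with
  | nil => simp
  | cons x A ih =>
    rw [List.cons_append, IP_cons, ih, IP_cons]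
    rcases A with _ | ⟨y, A⟩
    · simp only [List.nil_append, IP_nil, List.not_mem_nil, List.mem_singleton,
        List.getLast?_singleton]
      simp
    · simp only [List.getLast?_cons_cons, List.cons_append, List.head?_cons]
      constructor
      · rintro ⟨⟨h1, h2, h3⟩, h4⟩
        refine ⟨⟨h1, fun z hz => h4 z (by simp at hz ⊢; tauto)⟩, h2, ?_⟩
        intro a ha b hb
        rcases List.mem_cons.1 ha with rfl | ha
        · have := h4 b (by simp [hb])
          refine ⟨this.1, this.2.trans ?_⟩
          constructor
          · intro h
            simp at h; subst h
            exact absurd rfl (h3 y (by simp) y hb).1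
          · rintro ⟨h, -⟩
            exact absurd rfl (h4 a (by
              have := List.mem_of_getLast? h
              simp at this ⊢; tauto)).1
        · exact h3 a ha b hb
      · rintro ⟨⟨h1, h4⟩, h2, h3⟩
        refine ⟨⟨h1, h2, fun a ha b hb => h3 a (List.mem_cons_of_mem _ ha) b hb⟩, ?_⟩
        intro z hz
        by_cases hz' : z ∈ y :: A
        · exact h4 z hz'
        · have hzB : z ∈ B := by simp at hz hz'; tauto
          have := h3 x (by simp) z hzB
          refine ⟨this.1, this.2.trans ⟨?_, ?_⟩⟩
          · rintro ⟨h, -⟩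
            exact absurd rfl (h4 x (List.mem_of_getLast? h)).1
          · intro h; simp at h; subst h; simp at hz'

theorem IP_reverse {l : List V} : IP G l.reverse ↔ IP G l := by
  induction l with
  | nil => simp
  | cons a l ih =>
    rw [List.reverse_cons, IP_append, ih, IP_cons (a := a) (l := l)]
    simp only [List.mem_reverse, List.mem_singleton, forall_eq, IP_single, true_and,
      List.getLast?_reverse, List.head?_cons, and_true]
    constructor
    · rintro ⟨h1, h2⟩
      exact ⟨h1, fun x hx => ⟨(h2 x hx).1.symm, by rw [G.adj_comm]; exact (h2 x hx).2⟩⟩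
    · rintro ⟨h1, h2⟩
      exact ⟨h1, fun x hx => ⟨(h2 x hx).1.symm, by rw [G.adj_comm]; exact (h2 x hx).2⟩⟩

theorem IP.left {A B : List V} (h : IP G (A ++ B)) : IP G A := (IP_append.1 h).1
theorem IP.right {A B : List V} (h : IP G (A ++ B)) : IP G B := (IP_append.1 h).2.1
theorem IP.tail {a : V} {B : List V} (h : IP G (a :: B)) : IP G B := h.1
theorem IP.rev {A : List V} (h : IP G A) : IP G A.reverse := IP_reverse.2 h
theorem IP.of_inf {A B : List V} (h : IP G A) (hB : B <:+: A) : IP G B := by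
  obtain ⟨s, t, rfl⟩ := hB
  exact h.left.right

theorem IP.nodup {A : List V} (h : IP G A) : A.Nodup := by
  induction A with
  | nil => simp
  | cons a l ih =>
    rw [List.nodup_cons]
    exact ⟨fun hh => (h.2 a hh).1 rfl, ih h.1⟩

theorem IP.chain {A : List V} (h : IP G A) : A.IsChain G.Adj := by
  induction A with
  | nil => simp
  | cons a l ih =>
    rw [List.isChain_cons]
    refine ⟨fun y hy => ((h.2 y (List.mem_of_head? hy)).2.2 hy), ih h.1⟩

/-- Symmetric characterization of hole lists. -/
theorem HL_append {A B : List V} (hA : A ≠ []) (hB : B ≠ []) : HL G (A ++ B) ↔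
    IP G A ∧ IP G B ∧ 4 ≤ A.length + B.length ∧
    ∀ a ∈ A, ∀ b ∈ B, a ≠ b ∧ (G.Adj a b ↔
      (A.getLast? = some a ∧ B.head? = some b) ∨ (A.head? = some a ∧ B.getLast? = some b)) := by
  rcases A with _ | ⟨x, A⟩
  · exact absurd rfl hA
  rw [List.cons_append, HL_cons, IP_append, IP_cons]
  rcases A with _ | ⟨y, A⟩
  · simp only [List.nil_append, IP_nil, List.not_mem_nil, List.mem_singleton,
        List.getLast?_singleton, List.length_cons, List.length_nil]
    simp
    intro _ _
    omega
  · have hl : ((y :: A) ++ B).getLast? = B.getLast? := by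
      rw [List.getLast?_append_of_ne_nil _ hB]
    rw [hl]
    simp only [List.getLast?_cons_cons, List.cons_append, List.head?_cons]
    constructor
    · rintro ⟨⟨h1, h2, h3⟩, hlen, h4⟩
      refine ⟨⟨h1, fun z hz => ⟨(h4 z (by simp at hz ⊢; tauto)).1, ?_⟩⟩, h2, ?_, ?_⟩
      · rw [(h4 z (by simp at hz ⊢; tauto)).2]
        constructor
        · rintro (h | h)
          · exact h
          · exact absurd rfl (h3 z hz z (List.mem_of_getLast? h)).1
        · exact Or.inl
      · simp at hlen ⊢; omega
      intro a ha b hb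
      rcases List.mem_cons.1 ha with rfl | ha
      · have := h4 b (by simp [hb])
        refine ⟨this.1, this.2.trans ?_⟩
        constructor
        · rintro (h | h)
          · simp at h; subst h
            exact absurd rfl (h3 y (by simp) y hb).1
          · exact Or.inr ⟨rfl, h⟩
        · rintro (⟨h, -⟩ | ⟨-, h⟩)
          · exact absurd rfl (h4 a (by
              have := List.mem_of_getLast? h
              simp at this ⊢; tauto)).1
          · exact Or.inr h
      · refine ⟨(h3 a ha b hb).1, (h3 a ha b hb).2.trans ?_⟩
        constructor
        · exact Or.inl
        · rintro (h | ⟨h, -⟩)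
          · exact h
          · simp at h; subst h
            exact absurd rfl (h4 x (by simp at ha ⊢; tauto)).1
    · rintro ⟨⟨h1, h4⟩, h2, hlen, h3⟩
      refine ⟨⟨h1, h2, fun a ha b hb => ⟨(h3 a (List.mem_cons_of_mem _ ha) b hb).1,
        (h3 a (List.mem_cons_of_mem _ ha) b hb).2.trans ?_⟩⟩, ?_, ?_⟩
      · constructor
        · rintro (h | ⟨h, -⟩)
          · exact h
          · simp at h; subst h
            exact absurd rfl (h4 x ha).1
        · exact Or.inl
      · simp at hlen ⊢; omega
      intro z hz
      by_cases hz' : z ∈ y :: A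
      · refine ⟨(h4 z hz').1, (h4 z hz').2.trans ⟨Or.inl, ?_⟩⟩
        rintro (h | h)
        · exact h
        · exact absurd rfl (h3 z (List.mem_cons_of_mem _ hz') z (List.mem_of_getLast? h)).1
      · have hzB : z ∈ B := by simp at hz hz'; tauto
        have := h3 x (by simp) z hzB
        refine ⟨this.1, this.2.trans ⟨?_, ?_⟩⟩
        · rintro (⟨h, -⟩ | ⟨-, h⟩)
          · exact absurd rfl (h4 x (List.mem_of_getLast? h)).1
          · exact Or.inr h
        · rintro (h | h)
          · simp at h; subst h; simp at hz'
          · exact Or.inr ⟨rfl, h⟩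

theorem HL.rot {A B : List V} (h : HL G (A ++ B)) : HL G (B ++ A) := by
  rcases eq_or_ne A [] with rfl | hA
  · simpa using h
  rcases eq_or_ne B [] with rfl | hB
  · simpa using h
  rw [HL_append hA hB] at h
  rw [HL_append hB hA]
  refine ⟨h.2.1, h.1, by omega, fun a ha b hb => ⟨(h.2.2.2 b hb a ha).1.symm, ?_⟩⟩
  rw [G.adj_comm, (h.2.2.2 b hb a ha).2]
  tauto

theorem HL.rev {l : List V} (h : HL G l) : HL G l.reverse := by
  rcases l with _ | ⟨a, l⟩
  · exact h
  rw [List.reverse_cons]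
  apply HL.rot
  rw [List.singleton_append, HL_cons]
  refine ⟨h.1.rev, by simpa using h.2.1, fun x hx => ⟨(h.2.2 x (by simpa using hx)).1, ?_⟩⟩
  rw [(h.2.2 x (by simpa using hx)).2]
  simp; tauto

theorem HL.rev' {a : V} {l : List V} (h : HL G (a :: l)) : HL G (a :: l.reverse) := by
  have := h.rev
  rw [List.reverse_cons] at this
  exact this.rot

theorem HL.tail {a : V} {l : List V} (h : HL G (a :: l)) : IP G l := h.1

theorem HL.left {A B : List V} (h : HL G (A ++ B)) (hB : B ≠ []) : IP G A := by
  rcases eq_or_ne A [] with rfl | hA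
  · simp
  · exact ((HL_append hA hB).1 h).1

theorem HL.right {A B : List V} (h : HL G (A ++ B)) (hA : A ≠ []) : IP G B :=
  h.rot.left hA

theorem HL.nodup {A : List V} (h : HL G A) : A.Nodup := by
  rcases A with _ | ⟨a, l⟩
  · exact h.elim
  rw [List.nodup_cons]
  exact ⟨fun hh => (h.2.2 a hh).1 rfl, h.1.nodup⟩

theorem HL.length {A : List V} (h : HL G A) : 4 ≤ A.length := by
  rcases A with _ | ⟨a, l⟩
  · exact h.elim
  have := h.2.1
  simp; omega

/-- rotate so that a given vertex comes first -/
theorem HL.rotTo {l : List V} (h : HL G l) {a : V} (ha : a ∈ l) :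
    ∃ l', HL G (a :: l') ∧ (a :: l').Perm l := by
  obtain ⟨s, t, rfl⟩ := List.append_of_mem ha
  refine ⟨t ++ s, ?_, ?_⟩
  · have := h.rot
    simpa using this
  · rw [← List.cons_append]
    exact List.perm_append_comm

/-- rotate/reflect so that a given edge comes first -/
theorem HL.rotEdge {l : List V} (h : HL G l) {a b : V} (ha : a ∈ l) (hb : b ∈ l)
    (hab : G.Adj a b) : ∃ l', HL G (a :: b :: l') ∧ (a :: b :: l').Perm l := by
  obtain ⟨l', h1, h2⟩ := h.rotTo ha
  have hb' : b ∈ l' := by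
    have : b ∈ a :: l' := h2.mem_iff.2 hb
    rcases List.mem_cons.1 this with rfl | h
    · exact absurd hab (G.irrefl)
    · exact h
  rcases ((h1.2.2 b hb').2.1 hab) with h | h
  · rcases l' with _ | ⟨c, l'⟩
    · simp at h
    · simp at h; subst h
      exact ⟨l', h1, h2⟩
  · obtain ⟨m, rfl⟩ : ∃ m, l' = m ++ [b] := by
      rw [List.getLast?_eq_some_iff] at h
      exact h
    refine ⟨m.reverse, by simpa using h1.rev', ?_⟩
    refine List.Perm.trans ?_ h2
    refine List.Perm.cons _ ?_
    simpa using List.reverse_perm (m ++ [b])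

end Part1

section Part2
variable {V : Type*} {G : SimpleGraph V}

theorem IP.getElem {l : List V} (h : IP G l) {i j : ℕ} (hij : i < j) (hj : j < l.length) :
    G.Adj (l[i]) (l[j]) ↔ j = i + 1 := by
  induction l generalizing i j with
  | nil => simp at hj
  | cons a l ih =>
    rcases j with _ | j
    · omega
    have hj' : j < l.length := by simpa using hj
    rcases i with _ | i
    · simp only [List.getElem_cons_zero, List.getElem_cons_succ]
      rw [(h.2 _ (List.getElem_mem hj')).2, List.head?_eq_getElem?]
      rw [List.getElem?_eq_getElem (by omega), Option.some_inj,
        (h.1.nodup).getElem_inj_iff]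
      omega
    · simp only [List.getElem_cons_succ]
      rw [ih h.1 (by omega) hj']
      omega

theorem HL.getElem {l : List V} (h : HL G l) {i j : ℕ} (hij : i < j) (hj : j < l.length) :
    G.Adj (l[i]) (l[j]) ↔ j = i + 1 ∨ (i = 0 ∧ j = l.length - 1) := by
  rcases l with _ | ⟨a, l⟩
  · exact h.elim
  rcases j with _ | j
  · omega
  have hj' : j < l.length := by simpa using hj
  rcases i with _ | i
  · simp only [List.getElem_cons_zero, List.getElem_cons_succ]
    rw [(h.2.2 _ (List.getElem_mem hj')).2, List.head?_eq_getElem?, List.getLast?_eq_getElem?]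
    rw [List.getElem?_eq_getElem (by omega), List.getElem?_eq_getElem (by omega),
      Option.some_inj, Option.some_inj,
      (h.1.nodup).getElem_inj_iff, (h.1.nodup).getElem_inj_iff]
    simp
    omega
  · simp only [List.getElem_cons_succ]
    rw [h.1.getElem (by omega) hj']
    omega

theorem HL.isHoleSet {l : List V} (h : HL G l) : IsHoleSet G {v | v ∈ l} := by
  classical
  refine ⟨l.length, h.length, ⟨RelIso.symm ⟨h.nodup.getEquiv, ?_⟩⟩⟩
  have hlen := h.length
  intro i j
  show G.Adj (l[i.1]) (l[j.1]) ↔ _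
  rw [cycleGraph_adj']
  have key : ∀ i j : Fin l.length, i.1 < j.1 → (G.Adj (l[i.1]) (l[j.1]) ↔ 
      ((i - j).val = 1 ∨ (j - i).val = 1)) := by
    intro i j hij
    rw [h.getElem hij j.2]
    rw [Fin.sub_val_of_le (show i ≤ j from hij.le)]
    rw [Fin.val_sub]
    have := i.2
    have := j.2
    rw [Nat.mod_eq_of_lt (by omega)]
    omega
  rcases lt_trichotomy i.1 j.1 with hij | hij | hij
  · exact key i j hij
  · have : i = j := Fin.ext hij
    subst this
    have : i - i = ⟨0, by omega⟩ := by
      apply Fin.ext; rw [Fin.sub_val_of_le le_rfl]; simp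
    simp [this]
  · rw [G.adj_comm, key j i hij]
    tauto

/-- number of neighbours of `r` in the list -/
noncomputable def cnt (G : SimpleGraph V) (r : V) (l : List V) : ℕ :=
  haveI := Classical.decPred (G.Adj r); l.countP (fun x => decide (G.Adj r x))

theorem cnt_nil {r : V} : cnt G r [] = 0 := rfl

theorem cnt_cons_pos {r a : V} {l : List V} (h : G.Adj r a) : cnt G r (a :: l) = cnt G r l + 1 := by
  simp [cnt, h]

theorem cnt_cons_neg {r a : V} {l : List V} (h : ¬ G.Adj r a) : cnt G r (a :: l) = cnt G r l := by
  simp [cnt, h]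

theorem cnt_append {r : V} {A B : List V} : cnt G r (A ++ B) = cnt G r A + cnt G r B := by
  simp [cnt]

theorem cnt_reverse {r : V} {A : List V} : cnt G r A.reverse = cnt G r A := by
  simp [cnt]

theorem cnt_perm {r : V} {A B : List V} (h : A.Perm B) : cnt G r A = cnt G r B := by
  simp [cnt, h.countP_eq]

theorem cnt_zero {r : V} {A : List V} (h : ∀ x ∈ A, ¬ G.Adj r x) : cnt G r A = 0 := by
  simp [cnt, List.countP_eq_zero]; exact h

theorem cnt_pos {r : V} {A : List V} (h : 0 < cnt G r A) : ∃ x ∈ A, G.Adj r x := by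
  by_contra hh
  push Not at hh
  rw [cnt_zero hh] at h
  omega

theorem ncard_nbrsIn {r : V} {l : List V} (h : l.Nodup) :
    (nbrsIn G {v | v ∈ l} r).ncard = cnt G r l := by
  classical
  have : nbrsIn G {v | v ∈ l} r = ((l.filter (fun x => decide (G.Adj r x))).toFinset : Set V) := by
    ext x; simp [nbrsIn]
  rw [this, Set.ncard_coe_finset, List.toFinset_card_of_nodup (h.filter _),
    ← List.countP_eq_length_filter]
  unfold cnt
  congr

theorem no_evenwheel (hG : InC G) {l : List V} {r : V} (h : HL G l) (hr : r ∉ l)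
    (h3 : 3 ≤ cnt G r l) (he : Even (cnt G r l)) : False := by
  apply hG.2.2.2.2.2
  refine ⟨{v | v ∈ l}, r, ⟨h.isHoleSet, hr, ?_⟩, ?_⟩
  · rwa [ncard_nbrsIn h.nodup]
  · rwa [ncard_nbrsIn h.nodup]

theorem pairHole_of {a b c d : V} {P : G.Walk a b} {Q : G.Walk c d} {l : List V}
    (h : HL G l) (hl : ∀ v, v ∈ l ↔ v ∈ P.support ∨ v ∈ Q.support) : PairHole G P Q := by
  have := h.isHoleSet
  unfold PairHole
  convert this using 1
  ext v; simp [hl]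

/-- walk from an induced path list -/
theorem walk_of {a b : V} {l : List V} (h : IP G l) (ha : l.head? = some a)
    (hb : l.getLast? = some b) : ∃ P : G.Walk a b, P.IsPath ∧ P.support = l := by
  have hne : l ≠ [] := by rintro rfl; simp at ha
  have h1 : l.head hne = a := by
    rw [List.head?_eq_some_head hne] at ha; simpa using ha
  have h2 : l.getLast hne = b := by
    rw [List.getLast?_eq_some_getLast hne] at hb; simpa using hb
  subst h1 h2
  refine ⟨Walk.ofSupport l hne h.chain, ?_, by simp⟩
  rw [Walk.isPath_def]
  simpa using h.nodup

theorem no_theta (hG : InC G) {a b : V} {A B C : List V} (hA : A ≠ []) (hB : B ≠ []) (hC : C ≠ [])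
    (h1 : HL G (a :: A ++ b :: B.reverse)) (h2 : HL G (a :: A ++ b :: C.reverse))
    (h3 : HL G (a :: B ++ b :: C.reverse)) : False := by
  apply hG.2.2.1
  have hp : ∀ {X Y : List V}, Y ≠ [] → HL G (a :: X ++ b :: Y.reverse) → IP G (a :: X ++ [b]) := by
    intro X Y hY h
    have : HL G ((a :: X ++ [b]) ++ Y.reverse) := by simpa using h
    exact this.left (by simpa using hY)
  have hC' : IP G (a :: C ++ [b]) := by
    refine hp hA ?_
    have := h2.rev'
    simpa using this
  obtain ⟨P1, p1, q1⟩ := walk_of (a := a) (b := b) (hp hB h1) (by simp) (by simp)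
  obtain ⟨P2, p2, q2⟩ := walk_of (a := a) (b := b) (hp hC h3) (by simp) (by simp)
  obtain ⟨P3, p3, q3⟩ := walk_of (a := a) (b := b) hC' (by simp) (by simp)
  have hab := h1.2.2 b (by simp)
  refine ⟨a, b, P1, P2, P3, hab.1, ?_, p1, p2, p3, pairHole_of h1 ?_, pairHole_of h2 ?_, 
    pairHole_of h3 ?_⟩
  · rw [hab.2]
    have hnd := h1.nodup
    rintro (h | h)
    · rcases A with _ | ⟨c, A⟩
      · simp at hA
      · simp at h; subst h; simp at hnd
    · rcases B with _ | ⟨c, B⟩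
      · simp at hB
      · have h : (A ++ b :: (c :: B).reverse).getLast? = some b := h
        have : c = b := by simpa using h
        subst this; simp at hnd
        have := hnd.2
        rw [List.nodup_append] at this
        simp at this
  · intro v; rw [q1, q2]; clear * -; grind
  · intro v; rw [q1, q3]; clear * -; grind
  · intro v; rw [q2, q3]; clear * -; grind

theorem no_pyramid (hG : InC G) {a b1 b2 b3 : V} {A1 A2 A3 : List V}
    (h1 : HL G (a :: A1 ++ b1 :: b2 :: A2.reverse)) (h2 : HL G (a :: A1 ++ b1 :: b3 :: A3.reverse))
    (h3 : HL G (a :: A2 ++ b2 :: b3 :: A3.reverse)) : False := by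
  apply hG.2.2.2.1
  have hp : ∀ {X Y : List V} {x y : V}, HL G (a :: X ++ x :: y :: Y.reverse) → 
      IP G (a :: X ++ [x]) ∧ G.Adj x y ∧ a ≠ x := by
    intro X Y x y h
    have h' : HL G ((a :: X ++ [x]) ++ y :: Y.reverse) := by simpa using h
    have h'' := (HL_append (by simp) (by simp)).1 h'
    exact ⟨h'.left (by simp), (h''.2.2.2 x (by simp) y (by simp)).2.2 (by simp), 
      (h.2.2 x (by simp)).1⟩
  have h4 : HL G (a :: A3 ++ b3 :: b1 :: A1.reverse) := by
    have := h2.rev'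
    simpa using this
  obtain ⟨P1, p1, q1⟩ := walk_of (a := a) (b := b1) (hp h1).1 (by simp) (by simp)
  obtain ⟨P2, p2, q2⟩ := walk_of (a := a) (b := b2) (hp h3).1 (by simp) (by simp)
  obtain ⟨P3, p3, q3⟩ := walk_of (a := a) (b := b3) (hp h4).1 (by simp) (by simp)
  refine ⟨a, b1, b2, b3, P1, P2, P3, (hp h1).2.1, (hp h2).2.1, (hp h3).2.1, (hp h1).2.2,
    (hp h3).2.2, (hp h4).2.2, p1, p2, p3, pairHole_of h1 ?_, pairHole_of h2 ?_, 
    pairHole_of h3 ?_⟩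
  · intro v; rw [q1, q2]; clear * -; grind
  · intro v; rw [q1, q3]; clear * -; grind
  · intro v; rw [q2, q3]; clear * -; grind

theorem no_prism (hG : InC G) {a1 a2 a3 b1 b2 b3 : V} {A1 A2 A3 : List V}
    (h1 : HL G ((a1 :: A1 ++ [b1]) ++ (b2 :: A2.reverse ++ [a2])))
    (h2 : HL G ((a1 :: A1 ++ [b1]) ++ (b3 :: A3.reverse ++ [a3])))
    (h3 : HL G ((a2 :: A2 ++ [b2]) ++ (b3 :: A3.reverse ++ [a3]))) : False := by
  apply hG.2.2.2.2.1
  have hp : ∀ {X Y : List V} {x x' y y' : V}, 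
      HL G ((x :: X ++ [x']) ++ (y' :: Y.reverse ++ [y])) → 
      IP G (x :: X ++ [x']) ∧ G.Adj x y ∧ G.Adj x' y' ∧ x ≠ x' ∧ x ≠ y' ∧ x' ≠ y := by
    intro X Y x x' y y' h
    have h'' := (HL_append (by simp) (by simp)).1 h
    refine ⟨h''.1, (h''.2.2.2 x (by simp) y (by simp)).2.2 (by simp),
      (h''.2.2.2 x' (by simp) y' (by simp)).2.2 (by simp),
      (h.2.2 x' (by simp)).1, (h''.2.2.2 x (by simp) y' (by simp)).1,
      (h''.2.2.2 x' (by simp) y (by simp)).1⟩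
  have h4 : HL G ((a3 :: A3 ++ [b3]) ++ (b1 :: A1.reverse ++ [a1])) := by
    have := h2.rev
    simpa using this
  obtain ⟨P1, p1, q1⟩ := walk_of (a := a1) (b := b1) (hp h1).1 (by simp) (by simp)
  obtain ⟨P2, p2, q2⟩ := walk_of (a := a2) (b := b2) (hp h3).1 (by simp) (by simp)
  obtain ⟨P3, p3, q3⟩ := walk_of (a := a3) (b := b3) (hp h4).1 (by simp) (by simp)
  have e1 := hp h1
  have e2 := hp h2
  have e3 := hp h3
  have e4 := hp h4
  refine ⟨a1, a2, a3, b1, b2, b3, P1, P2, P3, e1.2.1, e2.2.1, e3.2.1, e1.2.2.1, e2.2.2.1,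
    e3.2.2.1, ?_, p1, p2, p3, pairHole_of h1 ?_, pairHole_of h2 ?_, 
    pairHole_of h3 ?_⟩
  · ext x; simp only [Set.mem_inter_iff, Set.mem_insert_iff, Set.mem_singleton_iff,
      Set.mem_empty_iff_false, iff_false]
    grind
  · intro v; rw [q1, q2]; clear * -; grind
  · intro v; rw [q1, q3]; clear * -; grind
  · intro v; rw [q2, q3]; clear * -; grind

theorem CN (hG : InC G) {a b x y : V} (hab : a ≠ b) (hnab : ¬ G.Adj a b) (hx : G.Adj x a)
    (hx' : G.Adj x b) (hy : G.Adj y a) (hy' : G.Adj y b) : x = y := by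
  by_contra hxy
  have e1 := hx.ne; have e2 := hx'.ne; have e3 := hy.ne; have e4 := hy'.ne
  by_cases h : G.Adj x y
  · apply hG.2.1
    let f : Fin 4 → V := ![a, b, x, y]
    have hf : Function.Injective f := by
      intro i j
      fin_cases i <;> fin_cases j <;> simp [f] <;> grind
    refine ⟨Set.range f, ⟨RelIso.symm ⟨Equiv.ofInjective f hf, ?_⟩⟩⟩
    intro i j
    simp only [comap_adj, Function.Embedding.subtype_apply, Equiv.ofInjective_apply]
    have := hx.symm; have := hx'.symm; have := hy.symm; have := hy'.symm; have := h.symm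
    have : ¬ G.Adj b a := fun h => hnab h.symm
    fin_cases i <;> fin_cases j <;> simp [f, diamond, *]
  · apply hG.1
    let f : Fin 4 → V := ![a, x, b, y]
    have hf : Function.Injective f := by
      intro i j
      fin_cases i <;> fin_cases j <;> simp [f] <;> grind
    refine ⟨Set.range f, ⟨RelIso.symm ⟨Equiv.ofInjective f hf, ?_⟩⟩⟩
    intro i j
    simp only [comap_adj, Function.Embedding.subtype_apply, Equiv.ofInjective_apply]
    have := hx.symm; have := hx'.symm; have := hy.symm; have := hy'.symm
    have : ¬ G.Adj b a := fun h => hnab h.symm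
    have : ¬ G.Adj y x := fun h' => h h'.symm
    rw [cycleGraph_adj]
    fin_cases i <;> fin_cases j <;> simp [f, *] <;> decide

end Part2

section Part3
variable {V : Type*} {G : SimpleGraph V}

/-- linked inside `S` -/
def Lk (G : SimpleGraph V) (S : Set V) (x y : V) : Prop :=
  Relation.ReflTransGen (fun a b => G.Adj a b ∧ a ∈ S ∧ b ∈ S) x y

theorem Lk.refl {S : Set V} {x : V} : Lk G S x x := Relation.ReflTransGen.refl
theorem Lk.symm {S : Set V} {x y : V} (h : Lk G S x y) : Lk G S y x := by
  induction h with
  | refl => exact Lk.refl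
  | tail _ h ih => exact Relation.ReflTransGen.head ⟨h.1.symm, h.2.2, h.2.1⟩ ih
theorem Lk.trans {S : Set V} {x y z : V} (h : Lk G S x y) (h' : Lk G S y z) : Lk G S x z :=
  Relation.ReflTransGen.trans h h'
theorem Lk.mono {S T : Set V} {x y : V} (h : Lk G S x y) (hST : S ⊆ T) : Lk G T x y := by
  induction h with
  | refl => exact Lk.refl
  | tail _ h ih => exact Relation.ReflTransGen.tail ih ⟨h.1, hST h.2.1, hST h.2.2⟩
theorem Lk.step {S : Set V} {x y : V} (h : G.Adj x y) (hx : x ∈ S) (hy : y ∈ S) : Lk G S x y :=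
  Relation.ReflTransGen.single ⟨h, hx, hy⟩
theorem Lk.mem {S : Set V} {x y : V} (h : Lk G S x y) (hx : x ∈ S) : y ∈ S := by
  induction h with
  | refl => exact hx
  | tail _ h ih => exact h.2.2

theorem Lk.of_chain {S : Set V} {a : V} {l : List V} (h : (a :: l).IsChain G.Adj)
    (hS : ∀ v ∈ a :: l, v ∈ S) : ∀ v ∈ a :: l, Lk G S a v := by
  induction l generalizing a with
  | nil => intro v hv; simp at hv; subst hv; exact Lk.refl
  | cons b l ih =>
    rw [List.isChain_cons_cons] at h
    have := ih h.2 (fun v hv => hS v (List.mem_cons_of_mem _ hv))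
    intro v hv
    rcases List.mem_cons.1 hv with rfl | hv
    · exact Lk.refl
    · exact (Lk.step h.1 (hS _ (by simp)) (hS _ (by simp))).trans (this v hv)

theorem IP.lk {S : Set V} {l : List V} (h : IP G l) (hS : ∀ v ∈ l, v ∈ S) {x y : V}
    (hx : x ∈ l) (hy : y ∈ l) : Lk G S x y := by
  rcases l with _ | ⟨a, l⟩
  · simp at hx
  exact (Lk.of_chain h.chain hS x hx).symm.trans (Lk.of_chain h.chain hS y hy)

theorem exists_first {p : V → Prop} {l : List V} (h : ∃ x ∈ l, p x) :
    ∃ s a t, l = s ++ a :: t ∧ p a ∧ ∀ x ∈ s, ¬ p x := by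
  induction l with
  | nil => simp at h
  | cons b l ih =>
    by_cases hb : p b
    · exact ⟨[], b, l, by simp, hb, by simp⟩
    · obtain ⟨x, hx, hpx⟩ := h
      have : x ∈ l := by
        rcases List.mem_cons.1 hx with rfl | h
        · exact absurd hpx hb
        · exact h
      obtain ⟨s, a, t, rfl, ha, hs⟩ := ih ⟨x, this, hpx⟩
      refine ⟨b :: s, a, t, by simp, ha, ?_⟩
      intro y hy
      rcases List.mem_cons.1 hy with rfl | hy
      · exact hb
      · exact hs y hy

theorem exists_last {p : V → Prop} {l : List V} (h : ∃ x ∈ l, p x) :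
    ∃ s a t, l = s ++ a :: t ∧ p a ∧ ∀ x ∈ t, ¬ p x := by
  obtain ⟨s, a, t, h1, h2, h3⟩ := exists_first (p := p) (l := l.reverse) (by simpa using h)
  refine ⟨t.reverse, a, s.reverse, ?_, h2, by simpa using h3⟩
  have := congrArg List.reverse h1
  simpa using this

theorem IP_of_splits {l : List V} (h : ∀ s a t, l = s ++ a :: t → ∀ x ∈ t,
    a ≠ x ∧ (G.Adj a x ↔ t.head? = some x)) : IP G l := by
  induction l with
  | nil => simp
  | cons b l ih =>
    refine ⟨ih fun s a t hl x hx => h (b :: s) a t (by simp [hl]) x hx, h [] b l rfl⟩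

theorem SP {S X Y : Set V} {x y : V} (hx : x ∈ X) (hy : y ∈ Y) (hxS : x ∈ S) (h : Lk G S x y) :
    ∃ l, IP G l ∧ (∀ v ∈ l, v ∈ S) ∧ (∃ s, l.head? = some s ∧ s ∈ X) ∧
      (∃ t, l.getLast? = some t ∧ t ∈ Y) ∧ (∀ v ∈ l, v ∈ X → l.head? = some v) ∧
      (∀ v ∈ l, v ∈ Y → l.getLast? = some v) := by
  classical
  let Good : List V → Prop := fun l => l.IsChain G.Adj ∧ (∀ v ∈ l, v ∈ S) ∧
    (∃ s, l.head? = some s ∧ s ∈ X) ∧ (∃ t, l.getLast? = some t ∧ t ∈ Y)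
  have hex : ∃ n, ∃ l, Good l ∧ l.length = n := by
    obtain ⟨l, hl, hl'⟩ := List.exists_isChain_cons_of_relationReflTransGen h
    refine ⟨_, x :: l, ⟨hl.imp fun _ _ h => h.1, ?_, ⟨x, rfl, hx⟩, ⟨y, ?_, hy⟩⟩, rfl⟩
    · clear hl'
      induction l generalizing x with
      | nil => intro v hv; simp at hv; subst hv; exact hxS
      | cons b l ih =>
        rw [List.isChain_cons_cons] at hl
        intro v hv
        rcases List.mem_cons.1 hv with rfl | hv
        · exact hxS
        · by_cases hb : b ∈ X
          · refine ih hb hl.1.2.2 ?_ hl.2 v hv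
            exact Lk.trans (Lk.step hl.1.1.symm hl.1.2.2 hxS) h
          · have : ∀ {z : V} {l : List V}, z ∈ S →
                (z :: l).IsChain (fun a b => G.Adj a b ∧ a ∈ S ∧ b ∈ S) → ∀ v ∈ z :: l, v ∈ S := by
              intro z l
              induction l generalizing z with
              | nil => intro hz _ v hv; simp at hv; subst hv; exact hz
              | cons c l ih2 =>
                intro hz hc v hv
                rw [List.isChain_cons_cons] at hc
                rcases List.mem_cons.1 hv with rfl | hv
                · exact hz
                · exact ih2 hc.1.2.2 hc.2 v hv
            exact this hl.1.2.2 hl.2 v hv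
    · rw [List.getLast?_eq_some_getLast (by simp)]; simpa using hl'
  obtain ⟨l, hl, hlen⟩ := Nat.find_spec hex
  have hmin : ∀ l', Good l' → l.length ≤ l'.length := by
    intro l' hl'
    rw [hlen]
    exact Nat.find_min' hex ⟨l', hl', rfl⟩
  obtain ⟨h1, h2, h3, h4⟩ := hl
  refine ⟨l, IP_of_splits ?_, h2, h3, h4, ?_, ?_⟩
  · rintro s a t rfl x hxt
    obtain ⟨t1, t2, rfl⟩ := List.append_of_mem hxt
    rw [List.isChain_append, List.isChain_cons, List.isChain_append] at h1
    constructor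
    · rintro rfl
      have := hmin (s ++ a :: t2) ⟨?_, ?_, ?_, ?_⟩
      · simp at this; omega
      · rw [List.isChain_append]
        exact ⟨h1.1, h1.2.1.2.2.1, by simpa using h1.2.2⟩
      · intro v hv; apply h2; simp at hv ⊢; grind
      · rcases s with _ | ⟨c, s⟩ <;> simpa using h3
      · simpa using h4
    · constructor
      · intro hax
        rcases t1 with _ | ⟨c, t1⟩
        · simp
        have := hmin (s ++ a :: x :: t2) ⟨?_, ?_, ?_, ?_⟩
        · simp at this; omega
        · rw [List.isChain_append, List.isChain_cons_cons]
          exact ⟨h1.1, ⟨hax, h1.2.1.2.2.1⟩, by simpa using h1.2.2⟩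
        · intro v hv; apply h2; simp at hv ⊢; grind
        · rcases s with _ | ⟨c, s⟩ <;> simpa using h3
        · simp at h4 ⊢; exact h4
      · intro hh
        exact h1.2.1.1 x hh
  · intro v hv hvX
    obtain ⟨s, t, rfl⟩ := List.append_of_mem hv
    rcases s with _ | ⟨c, s⟩
    · simp
    rw [List.isChain_append] at h1
    have := hmin (v :: t) ⟨h1.2.1, ?_, ?_, ?_⟩
    · simp at this; omega
    · intro w hw; apply h2; simp at hw ⊢; grind
    · simpa using hvX
    · simpa using h4
  · intro v hv hvX
    obtain ⟨s, t, rfl⟩ := List.append_of_mem hv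
    rcases t with _ | ⟨c, t⟩
    · simp
    have h1' : ((s ++ [v]) ++ (c :: t)).IsChain G.Adj := by simpa using h1
    rw [List.isChain_append] at h1'
    have := hmin (s ++ [v]) ⟨h1'.1, ?_, ?_, ?_⟩
    · simp at this
    · intro w hw; apply h2; simp at hw ⊢; grind
    · rcases s with _ | ⟨c, s⟩ <;> simpa using h3
    · simpa using hvX

/-- close an induced path by a vertex -/
theorem HL_of_IP {a b r : V} {A : List V} (h : IP G (a :: A ++ [b])) (hA : A ≠ [])
    (hr : r ∉ a :: A ++ [b]) (hra : G.Adj r a) (hrb : G.Adj r b) (hrA : ∀ x ∈ A, ¬ G.Adj r x) :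
    HL G (r :: a :: A ++ [b]) := by
  rw [List.cons_append, HL_cons]
  refine ⟨h, ?_, ?_⟩
  · have := List.length_pos_iff.2 hA
    simp; omega
  · intro x hx
    refine ⟨fun e => hr (e ▸ hx), ?_⟩
    have hnd := h.nodup
    simp only [List.cons_append, List.head?_cons, getLast?_cons_app, List.getLast?_singleton,
      Option.some_inj]
    simp only [List.cons_append, List.mem_cons, List.mem_append, List.not_mem_nil, or_false] at hx
    constructor
    · intro hrx
      rcases hx with rfl | hx | rfl
      · exact Or.inl rfl
      · exact absurd hrx (hrA x hx)
      · exact Or.inr rfl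
    · rintro (rfl | rfl) <;> assumption

theorem HL.no_tri {l : List V} (h : HL G l) {x y z : V} (hx : x ∈ l) (hy : y ∈ l) (hz : z ∈ l)
    (hxy : G.Adj x y) (hyz : G.Adj y z) (hxz : G.Adj x z) : False := by
  obtain ⟨L, h1, h2⟩ := h.rotEdge hx hy hxy
  have hz' : z ∈ L := by
    have : z ∈ x :: y :: L := h2.mem_iff.2 hz
    have := hyz.ne; have := hxz.ne
    simp at *; grind
  have e1 := (h1.1.2 z hz').2.1 hyz
  have e2 := (h1.2.2 z (by simp [hz'])).2.1 hxz
  have hn := h1.nodup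
  have hlen := h1.length
  rcases L with _ | ⟨c, _ | ⟨d, L⟩⟩
  · simp at hlen
  · simp at hlen
  · simp at e1; subst e1
    simp at e2
    rcases e2 with e2 | e2
    · subst e2; exact hyz.ne rfl
    · have := List.mem_of_getLast? e2
      simp at hn this; grind

/-- two common nonadjacent neighbours of a hole vertex -/
theorem mem_of_ne {l : List V} {a x : V} (h : x ∈ a :: l) (hne : x ≠ a) : x ∈ l := by
  rcases List.mem_cons.1 h with h | h
  · exact absurd h hne
  · exact h

theorem LemmaA0 (hG : InC G) {l : List V} {r a b c : V} (h : HL G l) (hr : r ∉ l)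
    (ha : a ∈ l) (hb : b ∈ l) (hc : c ∈ l) (hra : G.Adj r a) (hrb : G.Adj r b) (hrc : G.Adj r c)
    (hac : G.Adj a c) (hab : a ≠ b) (hnab : ¬ G.Adj a b) (hcb : c ≠ b) (hodd : Odd (cnt G r l)) :
    ∃ d ∈ l, G.Adj r d ∧ d ≠ a ∧ d ≠ b ∧ ¬ G.Adj d a ∧ ¬ G.Adj d b := by
  by_contra hno
  push Not at hno
  have hrc' : r ≠ c := fun e => hr (e ▸ hc)
  have hncb : ¬ G.Adj c b := fun hcb => hrc' (CN hG hab hnab hra hrb hac.symm hcb)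
  obtain ⟨L, h1, h2⟩ := h.rotEdge ha hc hac
  have hbL : b ∈ L := by
    have : b ∈ a :: c :: L := h2.mem_iff.2 hb
    exact mem_of_ne (mem_of_ne this hab.symm) hcb.symm
  obtain ⟨L1, L2, rfl⟩ := List.append_of_mem hbL
  have hL1 : L1 ≠ [] := by
    rintro rfl
    exact hncb ((h1.1.2 b (by simp)).2.2 (by simp))
  have hL2 : L2 ≠ [] := by
    rintro rfl
    exact hnab ((h1.2.2 b (by simp)).2.2 (by simp))
  have hcnt : cnt G r l = 3 + (cnt G r (L1 ++ L2)) := by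
    rw [← cnt_perm h2, cnt_cons_pos hra, cnt_cons_pos hrc, cnt_append, cnt_cons_pos hrb,
      cnt_append]
    omega
  have hrL : ∀ x ∈ a :: c :: (L1 ++ b :: L2), r ≠ x := fun x hx e => hr (h2.mem_iff.1 (e ▸ hx))
  have hnd := h1.nodup
  by_cases h0 : cnt G r (L1 ++ L2) = 0
  · have hz : ∀ x ∈ L1 ++ L2, ¬ G.Adj r x := by
      intro x hx hrx
      obtain ⟨s, t, hst⟩ := List.append_of_mem hx
      rw [hst, cnt_append, cnt_cons_pos hrx] at h0
      omega
    have e1 : HL G (b :: L2 ++ a :: c :: (L1.reverse).reverse) := by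
      have : HL G ((a :: c :: L1) ++ (b :: L2)) := by simpa using h1
      simpa using this.rot
    have p1 : IP G (b :: L2 ++ [a]) := by
      have : HL G ((b :: L2 ++ [a]) ++ (c :: L1)) := by simpa using e1
      exact this.left (by simp)
    have p2 : IP G (c :: L1 ++ [b]) := by
      have : HL G ((c :: L1 ++ [b]) ++ (L2 ++ [a])) := by
        have : HL G ([a] ++ (c :: L1 ++ [b] ++ L2)) := by simpa using h1
        simpa using this.rot
      exact this.left (by simp)
    have e2 : HL G (r :: b :: L2 ++ [a]) := by
      refine HL_of_IP p1 hL2 ?_ hrb hra (fun x hx => hz x (by simp [hx]))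
      intro hh; exact hrL r (by simp at hh ⊢; grind) rfl
    have e3 : HL G (r :: c :: L1 ++ [b]) := by
      refine HL_of_IP p2 hL1 ?_ hrc hrb (fun x hx => hz x (by simp [hx]))
      intro hh; exact hrL r (by simp at hh ⊢; grind) rfl
    refine no_pyramid hG (a := b) (A1 := []) (b1 := r) (A2 := L2) (b2 := a) (A3 := L1.reverse)
      (b3 := c) ?_ ?_ e1
    · have := e2.rot (A := [r]) (B := b :: L2 ++ [a])
      have := this.rev'
      simpa using this
    · have : HL G ((r :: c :: L1) ++ [b]) := by simpa using e3
      simpa using this.rot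
  · obtain ⟨d, hd, hrd⟩ := cnt_pos (Nat.pos_of_ne_zero h0)
    have hnob : ∀ d, d ∈ L1 ++ L2 → G.Adj r d → G.Adj d b := by
      intro d hd hrd
      have hdl : d ∈ a :: c :: (L1 ++ b :: L2) := by simp at hd ⊢; grind
      have hda : d ≠ a := by rintro rfl; simp at hnd hd; grind
      have hdb : d ≠ b := by
        rintro rfl
        have : (d :: (L1 ++ L2)).Nodup := by
          have := (List.nodup_cons.1 (List.nodup_cons.1 hnd).2).2
          exact (List.nodup_middle.1 this)
        exact (List.nodup_cons.1 this).1 hd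
      have hdc : d ≠ c := by rintro rfl; simp at hnd hd; grind
      refine hno d (h2.mem_iff.1 hdl) hrd hda hdb ?_
      intro hda
      have hdc' : ¬ G.Adj d c := fun hdc => h1.no_tri (x := d) (y := a) (z := c) hdl (by simp)
        (by simp) hda hac hdc
      exact hrL a (by simp) (CN hG hdc hdc' hrd hrc hda.symm hac)
    obtain ⟨s, t, hst⟩ := List.append_of_mem hd
    have hcnt2 : cnt G r (L1 ++ L2) = 1 + cnt G r (s ++ t) := by
      rw [hst, cnt_append, cnt_cons_pos hrd, cnt_append]; omega
    obtain ⟨e, he, hre⟩ : ∃ e ∈ s ++ t, G.Adj r e := by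
      apply cnt_pos
      rcases Nat.eq_zero_or_pos (cnt G r (s ++ t)) with h | h
      · rw [hcnt, hcnt2, h] at hodd
        exact absurd hodd (by decide)
      · exact h
    have hde : d ≠ e := by
      rintro rfl
      have h3 : (L1 ++ b :: L2).Nodup := (List.nodup_cons.1 (List.nodup_cons.1 hnd).2).2
      have h4 := (List.nodup_cons.1 (List.nodup_middle.1 h3)).2
      rw [hst] at h4
      exact (List.nodup_cons.1 (List.nodup_middle.1 h4)).1 he
    have he' : e ∈ L1 ++ L2 := by rw [hst]; simp at he ⊢; grind
    have hdl : d ∈ a :: c :: (L1 ++ b :: L2) := by simp at hd ⊢; grind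
    have hel : e ∈ a :: c :: (L1 ++ b :: L2) := by simp at he' ⊢; grind
    have hdb := hnob d hd hrd
    have heb := hnob e he' hre
    have hnde : ¬ G.Adj d e := fun hde => h1.no_tri (x := d) (y := b) (z := e) hdl (by simp)
        hel hdb heb.symm hde
    exact hrL b (by simp) (CN hG hde hnde hrd hre hdb.symm heb.symm)

theorem LemmaA (hG : InC G) {l : List V} {r a b : V} (h : HL G l) (hr : r ∉ l)
    (ha : a ∈ l) (hb : b ∈ l) (hra : G.Adj r a) (hrb : G.Adj r b)
    (hab : a ≠ b) (hnab : ¬ G.Adj a b) : Odd (cnt G r l) ∧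
    ∃ a ∈ l, ∃ b ∈ l, ∃ d ∈ l, G.Adj r a ∧ G.Adj r b ∧ G.Adj r d ∧ a ≠ b ∧ d ≠ a ∧ d ≠ b ∧
      ¬ G.Adj a b ∧ ¬ G.Adj d a ∧ ¬ G.Adj d b := by
  obtain ⟨L, h1, h2⟩ := h.rotTo ha
  have hbL : b ∈ L := mem_of_ne (h2.mem_iff.2 hb) hab.symm
  obtain ⟨A, B, rfl⟩ := List.append_of_mem hbL
  have hA : A ≠ [] := by
    rintro rfl
    exact hnab ((h1.2.2 b (by simp)).2.2 (by simp))
  have hB : B ≠ [] := by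
    rintro rfl
    exact hnab ((h1.2.2 b (by simp)).2.2 (by simp))
  have hcnt : cnt G r l = 2 + (cnt G r (A ++ B)) := by
    rw [← cnt_perm h2, cnt_cons_pos hra, cnt_append, cnt_cons_pos hrb, cnt_append]
    omega
  have hrL : ∀ x ∈ a :: (A ++ b :: B), r ≠ x := fun x hx e => hr (h2.mem_iff.1 (e ▸ hx))
  have hpos : cnt G r (A ++ B) ≠ 0 := by
    intro h0
    have hz : ∀ x ∈ A ++ B, ¬ G.Adj r x := by
      intro x hx hrx
      obtain ⟨s, t, hst⟩ := List.append_of_mem hx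
      rw [hst, cnt_append, cnt_cons_pos hrx] at h0
      omega
    have p1 : IP G (a :: A ++ [b]) := by
      have : HL G ((a :: A ++ [b]) ++ B) := by simpa using h1
      exact this.left hB
    have p2 : IP G (b :: B ++ [a]) := by
      have : HL G ((b :: B ++ [a]) ++ A) := by
        have : HL G ((a :: A) ++ (b :: B)) := by simpa using h1
        simpa using this.rot
      exact this.left hA
    have e1 : HL G (r :: a :: A ++ [b]) := by
      refine HL_of_IP p1 hA ?_ hra hrb (fun x hx => hz x (by simp [hx]))
      intro hh; exact hrL r (by simp at hh ⊢; grind) rfl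
    have e2 : HL G (r :: b :: B ++ [a]) := by
      refine HL_of_IP p2 hB ?_ hrb hra (fun x hx => hz x (by simp [hx]))
      intro hh; exact hrL r (by simp at hh ⊢; grind) rfl
    refine no_theta hG (a := a) (b := b) (A := A) (B := B.reverse) (C := [r]) hA (by simpa using hB)
      (by simp) (by simpa using h1) ?_ ?_
    · have := e1.rot (A := [r]) (B := a :: A ++ [b])
      simpa using this
    · have := e2.rev'.rot (A := [r])
      simpa using this
  have hodd : Odd (cnt G r l) := by
    by_contra hev
    rw [Nat.not_odd_iff_even] at hev
    exact no_evenwheel hG h hr (by omega) hev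
  refine ⟨hodd, ?_⟩
  obtain ⟨c, hc, hrc⟩ := cnt_pos (Nat.pos_of_ne_zero hpos)
  have hnd := h1.nodup
  have hca : c ≠ a := by rintro rfl; simp at hnd hc; grind
  have hcb : c ≠ b := by
    rintro rfl
    have := List.nodup_middle.1 (List.nodup_cons.1 hnd).2
    exact (List.nodup_cons.1 this).1 hc
  have hcl : c ∈ l := h2.mem_iff.1 (by simp at hc ⊢; grind)
  by_cases hac : G.Adj a c
  · obtain ⟨d, h1, h2, h3, h4, h5, h6⟩ :=
      LemmaA0 hG h hr ha hb hcl hra hrb hrc hac hab hnab hcb hodd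
    exact ⟨a, ha, b, hb, d, h1, hra, hrb, h2, hab, h3, h4, hnab, h5, h6⟩
  by_cases hbc : G.Adj b c
  · obtain ⟨d, h1, h2, h3, h4, h5, h6⟩ :=
      LemmaA0 hG h hr hb ha hcl hrb hra hrc hbc hab.symm (fun h => hnab h.symm) hca hodd
    exact ⟨a, ha, b, hb, d, h1, hra, hrb, h2, hab, h4, h3, hnab, h6, h5⟩
  exact ⟨a, ha, b, hb, c, hcl, hra, hrb, hrc, hab, hca, hcb, hnab, fun h => hac h.symm,
    fun h => hbc h.symm⟩

end Part3

section Part4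
variable {V : Type*} {G : SimpleGraph V}

theorem HL_J {t0 tk r1 rm : V} {X M : List V} (hT : IP G (t0 :: X ++ [tk]))
    (hR : IP G (r1 :: M ++ [rm])) (hd : ∀ x ∈ t0 :: X ++ [tk], x ∉ r1 :: M ++ [rm])
    (h1 : G.Adj r1 t0) (h2 : ¬ G.Adj r1 tk) (h3 : ∀ x ∈ X, ¬ G.Adj r1 x)
    (k1 : G.Adj rm tk) (k2 : ¬ G.Adj rm t0) (k3 : ∀ x ∈ X, ¬ G.Adj rm x)
    (hM : ∀ m ∈ M, ∀ x ∈ t0 :: X ++ [tk], ¬ G.Adj m x) :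
    HL G ((t0 :: X ++ [tk]) ++ (rm :: M.reverse ++ [r1])) := by
  have hR' : IP G (rm :: M.reverse ++ [r1]) := by simpa using hR.rev
  rw [HL_append (by simp) (by simp)]
  refine ⟨hT, hR', by simp; omega, ?_⟩
  intro x hx y hy
  have hy' : y ∈ r1 :: M ++ [rm] := by simp at hy ⊢; grind
  refine ⟨fun e => hd x hx (e ▸ hy'), ?_⟩
  have n1 := hT.nodup
  have n2 := hR.nodup
  simp only [List.cons_append, List.head?_cons, getLast?_cons_app, List.getLast?_singleton,
      Option.some_inj]
  simp only [List.cons_append, List.mem_cons, List.mem_append, List.not_mem_nil, or_false] at hx hy'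
  have e1 : tk ≠ t0 := by rintro rfl; exact h2 h1
  have e2 : r1 ≠ rm := by rintro rfl; exact k2 h1
  rw [G.adj_comm]
  constructor
  · intro hxy
    rcases hy' with rfl | hy' | rfl
    · rcases hx with rfl | hx | rfl
      · exact Or.inr ⟨rfl, rfl⟩
      · exact absurd hxy (h3 x hx)
      · exact absurd hxy h2
    · exact absurd hxy (hM y hy' x (by simp; grind))
    · rcases hx with rfl | hx | rfl
      · exact absurd hxy k2
      · exact absurd hxy (k3 x hx)
      · exact Or.inl ⟨rfl, rfl⟩
  · rintro (⟨rfl, rfl⟩ | ⟨rfl, rfl⟩) <;> assumption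

/-- clique attachments in a hole -/
theorem clq_cases {l : List V} (h : HL G l) {r p : V} (hp : p ∈ l) (hrp : G.Adj r p)
    (hc : ∀ x ∈ l, ∀ y ∈ l, G.Adj r x → G.Adj r y → x = y ∨ G.Adj x y) :
    (∀ x ∈ l, G.Adj r x → x = p) ∨ ∃ p' ∈ l, G.Adj p p' ∧ G.Adj r p' ∧
      ∀ x ∈ l, G.Adj r x → x = p ∨ x = p' := by
  by_cases hh : ∀ x ∈ l, G.Adj r x → x = p
  · exact Or.inl hh
  right
  push Not at hh
  obtain ⟨p', hp', hrp', hne⟩ := hh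
  have hpp' : G.Adj p p' := (hc p hp p' hp' hrp hrp').resolve_left (fun e => hne e.symm)
  refine ⟨p', hp', hpp', hrp', fun x hx hrx => ?_⟩
  by_contra hcon
  push Not at hcon
  exact h.no_tri hp hp' hx hpp' ((hc p' hp' x hx hrp' hrx).resolve_left (fun e => hcon.2 e.symm))
    ((hc p hp x hx hrp hrx).resolve_left (fun e => hcon.1 e.symm))

theorem U_ES (hG : InC G) {l M : List V} {r1 rm p p' q : V} (h : HL G l)
    (hR : IP G (r1 :: M ++ [rm])) (hd : ∀ x ∈ l, x ∉ r1 :: M ++ [rm])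
    (hM : ∀ m ∈ M, ∀ x ∈ l, ¬ G.Adj m x)
    (hp : p ∈ l) (hp' : p' ∈ l) (hq : q ∈ l) (hpp : G.Adj p p') (hrp : G.Adj r1 p)
    (hrp' : G.Adj r1 p') (h1 : ∀ x ∈ l, G.Adj r1 x → x = p ∨ x = p')
    (hrq : G.Adj rm q) (h2 : ∀ x ∈ l, G.Adj rm x → x = q) (hpq : p ≠ q) (hnpq : ¬ G.Adj p q) :
    False := by
  obtain ⟨L, g1, g2⟩ := h.rotEdge hp hp' hpp
  have hqp' : q ≠ p' := by rintro rfl; exact hnpq hpp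
  have hqL : q ∈ L := mem_of_ne (mem_of_ne (g2.mem_iff.2 hq) hpq.symm) hqp'
  obtain ⟨L1, L2, rfl⟩ := List.append_of_mem hqL
  have hml : ∀ x, x ∈ p :: p' :: (L1 ++ q :: L2) → x ∈ l := fun x hx => g2.mem_iff.1 hx
  have hnd := g1.nodup
  have e1 : HL G (q :: L2 ++ p :: p' :: (L1.reverse).reverse) := by
    have : HL G ((p :: p' :: L1) ++ (q :: L2)) := by simpa using g1
    simpa using this.rot
  have p1 : IP G (q :: L2 ++ [p]) := by
    have : HL G ((q :: L2 ++ [p]) ++ (p' :: L1)) := by simpa using e1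
    exact this.left (by simp)
  have p2 : IP G (p' :: L1 ++ [q]) := by
    have : HL G ((p' :: L1 ++ [q]) ++ (L2 ++ [p])) := by
      have : HL G ([p] ++ (p' :: L1 ++ [q] ++ L2)) := by simpa using g1
      simpa using this.rot
    exact this.left (by simp)
  have hnr : ∀ x ∈ L1 ++ q :: L2, ¬ G.Adj r1 x := by
    intro x hx hrx
    have hx' : x ≠ p ∧ x ≠ p' := by
      constructor <;> (rintro rfl; simp at hnd hx; grind)
    rcases h1 x (hml x (by simp at hx ⊢; grind)) hrx with e | e
    · exact hx'.1 e
    · exact hx'.2 e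
  have hnm : ∀ x ∈ p :: p' :: (L1 ++ L2), ¬ G.Adj rm x := by
    intro x hx hrx
    have hx' : x ≠ q := by
      rintro rfl
      have : (p :: p' :: L1 ++ x :: L2).Nodup := by simpa using hnd
      have := (List.nodup_cons.1 (List.nodup_middle.1 this)).1
      exact this (by simpa using hx)
    exact hx' (h2 x (hml x (by simp at hx ⊢; grind)) hrx)
  have p1' : IP G (p :: L2.reverse ++ [q]) := by simpa using p1.rev
  have e2 := HL_J (t0 := p) (X := L2.reverse) (tk := q) (r1 := r1) (rm := rm) (M := M)
    p1' hR
    (fun x hx => hd x (hml x (by simp at hx ⊢; grind))) hrp (hnr q (by simp))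
    (fun x hx => hnr x (by simp at hx ⊢; grind)) hrq (hnm p (by simp))
    (fun x hx => hnm x (by simp at hx ⊢; grind))
    (fun m hm x hx => hM m hm x (hml x (by simp at hx ⊢; grind)))
  have e3 := HL_J (t0 := p') (X := L1) (tk := q) (r1 := r1) (rm := rm) (M := M)
    p2 hR
    (fun x hx => hd x (hml x (by simp at hx ⊢; grind))) hrp' (hnr q (by simp))
    (fun x hx => hnr x (by simp at hx ⊢; grind)) hrq (hnm p' (by simp))
    (fun x hx => hnm x (by simp at hx ⊢; grind))
    (fun m hm x hx => hM m hm x (hml x (by simp at hx ⊢; grind)))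
  refine no_pyramid hG (a := q) (A1 := L2) (b1 := p) (A2 := L1.reverse) (b2 := p')
    (A3 := rm :: M.reverse) (b3 := r1) e1 ?_ ?_
  · have := e2.rot.rev
    simpa using this
  · have := e3.rot.rev
    simpa using this

theorem LemmaU (hG : InC G) {l M : List V} {r1 rm p q : V} (h : HL G l)
    (hR : IP G (r1 :: M ++ [rm])) (hd : ∀ x ∈ l, x ∉ r1 :: M ++ [rm])
    (hM : ∀ m ∈ M, ∀ x ∈ l, ¬ G.Adj m x)
    (c1 : ∀ x ∈ l, ∀ y ∈ l, G.Adj r1 x → G.Adj r1 y → x = y ∨ G.Adj x y)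
    (cm : ∀ x ∈ l, ∀ y ∈ l, G.Adj rm x → G.Adj rm y → x = y ∨ G.Adj x y)
    (hp : p ∈ l) (hq : q ∈ l) (hrp : G.Adj r1 p) (hrq : G.Adj rm q) : p = q ∨ G.Adj p q := by
  by_contra hcon
  push Not at hcon
  obtain ⟨hpq, hnpq⟩ := hcon
  have hR' : IP G (rm :: M.reverse ++ [r1]) := by simpa using hR.rev
  rcases clq_cases h hp hrp c1 with s1 | ⟨p', hp', hpp, hrp', s1⟩
  · rcases clq_cases h hq hrq cm with s2 | ⟨q', hq', hqq, hrq', s2⟩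
    · obtain ⟨L, g1, g2⟩ := h.rotTo hp
      have hqL : q ∈ L := mem_of_ne (g2.mem_iff.2 hq) hpq.symm
      obtain ⟨A, B, rfl⟩ := List.append_of_mem hqL
      have hml : ∀ x, x ∈ p :: (A ++ q :: B) → x ∈ l := fun x hx => g2.mem_iff.1 hx
      have hnd := g1.nodup
      have hA : A ≠ [] := by
        rintro rfl
        exact hnpq ((g1.2.2 q (by simp)).2.2 (by simp))
      have hB : B ≠ [] := by
        rintro rfl
        exact hnpq ((g1.2.2 q (by simp)).2.2 (by simp))
      have p1 : IP G (p :: A ++ [q]) := by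
        have : HL G ((p :: A ++ [q]) ++ B) := by simpa using g1
        exact this.left hB
      have p2 : IP G (p :: B.reverse ++ [q]) := by
        have : HL G ((q :: B ++ [p]) ++ A) := by
          have : HL G ((p :: A) ++ (q :: B)) := by simpa using g1
          simpa using this.rot
        simpa using (this.left hA).rev
      have hnr : ∀ x ∈ A ++ q :: B, ¬ G.Adj r1 x := by
        intro x hx hrx
        have hx' : x ≠ p := by rintro rfl; simp at hnd hx; grind
        exact hx' (s1 x (hml x (by simp at hx ⊢; grind)) hrx)
      have hnm : ∀ x ∈ p :: (A ++ B), ¬ G.Adj rm x := by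
        intro x hx hrx
        have hx' : x ≠ q := by
          rintro rfl
          have : (p :: A ++ x :: B).Nodup := by simpa using hnd
          have := (List.nodup_cons.1 (List.nodup_middle.1 this)).1
          exact this (by simpa using hx)
        exact hx' (s2 x (hml x (by simp at hx ⊢; grind)) hrx)
      have e2 := HL_J (t0 := p) (X := A) (tk := q) (r1 := r1) (rm := rm) (M := M)
        p1 hR
        (fun x hx => hd x (hml x (by simp at hx ⊢; grind))) hrp (hnr q (by simp))
        (fun x hx => hnr x (by simp at hx ⊢; grind)) hrq (hnm p (by simp))
        (fun x hx => hnm x (by simp at hx ⊢; grind))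
        (fun m hm x hx => hM m hm x (hml x (by simp at hx ⊢; grind)))
      have e3 := HL_J (t0 := p) (X := B.reverse) (tk := q) (r1 := r1) (rm := rm) (M := M)
        p2 hR
        (fun x hx => hd x (hml x (by simp at hx ⊢; grind))) hrp (hnr q (by simp))
        (fun x hx => hnr x (by simp at hx ⊢; grind)) hrq (hnm p (by simp))
        (fun x hx => hnm x (by simp at hx ⊢; grind))
        (fun m hm x hx => hM m hm x (hml x (by simp at hx ⊢; grind)))
      refine no_theta hG (a := p) (b := q) (A := A) (B := B.reverse) (C := r1 :: M ++ [rm]) hA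
        (by simpa using hB) (by simp) (by simpa using g1) (by simpa using e2) (by simpa using e3)
    · refine U_ES hG h hR' (fun x hx => ?_) (fun m hm => hM m (by simpa using hm)) hq hq' hp hqq
        hrq hrq' s2 hrp s1 hpq.symm (fun h => hnpq h.symm)
      have := hd x hx; simp at this ⊢; grind
  · rcases clq_cases h hq hrq cm with s2 | ⟨q', hq', hqq, hrq', s2⟩
    · exact U_ES hG h hR hd hM hp hp' hq hpp hrp hrp' s1 hrq s2 hpq hnpq
    · obtain ⟨L, g1, g2⟩ := h.rotEdge hp hp' hpp
      have hml : ∀ x, x ∈ p :: p' :: L → x ∈ l := fun x hx => g2.mem_iff.1 hx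
      have hnd := g1.nodup
      have hqp' : q ≠ p' := by rintro rfl; exact hnpq hpp
      have hq'p : q' ≠ p := by rintro rfl; exact hnpq hqq.symm
      have hqL : q ∈ L := mem_of_ne (mem_of_ne (g2.mem_iff.2 hq) hpq.symm) hqp'
      have hnr : ∀ x ∈ L, ¬ G.Adj r1 x := by
        intro x hx hrx
        have hx' : x ≠ p ∧ x ≠ p' := by
          constructor <;> (rintro rfl; simp at hnd; grind)
        rcases s1 x (hml x (by simp [hx])) hrx with e | e
        · exact hx'.1 e
        · exact hx'.2 e
      by_cases hq'p' : q' = p'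
      · subst hq'p'
        obtain ⟨K, rfl⟩ : ∃ K, L = q :: K := by
          have := (g1.1.2 q hqL).2.1 hqq.symm
          rcases L with _ | ⟨c, K⟩
          · simp at hqL
          · simp at this; subst this; exact ⟨K, rfl⟩
        have p1 : IP G (p :: K.reverse ++ [q]) := by
          have : HL G ((p :: [q']) ++ (q :: K)) := by simpa using g1
          have : HL G ((q :: K ++ [p]) ++ [q']) := by simpa using this.rot
          simpa using (this.left (by simp)).rev
        have hnm : ∀ x ∈ p :: K, ¬ G.Adj rm x := by
          intro x hx hrx
          have hx' : x ≠ q ∧ x ≠ q' := by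
            constructor <;> (rintro rfl; simp at hnd hx; grind)
          rcases s2 x (hml x (by simp at hx ⊢; grind)) hrx with e | e
          · exact hx'.1 e
          · exact hx'.2 e
        have e2 := HL_J (t0 := p) (X := K.reverse) (tk := q) (r1 := r1) (rm := rm) (M := M)
          p1 hR
          (fun x hx => hd x (hml x (by simp at hx ⊢; grind))) hrp (hnr q (by simp))
          (fun x hx => hnr x (by simp at hx ⊢; grind)) hrq (hnm p (by simp))
          (fun x hx => hnm x (by simp at hx ⊢; grind))
          (fun m hm x hx => hM m hm x (hml x (by simp at hx ⊢; grind)))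
        have hc : cnt G q' ((p :: K.reverse ++ [q]) ++ (rm :: M.reverse ++ [r1])) = 4 := by
          simp only [List.cons_append]
          rw [cnt_cons_pos hpp.symm, cnt_append, cnt_append, cnt_reverse, cnt_cons_pos hqq.symm,
            cnt_nil, cnt_cons_pos hrq'.symm, cnt_append, cnt_reverse, cnt_cons_pos hrp'.symm, cnt_nil,
            cnt_zero (A := K), cnt_zero (A := M)]
          · intro m hm hh
            exact hM m hm q' hp' hh.symm
          · intro k hk hh
            have := (g1.1.2 k (by simp [hk])).2.1 hh
            simp at this; subst this
            simp at hnd; grind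
        refine no_evenwheel hG e2 (r := q') ?_ (by rw [hc]; omega) (by rw [hc]; decide)
        have := hd q' hq'
        simp at hnd this ⊢; grind
      · have hq'L : q' ∈ L := mem_of_ne (mem_of_ne (g2.mem_iff.2 hq') hq'p) hq'p'
        obtain ⟨L1, s, t, L2, rfl, hst⟩ : ∃ L1 s t L2, L = L1 ++ s :: t :: L2 ∧
            ((s = q ∧ t = q') ∨ (s = q' ∧ t = q)) := by
          obtain ⟨A, B, rfl⟩ := List.append_of_mem hqL
          have hip : IP G (A ++ q :: B) := g1.1.1
          rcases List.mem_append.1 hq'L with hA | hB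
          · have := (IP_append.1 hip).2.2 q' hA q (by simp)
            have := this.2.1 hqq.symm
            obtain ⟨A', rfl⟩ := List.getLast?_eq_some_iff.1 this.1
            exact ⟨A', q', q, B, by simp, Or.inr ⟨rfl, rfl⟩⟩
          · have hB := mem_of_ne hB hqq.ne'
            have := ((hip.right).2 q' hB).2.1 hqq
            rcases B with _ | ⟨c, B⟩
            · simp at hB
            · simp at this; subst this
              exact ⟨A, q, c, B, rfl, Or.inl ⟨rfl, rfl⟩⟩
        have hs : G.Adj rm s := by rcases hst with ⟨rfl, rfl⟩ | ⟨rfl, rfl⟩ <;> assumption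
        have ht : G.Adj rm t := by rcases hst with ⟨rfl, rfl⟩ | ⟨rfl, rfl⟩ <;> assumption
        have hnm : ∀ x ∈ p :: p' :: (L1 ++ L2), ¬ G.Adj rm x := by
          intro x hx hrx
          have hx' : x ≠ s ∧ x ≠ t := by
            have : (p :: p' :: L1 ++ s :: t :: L2).Nodup := by simpa using hnd
            rw [List.nodup_middle, List.nodup_cons] at this
            have h2 := this.2
            rw [List.nodup_middle, List.nodup_cons] at h2
            have h1 := this.1
            have h2 := h2.1
            constructor
            · rintro rfl; simp at h1 hx; grind
            · rintro rfl; simp at h2 hx; grind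
          rcases s2 x (hml x (by simp at hx ⊢; grind)) hrx with e | e <;> grind
        have p1 : IP G (p' :: L1 ++ [s]) := by
          have : HL G ([p] ++ (p' :: L1 ++ [s] ++ (t :: L2))) := by simpa using g1
          exact (this.right (by simp)).left
        have e1 : HL G ((p' :: L1 ++ [s]) ++ (t :: (L2.reverse).reverse ++ [p])) := by
          have : HL G ([p] ++ (p' :: L1 ++ [s] ++ (t :: L2))) := by simpa using g1
          simpa using this.rot
        have p2 : IP G (p :: L2.reverse ++ [t]) := by
          have := (e1.right (by simp)).rev
          simpa using this
        have e2 := HL_J (t0 := p') (X := L1) (tk := s) (r1 := r1) (rm := rm) (M := M)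
          p1 hR
          (fun x hx => hd x (hml x (by simp at hx ⊢; grind))) hrp' (hnr s (by simp))
          (fun x hx => hnr x (by simp at hx ⊢; grind)) hs (hnm p' (by simp))
          (fun x hx => hnm x (by simp at hx ⊢; grind))
          (fun m hm x hx => hM m hm x (hml x (by simp at hx ⊢; grind)))
        have e3 := HL_J (t0 := p) (X := L2.reverse) (tk := t) (r1 := r1) (rm := rm) (M := M)
          p2 hR
          (fun x hx => hd x (hml x (by simp at hx ⊢; grind))) hrp (hnr t (by simp))
          (fun x hx => hnr x (by simp at hx ⊢; grind)) ht (hnm p (by simp))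
          (fun x hx => hnm x (by simp at hx ⊢; grind))
          (fun m hm x hx => hM m hm x (hml x (by simp at hx ⊢; grind)))
        exact no_prism hG e1 e2 e3

end Part4

section Part5
variable {V : Type*} {G : SimpleGraph V}

/-- two elements of `R` attach to distinct nonadjacent vertices of `l` -/
def BadAtt (G : SimpleGraph V) (l R : List V) : Prop :=
  ∃ r ∈ R, ∃ r' ∈ R, ∃ p ∈ l, ∃ q ∈ l, G.Adj r p ∧ G.Adj r' q ∧ p ≠ q ∧ ¬ G.Adj p q

theorem snoc_cases (R : List V) : R = [] ∨ (∃ r, R = [r]) ∨ ∃ a M b, R = a :: M ++ [b] := by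
  rcases R with _ | ⟨a, R⟩
  · simp
  · rcases List.eq_nil_or_concat R with rfl | ⟨M, b, rfl⟩
    · simp
    · right; right; exact ⟨a, M, b, by simp⟩

theorem LemmaUC (hG : InC G) {l : List V} (h : HL G l) : ∀ (n : ℕ) (R : List V), R.length = n →
    IP G R → (∀ x ∈ l, x ∉ R) →
    (∀ r ∈ R, ∀ x ∈ l, ∀ y ∈ l, G.Adj r x → G.Adj r y → x = y ∨ G.Adj x y) →
    BadAtt G l R →
    ∃ r1 M r2 p z q l', (r1 :: M ++ [r2]) <:+: R ∧ p ∈ l ∧ z ∈ l ∧ q ∈ l ∧ G.Adj p z ∧ G.Adj z q ∧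
      p ≠ q ∧ ¬ G.Adj p q ∧ G.Adj r1 p ∧ G.Adj r2 q ∧ (∃ m ∈ M, G.Adj m z) ∧ HL G l' ∧
      (z :: l').Perm (l ++ (r1 :: M ++ [r2])) := by
  intro n
  induction n using Nat.strong_induction_on with
  | _ n ih =>
  intro R hn hR hd hc hbad
  rcases snoc_cases R with rfl | ⟨r, rfl⟩ | ⟨r1, M, r2, rfl⟩
  · simp [BadAtt] at hbad
  · obtain ⟨r, hr, r', hr', p, hp, q, hq, h1, h2, h3, h4⟩ := hbad
    simp at hr hr'; subst hr; subst hr'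
    rcases hc _ (by simp) p hp q hq h1 h2 with e | e
    · exact absurd e h3
    · exact absurd e h4
  have i1 : (r1 :: M) <:+: (r1 :: M ++ [r2]) := ⟨[], [r2], by simp⟩
  have i2 : (M ++ [r2]) <:+: (r1 :: M ++ [r2]) := ⟨[r1], [], by simp⟩
  have hsub : ∀ R', R' <:+: (r1 :: M ++ [r2]) → R'.length < n → BadAtt G l R' → 
     ∃ r1' M' r2' p z q l', (r1' :: M' ++ [r2']) <:+: (r1 :: M ++ [r2]) ∧ p ∈ l ∧ z ∈ l ∧ q ∈ l ∧ G.Adj p z ∧ G.Adj z q ∧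
      p ≠ q ∧ ¬ G.Adj p q ∧ G.Adj r1' p ∧ G.Adj r2' q ∧ (∃ m ∈ M', G.Adj m z) ∧ HL G l' ∧
      (z :: l').Perm (l ++ (r1' :: M' ++ [r2'])) := by
    intro R' hi hl hb
    obtain ⟨a, b, c, d, e, f, g, k1, k2⟩ := ih _ hl R' rfl (hR.of_inf hi) (fun x hx hx' => hd x hx (hi.subset hx'))
      (fun r hr => hc r (hi.subset hr)) hb
    exact ⟨a, b, c, d, e, f, g, k1.trans hi, k2⟩
  by_cases b1 : BadAtt G l (r1 :: M)
  · exact hsub _ i1 (by rw [← hn]; simp) b1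
  by_cases b2 : BadAtt G l (M ++ [r2])
  · exact hsub _ i2 (by rw [← hn]; simp) b2
  have g1 : ∀ r ∈ r1 :: M, ∀ r' ∈ r1 :: M, ∀ x ∈ l, ∀ y ∈ l, G.Adj r x → G.Adj r' y → x = y ∨ G.Adj x y := by
    intro r hr r' hr' x hx y hy k1 k2
    by_contra hcon
    push Not at hcon
    exact b1 ⟨r, hr, r', hr', x, hx, y, hy, k1, k2, hcon⟩
  have g2 : ∀ r ∈ M ++ [r2], ∀ r' ∈ M ++ [r2], ∀ x ∈ l, ∀ y ∈ l, G.Adj r x → G.Adj r' y → x = y ∨ G.Adj x y := by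
    intro r hr r' hr' x hx y hy k1 k2
    by_contra hcon
    push Not at hcon
    exact b2 ⟨r, hr, r', hr', x, hx, y, hy, k1, k2, hcon⟩
  obtain ⟨p, hp, q, hq, hrp, hrq, hpq, hnpq⟩ : ∃ p ∈ l, ∃ q ∈ l, G.Adj r1 p ∧ G.Adj r2 q ∧ p ≠ q ∧ ¬ G.Adj p q := by
    obtain ⟨r, hr, r', hr', p, hp, q, hq, h1, h2, h3, h4⟩ := hbad
    by_cases c1 : r = r1
    · by_cases c2 : r' = r2
      · subst c1; subst c2; exact ⟨p, hp, q, hq, h1, h2, h3, h4⟩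
      · exact absurd (g1 r (by simp [c1]) r' (by simp at hr' ⊢; grind) p hp q hq h1 h2) (by grind)
    · by_cases c2 : r' = r1
      · by_cases c3 : r = r2
        · subst c2; subst c3; exact ⟨q, hq, p, hp, h2, h1, h3.symm, fun e => h4 e.symm⟩
        · exact absurd (g1 r (by simp at hr ⊢; grind) r' (by simp [c2]) p hp q hq h1 h2) (by grind)
      · exact absurd (g2 r (by simp at hr ⊢; grind) r' (by simp at hr' ⊢; grind) p hp q hq h1 h2) (by grind)
  have hmid : ∀ m ∈ M, ∀ x ∈ l, G.Adj m x → G.Adj x p ∧ G.Adj x q := by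
    intro m hm x hx hmx
    have e1 := g1 m (by simp [hm]) r1 (by simp) x hx p hp hmx hrp
    have e2 := g2 m (by simp [hm]) r2 (by simp) x hx q hq hmx hrq
    rcases e1 with rfl | e1
    · grind
    · rcases e2 with rfl | e2
      · exact absurd e1.symm hnpq
      · exact ⟨e1, e2⟩
  have hex : ∃ m ∈ M, ∃ z ∈ l, G.Adj m z := by
    by_contra hno
    push Not at hno
    rcases LemmaU hG h hR hd hno (hc _ (by simp)) (hc _ (by simp)) hp hq hrp hrq with e | e
    · exact hpq e
    · exact hnpq e
  obtain ⟨m, hm, z, hz, hmz⟩ := hex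
  obtain ⟨hzp, hzq⟩ := hmid m hm z hz hmz
  obtain ⟨L, f1, f2⟩ := h.rotEdge hp hz hzp.symm
  have hqL : q ∈ L := mem_of_ne (mem_of_ne (f2.mem_iff.2 hq) hpq.symm) hzq.ne'
  obtain ⟨K, rfl⟩ : ∃ K, L = q :: K := by
    have := (f1.1.2 q hqL).2.1 hzq
    rcases L with _ | ⟨c, K⟩
    · simp at hqL
    · simp at this; subst this; exact ⟨K, rfl⟩
  have p1 : IP G (q :: K ++ [p]) := by
    have : HL G ((p :: [z]) ++ (q :: K)) := by simpa using f1
    have : HL G ((q :: K ++ [p]) ++ [z]) := by simpa using this.rot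
    exact (this.left (by simp))
  have hnd := f1.nodup
  have hml : ∀ x, x ∈ p :: z :: q :: K → x ∈ l := fun x hx => f2.mem_iff.1 hx
  have s1 : ∀ y ∈ l, G.Adj r1 y → y = z ∨ y = p := by
    intro y hy hry
    rcases hc r1 (by simp) y hy p hp hry hrp with e | e
    · exact Or.inr e
    rcases g1 r1 (by simp) m (by simp [hm]) y hy z hz hry hmz with e' | e'
    · exact Or.inl e'
    exact (h.no_tri hy hz hp e' hzp e).elim
  have s2 : ∀ y ∈ l, G.Adj r2 y → y = z ∨ y = q := by
    intro y hy hry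
    rcases hc r2 (by simp) y hy q hq hry hrq with e | e
    · exact Or.inr e
    rcases g2 r2 (by simp) m (by simp [hm]) y hy z hz hry hmz with e' | e'
    · exact Or.inl e'
    exact (h.no_tri hy hz hq e' hzq e).elim
  have s3 : ∀ m ∈ M, ∀ y ∈ l, G.Adj m y → y = z := by
    intro m hm y hy hmy
    obtain ⟨a, b⟩ := hmid m hm y hy hmy
    exact CN hG hpq hnpq a b hzp hzq
  have hzK : z ∉ q :: K ++ [p] := by simp at hnd ⊢; grind
  have e2 := HL_J (t0 := q) (X := K) (tk := p) (r1 := r2) (rm := r1) (M := M.reverse)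
    p1 (by simpa using hR.rev)
    (fun x hx => by have := hd x (hml x (by simp at hx ⊢; grind)); simp at this ⊢; grind)
    hrq
    (fun hh => by rcases s2 p hp hh with e | e; exact hzp.ne e.symm; exact hpq e)
    (fun x hx hh => by rcases s2 x (hml x (by simp [hx])) hh with e | e <;> (subst e; simp at hnd; grind))
    hrp
    (fun hh => by rcases s1 q hq hh with e | e; exact hzq.ne e.symm; exact hpq e.symm)
    (fun x hx hh => by rcases s1 x (hml x (by simp [hx])) hh with e | e <;> (subst e; simp at hnd; grind))
    (fun m hm x hx hh => by
      have := s3 m (by simpa using hm) x (hml x (by simp at hx ⊢; grind)) hh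
      subst this; exact hzK hx)
  refine ⟨r1, M, r2, p, z, q, _, List.infix_refl _, hp, hz, hq, hzp.symm, hzq, hpq, hnpq, hrp, hrq, ⟨m, hm, hmz⟩, e2, ?_⟩
  have : (z :: (q :: K ++ [p])).Perm l := by
    refine List.Perm.trans ?_ f2
    have : (p :: z :: q :: K) = [p] ++ (z :: q :: K) := rfl
    rw [this, ← List.cons_append]
    exact List.perm_append_comm
  simpa using this.append_right (r1 :: M ++ [r2])

/-- rerouting an induced path through an outside vertex -/
theorem reroute (hG : InC G) {E : List V} (hE : IP G E) {r x y : V} (hr : r ∉ E) (hx : x ∈ E) (hy : y ∈ E)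
    (hrx : G.Adj r x) (hry : G.Adj r y) (hxy : x ≠ y) (hnxy : ¬ G.Adj x y) :
    ∃ E1 a Em b E3, E = E1 ++ a :: Em ++ b :: E3 ∧ G.Adj r a ∧ G.Adj r b ∧ a ≠ b ∧ ¬ G.Adj a b ∧
      (∀ v ∈ E1, ¬ G.Adj r v) ∧ (∀ v ∈ E3, ¬ G.Adj r v) ∧ 2 ≤ Em.length ∧
      IP G (E1 ++ a :: r :: b :: E3) := by
  obtain ⟨E1, a, t, rfl, ha, h1⟩ := exists_first (p := fun v => G.Adj r v) ⟨x, hx, hrx⟩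
  have hex : ∃ w ∈ t, G.Adj r w ∧ ¬ G.Adj a w := by
    by_contra hno
    push Not at hno
    have key : ∀ w ∈ E1 ++ a :: t, G.Adj r w → w = a ∨ (G.Adj a w ∧ t.head? = some w) := by
      intro w hw hrw
      simp at hw
      rcases hw with hw | rfl | hw
      · exact absurd hrw (h1 w hw)
      · exact Or.inl rfl
      · exact Or.inr ⟨hno w hw hrw, (hE.right.2 w hw).2.1 (hno w hw hrw)⟩
    rcases key x hx hrx with e1 | ⟨e1, e1'⟩ <;> rcases key y hy hry with e2 | ⟨e2, e2'⟩
    · grind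
    · subst e1; exact hnxy e2
    · subst e2; exact hnxy e1.symm
    · grind
  obtain ⟨w, hw, hrw, haw⟩ := hex
  obtain ⟨Em, b, E3, rfl, hb, h3⟩ := exists_last (p := fun v => G.Adj r v) ⟨w, hw, hrw⟩
  have hT := hE.right
  have hab : a ≠ b := (hT.2 b (by simp)).1
  have hnab : ¬ G.Adj a b := by
    intro hh
    have := (hT.2 b (by simp)).2.1 hh
    rcases Em with _ | ⟨c, Em⟩
    · simp at hw
      rcases hw with rfl | hw
      · exact haw hh
      · exact h3 w hw hrw
    · simp at this; subst this
      have := hT.1.nodup; simp at this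
  have hlen : 2 ≤ Em.length := by
    rcases Em with _ | ⟨c, _ | ⟨d, Em⟩⟩
    · exact absurd ((hT.2 b (by simp)).2.2 (by simp)) hnab
    · exfalso
      have e1 : G.Adj a c := (hT.2 c (by simp)).2.2 (by simp)
      have e2 : G.Adj c b := (hT.1.2 b (by simp)).2.2 (by simp)
      have := CN hG hab hnab e1.symm e2 ha hb
      subst this; simp at hr
    · simp
  refine ⟨E1, a, Em, b, E3, by simp, ha, hb, hab, hnab, h1, h3, hlen, ?_⟩
  have hi : E1 ++ a :: (Em ++ b :: E3) = (E1 ++ [a]) ++ (Em ++ b :: E3) := by simp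
  have hE' := hE
  rw [hi] at hE'
  have q1 : IP G (E1 ++ [a]) := hE'.left
  have q2 : IP G (b :: E3) := hE'.right.right
  have q3 : ∀ u ∈ E1 ++ [a], ∀ v ∈ b :: E3, u ≠ v ∧ ¬ G.Adj u v := by
    intro u hu v hv
    have := (IP_append.1 hE').2.2 u hu v (by simp at hv ⊢; grind)
    refine ⟨this.1, fun hh => ?_⟩
    obtain ⟨-, e⟩ := this.2.1 hh
    rcases Em with _ | ⟨c, Em⟩
    · simp at hlen
    · simp at e; subst e
      have := hT.1.nodup; simp at this hv; grind
  have hfin : IP G ((E1 ++ [a]) ++ r :: b :: E3) := by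
    rw [IP_append]
    refine ⟨q1, ⟨q2, ?_⟩, ?_⟩
    · intro v hv
      refine ⟨?_, ?_⟩
      · rintro rfl; simp at hr hv; grind
      · constructor
        · intro hh
          rcases List.mem_cons.1 hv with rfl | hv
          · rfl
          · exact absurd hh (h3 v hv)
        · intro hh; simp at hh; subst hh; exact hb
    · intro u hu v hv
      rcases List.mem_cons.1 hv with rfl | hv
      · refine ⟨?_, ?_⟩
        · rintro rfl; simp at hr hu; grind
        · simp only [getLast?_app, List.getLast?_singleton, Option.some_inj, List.head?_cons, and_true]
          constructor
          · intro hh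
            simp at hu
            rcases hu with hu | rfl
            · exact absurd hh.symm (h1 u hu)
            · rfl
          · rintro rfl; exact ha.symm
      · refine ⟨(q3 u hu v hv).1, fun hh => absurd hh (q3 u hu v hv).2, ?_⟩
        rintro ⟨-, hh⟩
        simp at hh; subst hh
        simp at hr hv; grind
  simpa using hfin

end Part5

section Part6
variable {V : Type*} {G : SimpleGraph V}

/-- equal or adjacent -/
def Nr (G : SimpleGraph V) (x y : V) : Prop := x = y ∨ G.Adj x y

theorem Nr.refl {x : V} : Nr G x x := Or.inl rfl
theorem Nr.symm {x y : V} (h : Nr G x y) : Nr G y x := by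
  rcases h with h | h
  · exact Or.inl h.symm
  · exact Or.inr h.symm
theorem Nr.trans (hG : InC G) {u x y z : V} (hx : G.Adj u x) (hy : G.Adj u y) (hz : G.Adj u z)
    (h1 : Nr G x y) (h2 : Nr G y z) : Nr G x z := by
  rcases h1 with rfl | h1
  · exact h2
  rcases h2 with rfl | h2
  · exact Or.inr h1
  by_contra hcon
  simp only [Nr, not_or] at hcon
  exact hy.ne (CN hG hcon.1 hcon.2 hx hz h1.symm h2)

theorem att_unique (hG : InC G) {u d w w' : V} (hd : d ≠ u) (hdu : ¬ G.Adj u d) (hw : G.Adj u w)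
    (hw' : G.Adj u w') (h1 : G.Adj d w) (h2 : G.Adj d w') : w = w' :=
  CN hG hd (fun h => hdu h.symm) h1.symm hw.symm h2.symm hw'.symm

structure BadP (G : SimpleGraph V) (W : Set V) (u x y c : V) (P : List V) : Prop where
  uW : u ∈ W
  xW : x ∈ W
  yW : y ∈ W
  cW : c ∈ W
  ux : G.Adj u x
  uy : G.Adj u y
  uc : G.Adj u c
  xy : ¬ Nr G x y
  xc : ¬ Nr G x c
  yc : ¬ Nr G y c
  ip : IP G P
  PW : ∀ p ∈ P, p ∈ W
  Pu : ∀ p ∈ P, p ≠ u ∧ ¬ G.Adj u p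
  hd : ∃ h, P.head? = some h ∧ G.Adj h x
  lt : ∃ t, P.getLast? = some t ∧ G.Adj t y
  mid : ∃ p ∈ P, G.Adj p c

/-- hole builder -/
theorem HB {u x y : V} {P : List V} (ux : G.Adj u x) (uy : G.Adj u y) (xy : ¬ Nr G x y)
    (ip : IP G P) (Pu : ∀ p ∈ P, p ≠ u ∧ ¬ G.Adj u p)
    (hd : ∃ h, P.head? = some h ∧ G.Adj h x) (lt : ∃ t, P.getLast? = some t ∧ G.Adj t y)
    (hx : ∀ p ∈ P, G.Adj p x → P.head? = some p) (hy : ∀ p ∈ P, G.Adj p y → P.getLast? = some p) :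
    HL G (u :: x :: P ++ [y]) := by
  obtain ⟨h, hh, hhx⟩ := hd
  obtain ⟨t, ht, hty⟩ := lt
  simp only [Nr, not_or] at xy
  have hP : P ≠ [] := by rintro rfl; simp at hh
  have hxP : x ∉ P := fun hc => (Pu x hc).2 ux
  have hyP : y ∉ P := fun hc => (Pu y hc).2 uy
  apply HL_of_IP _ hP
  · simp
    refine ⟨ux.ne, fun hc => (Pu u hc).1 rfl, uy.ne⟩
  · exact ux
  · exact uy
  · exact fun p hp => (Pu p hp).2
  · rw [List.cons_append, IP_cons, IP_append]
    refine ⟨⟨ip, by simp, ?_⟩, ?_⟩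
    · intro a ha b hb
      simp at hb; subst hb
      refine ⟨fun e => hyP (e ▸ ha), fun hh => ⟨hy a ha hh, by simp⟩, fun hh => ?_⟩
      rw [hh.1] at ht; simp at ht; subst ht; exact hty
    · intro v hv
      simp at hv
      rcases hv with hv | rfl
      · refine ⟨fun e => hxP (e ▸ hv), fun hxv => ?_, fun hxv => ?_⟩
        · rw [List.head?_append, hx v hv hxv.symm]; rfl
        · rw [List.head?_append, hh] at hxv
          simp at hxv; subst hxv; exact hhx.symm
      · refine ⟨xy.1, fun hc => absurd hc xy.2, fun hc => ?_⟩
        rw [List.head?_append, hh] at hc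
        simp at hc; subst hc
        exact absurd (List.mem_of_head? hh) hyP

theorem IP_join {R : List V} {rm a : V} {t : List V} (hR : IP G R) (hP : IP G (a :: t))
    (hd : ∀ r ∈ R, r ∉ a :: t) (hrm : R.getLast? = some rm) (hra : G.Adj rm a)
    (hrt : ∀ v ∈ t, ¬ G.Adj rm v) (hn : ∀ r ∈ R, r ≠ rm → ∀ v ∈ a :: t, ¬ G.Adj r v) :
    IP G (R ++ a :: t) := by
  rw [IP_append]
  refine ⟨hR, hP, fun r hr v hv => ⟨fun e => hd r hr (e ▸ hv), fun hh => ?_, ?_⟩⟩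
  · by_cases hrr : r = rm
    · subst hrr
      refine ⟨hrm, ?_⟩
      rcases List.mem_cons.1 hv with rfl | hv
      · rfl
      · exact absurd hh (hrt v hv)
    · exact absurd hh (hn r hr hrr v hv)
  · rintro ⟨h1, h2⟩
    rw [hrm] at h1
    simp at h1 h2; subst h1; subst h2; exact hra

/-- `d` attaches to the class of `x` in `N(u)` (inside `W`). -/
def Att (G : SimpleGraph V) (W : Set V) (u x d : V) : Prop :=
  ∃ w ∈ W, G.Adj u w ∧ Nr G w x ∧ G.Adj d w

set_option maxHeartbeats 1000000 in
theorem LemmaM (hG : InC G) {W D : Set V} {u x1 x2 x3 : V} (hDW : D ⊆ W) (huW : u ∈ W)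
    (hDu : ∀ d ∈ D, d ≠ u ∧ ¬ G.Adj u d) (hD : ∀ x ∈ D, ∀ y ∈ D, Lk G D x y)
    (u1 : G.Adj u x1) (u2 : G.Adj u x2) (u3 : G.Adj u x3)
    (h12 : ¬ Nr G x1 x2) (h13 : ¬ Nr G x1 x3) (h23 : ¬ Nr G x2 x3)
    (a1 : ∃ d ∈ D, Att G W u x1 d) (a2 : ∃ d ∈ D, Att G W u x2 d) (a3 : ∃ d ∈ D, Att G W u x3 d) :
    ∃ y1 y2 c P, BadP G W u y1 y2 c P ∧ ∀ p ∈ P, p ∈ D := by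
  have hne : ∀ {a b w w' : V}, G.Adj u a → G.Adj u b → G.Adj u w → G.Adj u w' → ¬ Nr G a b →
      Nr G w a → Nr G w' b → ¬ Nr G w w' := by
    intro a b w w' ha hb hw hw' hab h1 h2 h3
    exact hab (((h1.symm).trans hG ha hw hw' h3).trans hG ha hw' hb h2)
  obtain ⟨d1, hd1, hatt1⟩ := a1
  obtain ⟨d2, hd2, hatt2⟩ := a2
  obtain ⟨d3, hd3, hatt3⟩ := a3
  obtain ⟨P, ip, PD, ⟨h, hh, hhX⟩, ⟨t, ht, htY⟩, PX, PY⟩ :=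
    SP (X := {d | Att G W u x1 d}) (Y := {d | Att G W u x2 d}) hatt1 hatt2 hd1 (hD d1 hd1 d2 hd2)
  obtain ⟨w1, w1W, uw1, n1, hw1⟩ := hhX
  obtain ⟨w2, w2W, uw2, n2, hw2⟩ := htY
  have Pu := fun p hp => hDu p (PD p hp)
  by_cases c3 : ∃ p ∈ P, Att G W u x3 p
  · obtain ⟨p, hp, w3, w3W, uw3, n3, hw3⟩ := c3
    exact ⟨w1, w2, w3, P, ⟨huW, w1W, w2W, w3W, uw1, uw2, uw3, hne u1 u2 uw1 uw2 h12 n1 n2,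
      hne u1 u3 uw1 uw3 h13 n1 n3, hne u2 u3 uw2 uw3 h23 n2 n3, ip, fun p hp => hDW (PD p hp), Pu,
      ⟨h, hh, hw1⟩, ⟨t, ht, hw2⟩, ⟨p, hp, hw3⟩⟩, PD⟩
  have hhP := List.mem_of_head? hh
  obtain ⟨R, ipR, RD, ⟨s, hs, hsX⟩, ⟨rm, hrm, hrmY⟩, RX, RY⟩ :=
    SP (X := {d | Att G W u x3 d}) (Y := {d | d ∈ P ∨ ∃ p ∈ P, G.Adj d p}) hatt3 (y := h)
      (Or.inl hhP) hd3 (hD d3 hd3 h (PD h hhP))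
  obtain ⟨w3, w3W, uw3, n3, hw3⟩ := hsX
  have Ru := fun p hp => hDu p (RD p hp)
  have n12 := hne u1 u2 uw1 uw2 h12 n1 n2
  have n13 := hne u1 u3 uw1 uw3 h13 n1 n3
  have n23 := hne u2 u3 uw2 uw3 h23 n2 n3
  obtain ⟨M, rfl⟩ := List.getLast?_eq_some_iff.1 hrm
  have hndR := ipR.nodup
  have hMl : ∀ m ∈ M, m ≠ rm := by
    rintro m hm rfl; exact List.disjoint_of_nodup_append hndR hm (by simp)
  have hM : ∀ m ∈ M, m ∉ P ∧ ∀ p ∈ P, ¬ G.Adj m p := by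
    intro m hm
    have : ¬ (m ∈ P ∨ ∃ p ∈ P, G.Adj m p) := by
      intro hc
      have := RY m (by simp [hm]) hc
      simp at this
      exact hMl m hm this.symm
    push Not at this; exact this
  have hrmP : rm ∉ P := by
    intro hc
    rcases List.eq_nil_or_concat M with rfl | ⟨M', m, rfl⟩
    · simp at hs; subst hs
      exact c3 ⟨rm, hc, w3, w3W, uw3, n3, hw3⟩
    · have : G.Adj m rm := by
        have := (IP_append.1 ipR).2.2 m (by simp) rm (by simp)
        exact this.2.2 (by simp)
      exact (hM m (by simp)).2 rm hc this
  have hdis : ∀ r ∈ M ++ [rm], r ∉ P := by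
    intro r hr; simp at hr
    rcases hr with hr | rfl
    · exact (hM r hr).1
    · exact hrmP
  have hrmN : ∃ p ∈ P, G.Adj rm p := hrmY.resolve_left hrmP
  have hRn : ∀ r ∈ M ++ [rm], r ≠ rm → ∀ v ∈ P, ¬ G.Adj r v := by
    intro r hr hne; simp at hr
    exact (hM r (by grind)).2
  by_cases c1 : ∃ r ∈ M ++ [rm], Att G W u x1 r
  · obtain ⟨r, hr, w, wW, uw, nw, hw⟩ := c1
    obtain ⟨s', a, t', rfl, ha, hat⟩ := exists_last hrmN
    have hj : IP G ((M ++ [rm]) ++ a :: t') := IP_join ipR ip.right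
      (fun r hr hc => hdis r hr (by simp at hc ⊢; grind)) (by simp) ha hat
      (fun r hr hne v hv => hRn r hr hne v (by simp at hv ⊢; grind))
    have hin : ∀ p ∈ (M ++ [rm]) ++ a :: t', p ∈ D := by
      intro p hp
      rcases List.mem_append.1 hp with hp | hp
      · exact RD p hp
      · exact PD p (by simp at hp ⊢; grind)
    refine ⟨w3, w2, w, _, ⟨huW, w3W, w2W, wW, uw3, uw2, uw, fun e => n23 e.symm,
      hne u3 u1 uw3 uw (fun e => h13 e.symm) n3 nw, hne u2 u1 uw2 uw (fun e => h12 e.symm) n2 nw, hj,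
      fun p hp => hDW (hin p hp), fun p hp => hDu p (hin p hp), ⟨s, ?_, hw3⟩, ⟨t, ?_, hw2⟩,
      ⟨r, by simp at hr ⊢; grind, hw⟩⟩, hin⟩
    · rw [List.head?_append, hs]; rfl
    · simpa using ht
  by_cases c2 : ∃ r ∈ M ++ [rm], Att G W u x2 r
  · obtain ⟨r, hr, w, wW, uw, nw, hw⟩ := c2
    obtain ⟨s', a, t', rfl, ha, hat⟩ := exists_first hrmN
    have ip' : IP G (a :: s'.reverse) := by
      have : IP G ((s' ++ [a]) ++ t') := by simpa using ip
      simpa using this.left.rev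
    have hj : IP G ((M ++ [rm]) ++ a :: s'.reverse) := IP_join ipR ip'
      (fun r hr hc => hdis r hr (by simp at hc ⊢; grind)) (by simp) ha (by simpa using hat)
      (fun r hr hne v hv => hRn r hr hne v (by simp at hv ⊢; grind))
    have hin : ∀ p ∈ (M ++ [rm]) ++ a :: s'.reverse, p ∈ D := by
      intro p hp
      rcases List.mem_append.1 hp with hp | hp
      · exact RD p hp
      · exact PD p (by simp at hp ⊢; grind)
    refine ⟨w3, w1, w, _, ⟨huW, w3W, w1W, wW, uw3, uw1, uw, fun e => n13 e.symm,
      hne u3 u2 uw3 uw (fun e => h23 e.symm) n3 nw, hne u1 u2 uw1 uw h12 n1 nw, hj,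
      fun p hp => hDW (hin p hp), fun p hp => hDu p (hin p hp), ⟨s, ?_, hw3⟩, ⟨h, ?_, hw1⟩,
      ⟨r, by simp at hr ⊢; grind, hw⟩⟩, hin⟩
    · rw [List.head?_append, hs]; rfl
    · rcases s' with _ | ⟨b, s'⟩ <;> simp at hh ⊢ <;> grind
  exfalso
  push Not at c1 c2 c3
  have hHB : ∀ P', IP G P' → (∀ p ∈ P', p ∈ P ∨ p = rm) → P'.head? = some h → P'.getLast? = some t →
      HL G (u :: w1 :: P' ++ [w2]) := by
    intro P' ip' hP' hh' ht'
    refine HB uw1 uw2 n12 ip' ?_ ⟨h, hh', hw1⟩ ⟨t, ht', hw2⟩ ?_ ?_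
    · intro p hp
      rcases hP' p hp with e | rfl
      · exact Pu p e
      · exact Ru p (by simp)
    · intro p hp hpw
      rcases hP' p hp with e | rfl
      · rw [hh', ← hh]; exact PX p e ⟨w1, w1W, uw1, n1, hpw⟩
      · exact absurd ⟨w1, w1W, uw1, n1, hpw⟩ (c1 p (by simp))
    · intro p hp hpw
      rcases hP' p hp with e | rfl
      · rw [ht', ← ht]; exact PY p e ⟨w2, w2W, uw2, n2, hpw⟩
      · exact absurd ⟨w2, w2W, uw2, n2, hpw⟩ (c2 p (by simp))
  have H1 := hHB P ip (fun p hp => Or.inl hp) hh ht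
  have ip3 : IP G (w3 :: M ++ [rm]) := by
    rw [List.cons_append, IP_cons]
    refine ⟨ipR, fun r hr => ⟨fun e => (Ru r hr).2 (e ▸ uw3), fun hc => ?_, fun hc => ?_⟩⟩
    · exact RX r hr ⟨w3, w3W, uw3, n3, hc.symm⟩
    · rw [hs] at hc; simp at hc; subst hc; exact hw3.symm
  have Rw : ∀ r ∈ M ++ [rm], ¬ G.Adj r w1 ∧ ¬ G.Adj r w2 ∧ r ≠ w1 ∧ r ≠ w2 := by
    intro r hr
    exact ⟨fun hc => c1 r hr ⟨w1, w1W, uw1, n1, hc⟩, fun hc => c2 r hr ⟨w2, w2W, uw2, n2, hc⟩,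
      fun e => (Ru r hr).2 (e ▸ uw1), fun e => (Ru r hr).2 (e ▸ uw2)⟩
  have w3n : ¬ G.Adj w3 w1 ∧ ¬ G.Adj w3 w2 ∧ w3 ≠ w1 ∧ w3 ≠ w2 ∧ w3 ≠ u :=
    ⟨fun e => n13 (Or.inr e.symm), fun e => n23 (Or.inr e.symm), fun e => n13 (Or.inl e.symm),
      fun e => n23 (Or.inl e.symm), uw3.ne'⟩
  have w3P : ∀ p ∈ P, p ≠ w3 ∧ ¬ G.Adj w3 p := fun p hp =>
    ⟨fun e => (Pu p hp).2 (e ▸ uw3), fun hc => c3 p hp ⟨w3, w3W, uw3, n3, hc.symm⟩⟩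
  have mem1 : ∀ P' x, x ∈ u :: w1 :: P' ++ [w2] ↔ x = u ∨ x = w1 ∨ x ∈ P' ∨ x = w2 := by
    intro P' x; simp
  by_cases cq : ∀ x ∈ P, ∀ y ∈ P, G.Adj rm x → G.Adj rm y → Nr G x y
  · obtain ⟨p, hp, hrp⟩ := hrmN
    have := LemmaU hG H1 ip3 (p := u) (q := p) ?_ ?_ ?_ ?_ (by simp) (by simp [hp]) uw3.symm hrp
    · rcases this with e | e
      · exact (Pu p hp).1 e.symm
      · exact (Pu p hp).2 e
    · intro x hx hc
      rw [mem1] at hx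
      have hc : x = w3 ∨ x ∈ M ++ [rm] := by simpa using hc
      rcases hc with rfl | hc
      · have := w3P x; grind
      · have := Rw x hc; have := hdis x hc; have := Ru x hc; grind
    · intro m hm x hx hc
      rw [mem1] at hx
      have k1 := Rw m (by simp [hm]); have k2 := Ru m (by simp [hm]); have k3 := (hM m hm).2
      rcases hx with rfl | rfl | hx | rfl
      · exact k2.2 hc.symm
      · exact k1.1 hc
      · exact k3 x hx hc
      · exact k1.2.1 hc
    · intro x hx y hy h1 h2
      rw [mem1] at hx hy
      have : ∀ x, x = u ∨ x = w1 ∨ x ∈ P ∨ x = w2 → G.Adj w3 x → x = u := by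
        intro x hx hc; have := w3P x; grind
      exact Or.inl ((this x hx h1).trans (this y hy h2).symm)
    · intro x hx y hy h1 h2
      rw [mem1] at hx hy
      have : ∀ x, x = u ∨ x = w1 ∨ x ∈ P ∨ x = w2 → G.Adj rm x → x ∈ P := by
        intro x hx hc; have := Rw rm (by simp); have := Ru rm (by simp); have := G.adj_comm u rm
        grind
      exact cq x (this x hx h1) y (this y hy h2) h1 h2
  · push Not at cq
    obtain ⟨x, hx, y, hy, hrx, hry, hxy⟩ := cq
    simp only [Nr, not_or] at hxy
    obtain ⟨P1, a, Pm, b, P3, hPe, ha, hb, hab, hnab, q1, q3, -, ip'⟩ :=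
      reroute hG ip hrmP hx hy hrx hry hxy.1 hxy.2
    have hsub : ∀ p ∈ P1 ++ a :: rm :: b :: P3, p ∈ P ∨ p = rm := by
      intro p hp; rw [hPe]; simp at hp ⊢; grind
    have H2 := hHB _ ip' hsub (by
        rw [← hh, hPe]; rcases P1 with _ | ⟨b, s'⟩ <;> simp) (by
        rw [← ht, hPe]; simp)
    generalize hP' : P1 ++ a :: rm :: b :: P3 = P' at *
    have hrmP' : rm ∈ P' := by rw [← hP']; simp
    have hrmu := Ru rm (by simp)
    rcases List.eq_nil_or_concat M with rfl | ⟨M', m, rfl⟩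
    · simp at hs; subst hs
      have := (LemmaA hG H2 (r := w3) (a := u) (b := rm) ?_ (by simp) (by simp [hrmP']) uw3.symm
        hw3.symm hrmu.1.symm hrmu.2).2
      · obtain ⟨a, ha, b, hb, d, hd, k1, k2, k3, k4, k5, k6, k7⟩ := this
        rw [mem1] at ha hb hd
        have : ∀ x, x = u ∨ x = w1 ∨ x ∈ P' ∨ x = w2 → G.Adj w3 x → x = u ∨ x = rm := by
          intro x hx hc; have := w3P x; have := hsub x; grind
        have e1 := this a ha k1
        have e2 := this b hb k2
        have e3 := this d hd k3
        grind
      · rw [mem1]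
        have := w3P w3; have := hsub w3; have := (ip3.2 rm (by simp)).1
        grind
    · have hRn' : ∀ r ∈ M' ++ [m], G.Adj r rm → r = m := by
        intro r hr hc
        have := (IP_append.1 ipR).2.2 r (by simpa using hr) rm (by simp)
        have := this.2.1 hc
        simp at this; exact this.symm
      have hmrm : G.Adj m rm := by
        have := (IP_append.1 ipR).2.2 m (by simp) rm (by simp)
        exact this.2.2 (by simp)
      have ip4 : IP G (w3 :: M' ++ [m]) := by
        have : IP G ((w3 :: M' ++ [m]) ++ [rm]) := by simpa using ip3
        exact this.left
      have w3rm : ¬ G.Adj w3 rm := by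
        intro hc
        have := (ip3.2 rm (by simp)).2.1 hc
        rcases M' with _ | ⟨c, M'⟩ <;> simp at this <;> subst this <;> simp at hndR
      have w3n' : ∀ x, x = u ∨ x = w1 ∨ x ∈ P' ∨ x = w2 → G.Adj w3 x → x = u := by
        intro x hx hc; have := w3P x; have := hsub x; grind
      have mn' : ∀ r ∈ M' ++ [m], ∀ x, x = u ∨ x = w1 ∨ x ∈ P' ∨ x = w2 → G.Adj r x → x = rm := by
        intro r hr x hx hc
        have hr' : r ∈ (M'.concat m) ++ [rm] := by clear * - hr; simp at hr ⊢; grind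
        have k1 := Rw r hr'; have k2 := Ru r hr'
        have k3 := G.adj_comm u r
        have k4 := (hM r (by simpa using hr)).2 x; have k5 := hsub x
        clear * - hx k1 k2 k3 k4 k5 hc; grind
      have := LemmaU hG H2 ip4 (p := u) (q := rm) ?_ ?_ ?_ ?_ (by simp) (by simp [hrmP']) uw3.symm hmrm
      · rcases this with e | e
        · exact hrmu.1 e.symm
        · exact hrmu.2 e
      · intro x hx hc
        rw [mem1] at hx
        have hc : x = w3 ∨ x ∈ M' ++ [m] := by simpa using hc
        rcases hc with rfl | hc
        · have := w3P x; have := hsub x; have := (ip3.2 rm (by simp)).1; grind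
        · have hc' : x ∈ (M'.concat m) ++ [rm] := by simp at hc ⊢; grind
          have k1 := Rw x hc'; have k2 := hdis x hc'; have k3 := Ru x hc'
          have k4 := hMl x (by simpa using hc)
          have k5 := hsub x
          clear * - hx k1 k2 k3 k4 k5; grind
      · intro r hr x hx hc
        rw [mem1] at hx
        have := mn' r (by simp [hr]) x hx hc
        subst this
        have e := hRn' r (by simp [hr]) hc
        subst e
        have := ip4.nodup
        rw [List.cons_append, List.nodup_cons] at this
        exact List.disjoint_of_nodup_append this.2 hr (by simp)
      · intro x hx y hy h1 h2
        rw [mem1] at hx hy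
        exact Or.inl ((w3n' x hx h1).trans (w3n' y hy h2).symm)
      · intro x hx y hy h1 h2
        rw [mem1] at hx hy
        exact Or.inl ((mn' m (by simp) x hx h1).trans (mn' m (by simp) y hy h2).symm)

end Part6

section Part7
variable {V : Type*} {G : SimpleGraph V}

theorem IPb {x y : V} {P : List V} (xy : ¬ Nr G x y)
    (ip : IP G P) (hxP : x ∉ P) (hyP : y ∉ P)
    (hd : ∃ h, P.head? = some h ∧ G.Adj h x) (lt : ∃ t, P.getLast? = some t ∧ G.Adj t y)
    (hx : ∀ p ∈ P, G.Adj p x → P.head? = some p) (hy : ∀ p ∈ P, G.Adj p y → P.getLast? = some p) :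
    IP G (x :: P ++ [y]) := by
  obtain ⟨h, hh, hhx⟩ := hd
  obtain ⟨t, ht, hty⟩ := lt
  simp only [Nr, not_or] at xy
  rw [List.cons_append, IP_cons, IP_append]
  refine ⟨⟨ip, by simp, ?_⟩, ?_⟩
  · intro a ha b hb
    simp at hb; subst hb
    refine ⟨fun e => hyP (e ▸ ha), fun hh => ⟨hy a ha hh, by simp⟩, fun hh => ?_⟩
    rw [hh.1] at ht; simp at ht; subst ht; exact hty
  · intro v hv
    simp at hv
    rcases hv with hv | rfl
    · refine ⟨fun e => hxP (e ▸ hv), fun hxv => ?_, fun hxv => ?_⟩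
      · rw [List.head?_append, hx v hv hxv.symm]; rfl
      · rw [List.head?_append, hh] at hxv
        simp at hxv; subst hxv; exact hhx.symm
    · refine ⟨xy.1, fun hc => absurd hc xy.2, fun hc => ?_⟩
      rw [List.head?_append, hh] at hc
      simp at hc; subst hc
      exact absurd (List.mem_of_head? hh) hyP

theorem sector (hG : InC G) {u w : V} (huw : G.Adj u w) : ∀ (n : ℕ) (z : V) (S : List V),
    S.length = n → IP G (z :: S) → G.Adj u z → (∀ t, (z :: S).getLast? = some t → G.Adj u t) →
    u ∉ z :: S → w ∉ z :: S → (∀ v ∈ z :: S, G.Adj u v → ¬ G.Adj w v) →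
    Even (cnt G w (z :: S)) := by
  intro n
  induction n using Nat.strong_induction_on with
  | _ n ih =>
  intro z S hn ip huz hl hu hw hv
  rcases List.eq_nil_or_concat S with rfl | ⟨S', t, hS'⟩
  · rw [cnt_cons_neg (hv z (by simp) huz), cnt_nil]; simp
  have hut : G.Adj u t := hl t (by rw [hS']; simp)
  obtain ⟨s, z', t', hS, huz', hs⟩ := exists_first (p := fun v => G.Adj u v) (l := S)
    ⟨t, by rw [hS']; simp, hut⟩
  subst hS
  have hip' : IP G (z' :: t') := ip.1.right
  have e1 := ih t'.length (by rw [← hn]; simp; omega) z' t' rfl hip' huz' (by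
    intro t ht; exact hl t (by simpa using ht)) (by simp at hu ⊢; grind) (by simp at hw ⊢; grind)
    (fun v hv' => hv v (by simp at hv' ⊢; grind))
  rw [cnt_cons_neg (hv z (by simp) huz), cnt_append]
  refine Even.add ?_ e1
  by_cases hd : ∃ d ∈ s, G.Adj w d
  · obtain ⟨d, hds, hwd⟩ := hd
    have hne : s ≠ [] := by rintro rfl; simp at hds
    have ip2 : IP G (z :: s ++ [z']) := by
      have : IP G ((z :: s ++ [z']) ++ t') := by simpa using ip
      exact this.left
    have H := HL_of_IP ip2 hne (r := u) (by simp at hu ⊢; grind) huz huz' hs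
    have := (LemmaA hG H (r := w) (a := u) (b := d) (by
      have := huw.ne'
      simp at hw ⊢; grind) (by simp) (by simp [hds]) huw.symm hwd
      (by rintro rfl; simp at hu; grind) (hs d hds)).1
    rw [List.cons_append, List.cons_append, cnt_cons_pos huw.symm,
      cnt_cons_neg (hv z (by simp) huz), cnt_append, cnt_cons_neg (hv z' (by simp) huz'), cnt_nil] at this
    simpa [Nat.odd_add_one] using this
  · push Not at hd
    rw [cnt_zero hd]; simp

theorem LemmaPL (hG : InC G) {u x1 x2 w : V} {P R : List V}
    (u1 : G.Adj u x1) (u2 : G.Adj u x2) (uw : G.Adj u w) (n12 : ¬ Nr G x1 x2)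
    (nw1 : ¬ Nr G w x1) (nw2 : ¬ Nr G w x2)
    (ip : IP G P) (Pu : ∀ p ∈ P, p ≠ u ∧ ¬ G.Adj u p)
    (hd : ∃ h, P.head? = some h ∧ G.Adj h x1) (lt : ∃ t, P.getLast? = some t ∧ G.Adj t x2)
    (hx : ∀ p ∈ P, G.Adj p x1 → P.head? = some p) (hy : ∀ p ∈ P, G.Adj p x2 → P.getLast? = some p)
    (ipR : IP G R)
    (hdR : ∃ h, R.head? = some h ∧ G.Adj h x1) (ltR : ∃ t, R.getLast? = some t ∧ G.Adj t x2)
    (hxR : ∀ p ∈ R, G.Adj p x1 → R.head? = some p) (hyR : ∀ p ∈ R, G.Adj p x2 → R.getLast? = some p)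
    (dis : ∀ r ∈ R, r ≠ u ∧ r ≠ x1 ∧ r ≠ x2 ∧ r ≠ w ∧ r ∉ P ∧ ∀ p ∈ P, ¬ G.Adj r p)
    (hRw : ∀ r ∈ R, G.Adj u r → ¬ G.Adj w r) : ∀ p ∈ P, ¬ G.Adj w p := by
  intro p hp hwp
  have H1 := HB u1 u2 n12 ip Pu hd lt hx hy
  simp only [Nr, not_or] at nw1 nw2
  have hwP : w ∉ P := fun hc => (Pu w hc).2 uw
  have x1P : x1 ∉ P := fun hc => (Pu x1 hc).2 u1
  have x2P : x2 ∉ P := fun hc => (Pu x2 hc).2 u2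
  obtain ⟨o1, a, ha, b, hb, d, hd', k1, k2, k3, k4, k5, k6, k7, k8, k9⟩ :=
    LemmaA hG H1 (r := w) (a := u) (b := p) (by
      have := uw.ne'; have := nw1.1; have := nw2.1; simp; grind) (by simp) (by simp [hp]) uw.symm hwp
      (Pu p hp).1.symm (Pu p hp).2
  have hcP : cnt G w (u :: x1 :: P ++ [x2]) = cnt G w P + 1 := by
    rw [List.cons_append, List.cons_append, cnt_cons_pos uw.symm, cnt_cons_neg nw1.2, cnt_append,
      cnt_cons_neg nw2.2, cnt_nil]
  have memP : ∀ x ∈ u :: x1 :: P ++ [x2], G.Adj w x → x = u ∨ x ∈ P := by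
    intro x hx hwx; simp at hx; grind
  have hab : ∃ a ∈ P, ∃ b ∈ P, G.Adj w a ∧ G.Adj w b ∧ a ≠ b ∧ ¬ G.Adj a b := by
    have e1 := memP a ha k1
    have e2 := memP b hb k2
    have e3 := memP d hd' k3
    by_cases ca : a = u
    · exact ⟨b, by grind, d, by grind, k2, k3, k6.symm, fun h => k9 h.symm⟩
    · by_cases cb : b = u
      · exact ⟨a, by grind, d, by grind, k1, k3, k5.symm, fun h => k8 h.symm⟩
      · exact ⟨a, by grind, b, by grind, k1, k2, k4, k7⟩
  obtain ⟨a, haP, b, hbP, wa, wb, hab, hnab⟩ := hab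
  have ipP := IPb n12 ip x1P x2P hd lt hx hy
  have x1R : x1 ∉ R := fun hc => (dis x1 hc).2.1 rfl
  have x2R : x2 ∉ R := fun hc => (dis x2 hc).2.2.1 rfl
  have ipF := IPb n12 ipR x1R x2R hdR ltR hxR hyR
  have ev := sector hG uw _ x1 (R ++ [x2]) rfl (by simpa using ipF) u1 (by
      intro t ht; simp at ht; subst ht; exact u2) (by
      have := u1.ne; have := u2.ne; have := dis u; simp; grind) (by
      have := nw1.1; have := nw2.1; have := dis w; simp; grind) (by
      intro v hv; have := hRw v; simp at hv; grind)
  rw [cnt_cons_neg nw1.2, cnt_append, cnt_cons_neg nw2.2, cnt_nil] at ev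
  obtain ⟨h, hh, hhx⟩ := hdR
  obtain ⟨t, ht, htx⟩ := ltR
  have hRne : R ≠ [] := by rintro rfl; simp at hh
  have H2 : HL G ((x1 :: P ++ [x2]) ++ R.reverse) := by
    rw [HL_append (by simp) (by simpa using hRne)]
    have l1 := List.length_pos_iff.2 hRne
    have l2 : 0 < P.length := List.length_pos_iff.2 (by rintro rfl; simp at hp)
    refine ⟨ipP, ipR.rev, by simp; omega, fun v hv r hr => ?_⟩
    have hr : r ∈ R := by simpa using hr
    have := dis r hr
    have e1 : (x1 :: P ++ [x2]).getLast? = some x2 := by simp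
    have e2 : (x1 :: P ++ [x2]).head? = some x1 := by simp
    rw [e1, e2, List.head?_reverse, List.getLast?_reverse]
    have hv : v = x1 ∨ v ∈ P ∨ v = x2 := by simpa using hv
    refine ⟨by rintro rfl; grind, fun hvr => ?_, ?_⟩
    · rcases hv with rfl | hv | rfl
      · exact Or.inr ⟨rfl, hxR r hr hvr.symm⟩
      · exact absurd hvr.symm (this.2.2.2.2.2 v hv)
      · exact Or.inl ⟨rfl, hyR r hr hvr.symm⟩
    · rintro (⟨f1, f2⟩ | ⟨f1, f2⟩)
      · rw [ht] at f2; simp at f1 f2; subst f1; subst f2; exact htx.symm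
      · rw [hh] at f2; simp at f1 f2; subst f1; subst f2; exact hhx.symm
  have o2 := (LemmaA hG H2 (r := w) (a := a) (b := b) (by
    have := nw1.1; have := nw2.1; have := dis w; simp; grind) (by simp [haP]) (by simp [hbP]) wa wb hab hnab).1
  rw [cnt_append, List.cons_append, cnt_cons_neg nw1.2, cnt_append, cnt_cons_neg nw2.2, cnt_nil,
    cnt_reverse] at o2
  rw [hcP] at o1
  simp at ev o1 o2
  grind

end Part7

section Part8
variable {V : Type*} {G : SimpleGraph V}

def Clq (G : SimpleGraph V) (Z : Set V) : Prop := ∀ x ∈ Z, ∀ y ∈ Z, Nr G x y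

def Atom (G : SimpleGraph V) (W : Set V) : Prop :=
  ∀ Z ⊆ W, Clq G Z → ∀ x ∈ W \ Z, ∀ y ∈ W \ Z, Lk G (W \ Z) x y

/-- nonneighbours -/
def Dn (G : SimpleGraph V) (W : Set V) (u : V) : Set V := {v | v ∈ W ∧ v ≠ u ∧ ¬ G.Adj u v}

theorem Lk.cross {S : Set V} {p : V → Prop} {x y : V} (h : Lk G S x y) (hx : p x) (hy : ¬ p y) :
    ∃ a ∈ S, ∃ b ∈ S, G.Adj a b ∧ p a ∧ ¬ p b := by
  induction h with
  | refl => exact absurd hx hy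
  | @tail b c _ hbc ih =>
    by_cases hb : p b
    · exact ⟨b, hbc.2.1, c, hbc.2.2, hbc.1, hb, hy⟩
    · exact ih hb

theorem ne_of_class (hG : InC G) {u a b w w' : V} (ha : G.Adj u a) (hb : G.Adj u b)
    (hw : G.Adj u w) (hw' : G.Adj u w') (hab : ¬ Nr G a b)
      (h1 : Nr G w a) (h2 : Nr G w' b) : ¬ Nr G w w' := by
  intro h3
  exact hab (((h1.symm).trans hG ha hw hw' h3).trans hG ha hw' hb h2)

theorem att_of_atom (hG : InC G) {W : Set V} (hW : Atom G W) {u x x' : V} (huW : u ∈ W)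
    (hx : x ∈ W) (hx' : x' ∈ W)
    (ux : G.Adj u x) (ux' : G.Adj u x') (hn : ¬ Nr G x x') : ∃ d ∈ Dn G W u, Att G W u x d := by
  have hl := hW {u} (by simpa using huW) (by
    intro a ha b hb; simp at ha hb; subst ha; subst hb; exact Or.inl rfl) x ⟨hx, by simpa using ux.ne'⟩
    x' ⟨hx', by simpa using ux'.ne'⟩
  obtain ⟨a, ha, b, hb, hab, pa, pb⟩ := hl.cross (p := fun v => G.Adj u v ∧ Nr G v x) ⟨ux, Nr.refl⟩
    (fun h => hn h.2.symm)
  have hub : ¬ G.Adj u b := fun hub => pb ⟨hub, (Nr.symm (Or.inr hab)).trans hG hub pa.1 ux pa.2⟩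
  exact ⟨b, ⟨hb.1, by simpa using hb.2, hub⟩, a, ha.1, pa.1, pa.2, hab.symm⟩

theorem getPath {W D : Set V} {u x1 x2 : V} 
    (hD : ∀ x ∈ D, ∀ y ∈ D, Lk G D x y)
    (a1 : ∃ d ∈ D, Att G W u x1 d) (a2 : ∃ d ∈ D, Att G W u x2 d) :
    ∃ w1 w2 P, w1 ∈ W ∧ w2 ∈ W ∧ G.Adj u w1 ∧ G.Adj u w2 ∧ Nr G w1 x1 ∧ Nr G w2 x2 ∧
      IP G P ∧ (∀ p ∈ P, p ∈ D) ∧ (∃ h, P.head? = some h ∧ G.Adj h w1) ∧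
      (∃ t, P.getLast? = some t ∧ G.Adj t w2) ∧ (∀ p ∈ P, Att G W u x1 p → P.head? = some p) ∧
      (∀ p ∈ P, Att G W u x2 p → P.getLast? = some p) := by
  obtain ⟨d1, hd1, hatt1⟩ := a1
  obtain ⟨d2, hd2, hatt2⟩ := a2
  obtain ⟨P, ip, PD, ⟨h, hh, hhX⟩, ⟨t, ht, htY⟩, PX, PY⟩ :=
    SP (X := {d | Att G W u x1 d}) (Y := {d | Att G W u x2 d}) hatt1 hatt2 hd1 (hD d1 hd1 d2 hd2)
  obtain ⟨w1, w1W, uw1, n1, hw1⟩ := hhX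
  obtain ⟨w2, w2W, uw2, n2, hw2⟩ := htY
  exact ⟨w1, w2, P, w1W, w2W, uw1, uw2, n1, n2, ip, PD, ⟨h, hh, hw1⟩, ⟨t, ht, hw2⟩, PX, PY⟩

/-- set version of `LemmaUC`. -/
theorem UCset (hG : InC G) {l : List V} (h : HL G l) {S : Set V} (hSl : ∀ x ∈ l, x ∉ S)
    (hc : ∀ r ∈ S, ∀ x ∈ l, ∀ y ∈ l, G.Adj r x → G.Adj r y → Nr G x y)
    {c c' p q : V} (hcS : c ∈ S) (hcc : Lk G S c c') (hp : p ∈ l) (hq : q ∈ l)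
    (hcp : G.Adj c p) (hcq : G.Adj c' q) (hpq : ¬ Nr G p q) :
    ∃ R r1 M r2 p z q l', (∀ r ∈ R, r ∈ S) ∧ IP G R ∧ (r1 :: M ++ [r2]) <:+: R ∧ p ∈ l ∧ z ∈ l ∧ q ∈ l ∧ G.Adj p z ∧ G.Adj z q ∧
      p ≠ q ∧ ¬ G.Adj p q ∧ G.Adj r1 p ∧ G.Adj r2 q ∧ (∃ m ∈ M, G.Adj m z) ∧ HL G l' ∧
      (z :: l').Perm (l ++ (r1 :: M ++ [r2])) ∧ z ∉ l' := by
  obtain ⟨R, ip, RS, ⟨s, hs, hsX⟩, ⟨t, ht, htY⟩, -, -⟩ := SP (X := {c}) (Y := {c'}) rfl rfl hcS hcc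
  have hsX : s = c := hsX
  have htY : t = c' := htY
  subst hsX; subst htY
  have hd : ∀ x ∈ l, x ∉ R := fun x hx hxR => hSl x hx (RS x hxR)
  simp only [Nr, not_or] at hpq
  obtain ⟨r1, M, r2, p, z, q, l', k1, k2, k3, k4, k5, k6, k7, k8, k9, k10, k11, k12, k13⟩ :=
    LemmaUC hG h _ R rfl ip hd (fun r hr => hc r (RS r hr))
    ⟨s, List.mem_of_head? hs, t, List.mem_of_getLast? ht, p, hp, q, hq, hcp, hcq, hpq⟩
  refine ⟨R, r1, M, r2, p, z, q, l', RS, ip, k1, k2, k3, k4, k5, k6, k7, k8, k9, k10, k11, k12, k13, ?_⟩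
  have : (z :: l').Nodup := by
    rw [k13.nodup_iff, List.nodup_append]
    refine ⟨h.nodup, (ip.of_inf k1).nodup, ?_⟩
    rintro a ha b hb rfl
    exact hd a ha (k1.subset hb)
  exact (List.nodup_cons.1 this).1

theorem HL.not_clq {l : List V} (h : HL G l) : ∃ a ∈ l, ∃ b ∈ l, ¬ Nr G a b := by
  rcases l with _ | ⟨a, _ | ⟨b, _ | ⟨c, _ | ⟨d, l⟩⟩⟩⟩
  · exact h.elim
  all_goals try (have := h.length; simp at this; done)
  have hn := h.1.nodup
  refine ⟨b, by simp, d, by simp, ?_⟩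
  rintro (e | e)
  · subst e; simp at hn
  · have := (h.1.2 d (by simp)).2.1 e
    simp at this; subst this; simp at hn

theorem exists_two (_hG : InC G) {W : Set V} (hW : Atom G W) (hnc : ¬ Clq G W) :
    ∃ u ∈ W, ∃ x ∈ W, ∃ y ∈ W, G.Adj u x ∧ G.Adj u y ∧ ¬ Nr G x y := by
  simp only [Clq] at hnc
  push Not at hnc
  obtain ⟨x, hx, y, hy, hxy⟩ := hnc
  have := hW ∅ (by simp) (by intro a ha; simp at ha) x ⟨hx, by simp⟩ y ⟨hy, by simp⟩
  obtain ⟨a, ha, b, hb, hab, pa, pb⟩ := this.cross (p := fun v => Nr G x v) Nr.refl hxy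
  rcases pa with rfl | pa
  · exact absurd (Or.inr hab) pb
  · exact ⟨a, ha.1, x, hx, b, hb.1, pa.symm, hab, pb⟩

/-- if the hole `l` and a component attach only in cliques, there is nothing else. -/
theorem hole_all (hG : InC G) {W : Set V} (hW : Atom G W) {l : List V} (h : HL G l)
    (hl : ∀ x ∈ l, x ∈ W)
    (hc : ∀ r ∈ W, r ∉ l → ∀ x ∈ l, ∀ y ∈ l, G.Adj r x → G.Adj r y → Nr G x y)
    (hz : ∀ z ∈ l, ∀ l', HL G l' → z ∉ l' → (∀ x ∈ l', x ∈ W) → ∀ p ∈ l', ∀ q ∈ l',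
      G.Adj z p → G.Adj z q → Nr G p q) : ∀ r ∈ W, r ∈ l := by
  intro r hr
  by_contra hrl
  by_cases hb : ∃ c c' p q, Lk G (W \ {x | x ∈ l}) r c ∧ Lk G (W \ {x | x ∈ l}) r c' ∧ p ∈ l ∧ q ∈ l ∧
      G.Adj c p ∧ G.Adj c' q ∧ ¬ Nr G p q
  · obtain ⟨c, c', p, q, h1, h2, hp, hq, hcp, hcq, hpq⟩ := hb
    have hrS : r ∈ W \ {x | x ∈ l} := ⟨hr, hrl⟩
    obtain ⟨R, r1, M, r2, p, z, q, l', RS, -, k1, k2, k3, k4, k5, k6, k7, k8, k9, k10, k11, k12, k13, k14⟩ :=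
      UCset hG h (S := W \ {x | x ∈ l}) (fun x hx hx' => hx'.2 hx) (fun r hr => hc r hr.1 hr.2)
        (h1.mem hrS) (h1.symm.trans h2) hp hq hcp hcq hpq
    have hm : ∀ x ∈ l, x ≠ z → x ∈ l' := fun x hx hxz =>
      mem_of_ne (k13.mem_iff.2 (List.mem_append_left _ hx)) hxz
    rcases hz z k3 l' k12 k14 (by
      intro x hx
      have := k13.mem_iff.1 (List.mem_cons_of_mem z hx)
      rcases List.mem_append.1 this with e | e
      · exact hl x e
      · exact (RS x (k1.subset e)).1) p (hm p k2 k5.ne) q (hm q k4 k6.ne') k5.symm k6 with e | e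
    · exact k7 e
    · exact k8 e
  · push Not at hb
    let Z : Set V := {p | p ∈ l ∧ ∃ c, Lk G (W \ {x | x ∈ l}) r c ∧ G.Adj c p}
    have hZ : Clq G Z := by
      rintro x ⟨hx, c, h1, h2⟩ y ⟨hy, c', h3, h4⟩
      exact hb c c' x y h1 h3 hx hy h2 h4
    obtain ⟨a, ha, haZ⟩ : ∃ a ∈ l, a ∉ Z := by
      by_contra hno
      push Not at hno
      obtain ⟨a, ha, b, hb, hab⟩ := h.not_clq
      exact hab (hZ a (hno a ha) b (hno b hb))
    have := hW Z (fun x hx => hl x hx.1) hZ r ⟨hr, fun hh => hrl hh.1⟩ a ⟨hl a ha, haZ⟩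
    obtain ⟨a', ha', b, hb', hab, pa, pb⟩ := this.cross
      (p := fun v => v ∉ l ∧ Lk G (W \ {x | x ∈ l}) r v) ⟨hrl, Lk.refl⟩ (fun hh => hh.1 ha)
    by_cases hbl : b ∈ l
    · exact hb'.2 ⟨hbl, a', pa.2, hab⟩
    · exact pb ⟨hbl, pa.2.trans (Lk.step hab ⟨ha'.1, pa.1⟩ ⟨hb'.1, hbl⟩)⟩

theorem struct_beta (hG : InC G) {W : Set V} (hW : Atom G W)
    (hD : ∀ u ∈ W, ∀ x ∈ Dn G W u, ∀ y ∈ Dn G W u, Lk G (Dn G W u) x y)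
    (hB : ∀ u x y c P, ¬ BadP G W u x y c P) :
    Clq G W ∨ ∃ l, HL G l ∧ ∀ x, x ∈ W ↔ x ∈ l := by
  by_cases hcq : Clq G W
  · exact Or.inl hcq
  right
  have h3 : ∀ u ∈ W, ∀ a ∈ W, ∀ b ∈ W, ∀ c ∈ W, G.Adj u a → G.Adj u b → G.Adj u c →
      ¬ Nr G a b → ¬ Nr G a c → ¬ Nr G b c → False := by
    intro u hu a ha b hb c hc ua ub uc ab ac bc
    obtain ⟨y1, y2, c, P, hbad, -⟩ := LemmaM hG (D := Dn G W u) (W := W) (fun x hx => hx.1) hu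
      (fun d hd => hd.2) (hD u hu) ua ub uc ab ac bc (att_of_atom hG hW hu ha hb ua ub ab)
      (att_of_atom hG hW hu hb ha ub ua (fun e => ab e.symm)) (att_of_atom hG hW hu hc ha uc ua (fun e => ac e.symm))
    exact hB _ _ _ _ _ hbad
  have hA : ∀ l, HL G l → (∀ x ∈ l, x ∈ W) → ∀ r ∈ W, r ∉ l → ∀ x ∈ l, ∀ y ∈ l, G.Adj r x → G.Adj r y → Nr G x y := by
    intro l hl hlW r hr hrl x hx y hy hrx hry
    by_contra hcon
    simp only [Nr, not_or] at hcon
    obtain ⟨-, a, ha, b, hb, d, hd, k1, k2, k3, k4, k5, k6, k7, k8, k9⟩ := LemmaA hG hl hrl hx hy hrx hry hcon.1 hcon.2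
    exact h3 r hr a (hlW a ha) b (hlW b hb) d (hlW d hd) k1 k2 k3 (by simp [Nr, *]) 
      (by rintro (e | e); exact k5 e.symm; exact k8 e.symm) (by rintro (e | e); exact k6 e.symm; exact k9 e.symm)
  obtain ⟨u, hu, x, hx, y, hy, ux, uy, hxy⟩ := exists_two hG hW hcq
  obtain ⟨w1, w2, P, w1W, w2W, u1, u2, n1, n2, ip, PD, hd, lt, PX, PY⟩ := getPath (hD u hu)
    (att_of_atom hG hW hu hx hy ux uy hxy)
    (att_of_atom hG hW hu hy hx uy ux (fun e => hxy e.symm))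
  have H := HB u1 u2 (ne_of_class hG ux uy u1 u2 hxy n1 n2) ip (fun p hp => (PD p hp).2) hd lt
    (fun p hp hpw => PX p hp ⟨w1, w1W, u1, n1, hpw⟩) (fun p hp hpw => PY p hp ⟨w2, w2W, u2, n2, hpw⟩)
  have HW : ∀ x ∈ u :: w1 :: P ++ [w2], x ∈ W := by
    intro x hx
    have := PD x
    simp [Dn] at hx this; grind
  refine ⟨_, H, fun r => ⟨fun hr => ?_, HW r⟩⟩
  refine hole_all hG hW H HW (hA _ H HW) ?_ r hr
  intro z hz l' hl' hzl' hlW p hp q hq zp zq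
  exact hA l' hl' hlW z (HW z hz) hzl' p hp q hq zp zq

end Part8

section Part9
variable {V : Type*} {G : SimpleGraph V}

theorem BadP.rev {W : Set V} {u x y c : V} {P : List V} (h : BadP G W u x y c P) :
    BadP G W u y x c P.reverse where
  uW := h.uW
  xW := h.yW
  yW := h.xW
  cW := h.cW
  ux := h.uy
  uy := h.ux
  uc := h.uc
  xy := fun e => h.xy e.symm
  xc := h.yc
  yc := h.xc
  ip := h.ip.rev
  PW := by simpa using h.PW
  Pu := by simpa using h.Pu
  hd := by simpa using h.lt
  lt := by simpa using h.hd
  mid := by simpa using h.mid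

def MinBad (G : SimpleGraph V) (W : Set V) (n : ℕ) : Prop :=
  ∀ u x y c P, BadP G W u x y c P → n ≤ P.length

def MinBadU (G : SimpleGraph V) (W : Set V) (u : V) (n : ℕ) : Prop :=
  ∀ x y c P, BadP G W u x y c P → n ≤ P.length

theorem M1a (hG : InC G) {W : Set V} {u x y c : V} {P : List V} (h : BadP G W u x y c P)
    (hm : MinBadU G W u P.length) {p w : V} (hp : p ∈ P) (hw : w ∈ W) (uw : G.Adj u w)
    (hpw : G.Adj p w) (hwc : ¬ Nr G w c) (hwy : ¬ Nr G w y) : P.head? = some p ∧ w = x := by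
  obtain ⟨s, t, rfl⟩ := List.append_of_mem hp
  obtain ⟨hd, hhd, hdx⟩ := h.hd
  obtain ⟨lt, hlt, ltx⟩ := h.lt
  rcases s with _ | ⟨s0, s⟩
  · simp at hhd; subst hhd
    exact ⟨by simp, att_unique hG (h.Pu p hp).1 (h.Pu p hp).2 uw h.ux hpw hdx⟩
  exfalso
  have uniq : ∀ v ∈ (s0 :: s) ++ p :: t, ∀ a b, G.Adj u a → G.Adj u b → G.Adj v a → G.Adj v b → a = b :=
    fun v hv a b ha hb => att_unique hG (h.Pu v hv).1 (h.Pu v hv).2 ha hb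
  obtain ⟨p0, hp0, hp0c⟩ := h.mid
  have hne : p0 ≠ p := by
    rintro rfl
    exact hwc (Or.inl (uniq p0 hp0 w c uw h.uc hpw hp0c))
  have hp0' : p0 ∈ s0 :: s ∨ p0 ∈ t := by simp at hp0 ⊢; grind
  rcases hp0' with hp0' | hp0'
  · by_cases hwx : Nr G w x
    · obtain ⟨s1, s2, hs⟩ := List.append_of_mem hp0'
      have hs1 : s1 ≠ [] := by
        rintro rfl
        simp at hs hhd
        have := uniq p0 hp0 c x h.uc h.ux hp0c (by rw [← hs.1, hhd]; exact hdx)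
        exact h.xc (Or.inl this.symm)
      have hin : ∀ v ∈ p0 :: s2 ++ p :: t, v ∈ (s0 :: s) ++ p :: t := by
        intro v hv; rw [hs]; simp at hv ⊢; grind
      have hb : BadP G W u c y w (p0 :: s2 ++ p :: t) := ⟨h.uW, h.cW, h.yW, hw, h.uc, h.uy, uw,
        fun e => h.yc e.symm, fun e => hwc e.symm, fun e => hwy e.symm, by
          have := h.ip; rw [hs, List.append_assoc] at this; exact this.right,
        fun v hv => h.PW v (hin v hv), fun v hv => h.Pu v (hin v hv), ⟨p0, by simp, hp0c⟩, ⟨lt, by simpa using hlt, ltx⟩, ⟨p, by simp, hpw⟩⟩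
      have := hm _ _ _ _ hb
      rw [hs] at this
      have h2 := List.length_pos_iff.2 hs1
      simp only [List.length_append, List.length_cons] at this; omega
    · have ht : t ≠ [] := by
        rintro rfl
        simp at hlt; subst hlt
        exact hwy (Or.inl (uniq p hp w y uw h.uy hpw ltx))
      have hin : ∀ v ∈ (s0 :: s) ++ [p], v ∈ (s0 :: s) ++ p :: t := by
        intro v hv; simp at hv ⊢; grind
      have hb : BadP G W u x w c ((s0 :: s) ++ [p]) := ⟨h.uW, h.xW, hw, h.cW, h.ux, uw, h.uc,
        fun e => hwx e.symm, h.xc, hwc, by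
          have : IP G (((s0 :: s) ++ [p]) ++ t) := by simpa using h.ip
          exact this.left,
        fun v hv => h.PW v (hin v hv), fun v hv => h.Pu v (hin v hv), ⟨hd, by simpa using hhd, hdx⟩,
        ⟨p, by simp, hpw⟩, ⟨p0, List.mem_append_left _ hp0', hp0c⟩⟩
      have := hm _ _ _ _ hb
      have h2 := List.length_pos_iff.2 ht
      simp only [List.length_append, List.length_cons, List.length_nil] at this; omega
  · have hin : ∀ v ∈ p :: t, v ∈ (s0 :: s) ++ p :: t := by
        intro v hv; simp at hv ⊢; grind
    have hb : BadP G W u w y c (p :: t) := ⟨h.uW, hw, h.yW, h.cW, uw, h.uy, h.uc, hwy, hwc, h.yc, h.ip.right,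
        fun v hv => h.PW v (hin v hv), fun v hv => h.Pu v (hin v hv), ⟨p, by simp, hpw⟩,
        ⟨lt, by simpa using hlt, ltx⟩, ⟨p0, List.mem_cons_of_mem _ hp0', hp0c⟩⟩
    have := hm _ _ _ _ hb
    simp only [List.length_append, List.length_cons] at this; omega

theorem M1 (hG : InC G) {W : Set V} {u x y c : V} {P : List V} (h : BadP G W u x y c P)
    (hm : MinBadU G W u P.length) {p w : V} (hp : p ∈ P) (hw : w ∈ W) (uw : G.Adj u w)
    (hpw : G.Adj p w) (hwc : ¬ Nr G w c) :
    (P.head? = some p ∧ w = x) ∨ (P.getLast? = some p ∧ w = y) := by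
  by_cases hwy : Nr G w y
  · right
    have := M1a hG h.rev (by simpa using hm) (p := p) (w := w) (by simpa using hp) hw uw hpw hwc
      (fun e => h.xy (e.symm.trans hG h.ux uw h.uy hwy))
    simpa using this
  · exact Or.inl (M1a hG h hm hp hw uw hpw hwc hwy)

theorem bad_hole (hG : InC G) {W : Set V} {u x y c : V} {P : List V} (h : BadP G W u x y c P)
    (hm : MinBad G W P.length) : HL G (u :: x :: P ++ [y]) := by
  refine HB h.ux h.uy h.xy h.ip h.Pu h.hd h.lt (fun p hp hpx => ?_) (fun p hp hpy => ?_)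
  · rcases M1 hG h (hm _) hp h.xW h.ux hpx h.xc with e | e
    · exact e.1
    · exact absurd (Or.inl e.2) h.xy
  · rcases M1 hG h (hm _) hp h.yW h.uy hpy h.yc with e | e
    · exact absurd (Or.inl e.2.symm) h.xy
    · exact e.1

theorem IP.deg {l : List V} (h : IP G l) {v a b c : V} (hv : v ∈ l) (ha : a ∈ l) (hb : b ∈ l) (hc : c ∈ l)
    (hab : a ≠ b) (hac : a ≠ c) (hbc : b ≠ c) (va : G.Adj v a) (vb : G.Adj v b) (vc : G.Adj v c) : False := by
  obtain ⟨i, hi, rfl⟩ := List.mem_iff_getElem.1 hv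
  have key : ∀ a ∈ l, G.Adj l[i] a → l[i+1]? = some a ∨ (0 < i ∧ l[i-1]? = some a) := by
    intro a ha hva
    obtain ⟨j, hj, rfl⟩ := List.mem_iff_getElem.1 ha
    rcases lt_trichotomy i j with hij | hij | hij
    · left; rw [← (h.getElem hij hj).1 hva]; simp [hj]
    · subst hij; exact absurd hva (G.loopless.irrefl _)
    · right
      have := (h.getElem hij hi).1 hva.symm
      refine ⟨by omega, ?_⟩
      have e : i - 1 = j := by omega
      rw [e]; simp [hj]
  rcases key a ha va with e1 | e1 <;> rcases key b hb vb with e2 | e2 <;> rcases key c hc vc with e3 | e3 <;> grind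

set_option maxHeartbeats 1000000 in
theorem M2 (hG : InC G) {W : Set V} {u x y c : V} {P : List V} (h : BadP G W u x y c P)
    (hm : MinBad G W P.length) {r : V} (hr : r ∈ W) (hrH : r ∉ u :: x :: P ++ [y]) (hrc : ¬ Nr G r c)
    {a0 b0 : V} (ha0 : a0 ∈ u :: x :: P ++ [y]) (hb0 : b0 ∈ u :: x :: P ++ [y]) (ra0 : G.Adj r a0)
    (rb0 : G.Adj r b0) : Nr G a0 b0 := by
  have H := bad_hole hG h hm
  have ipE : IP G (x :: P ++ [y]) := H.1
  have memH : ∀ v, v ∈ u :: x :: P ++ [y] ↔ v = u ∨ v = x ∨ v ∈ P ∨ v = y := by intro v; simp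
  by_cases hru : G.Adj u r
  · have hrP : ∀ p ∈ P, ¬ G.Adj r p := by
      intro p hp hrp
      rcases M1 hG h (hm _) hp hr hru hrp.symm hrc with e | e
      · apply hrH; rw [e.2]; simp
      · apply hrH; rw [e.2]; simp
    have hxy : ¬ (G.Adj r x ∧ G.Adj r y) := fun e =>
      h.xy (Nr.trans hG h.ux hru h.uy (Or.inr e.1.symm) (Or.inr e.2))
    rw [memH] at ha0 hb0
    have := hrP a0; have := hrP b0; have := h.ux; have := h.uy; have := h.ux.symm; have := h.uy.symm
    simp only [Nr]
    grind
  by_contra hcon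
  simp only [Nr, not_or] at hcon
  obtain ⟨-, a', ha', b', hb', d', hd', ra', rb', rd', k4, k5, k6, k7, k8, k9⟩ := LemmaA hG H hrH ha0 hb0 ra0 rb0 hcon.1 hcon.2
  have inE : ∀ v ∈ u :: x :: P ++ [y], G.Adj r v → v ∈ x :: P ++ [y] := by
    intro v hv hrv
    exact mem_of_ne hv (by rintro rfl; exact hru hrv.symm)
  have hrE : r ∉ x :: P ++ [y] := fun e => hrH (List.mem_cons_of_mem _ e)
  obtain ⟨E1, a, Em, b, E3, hE, ra, rb, hab, hnab, hE1, hE3, hlen, ipE'⟩ := reroute hG ipE hrE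
    (inE _ ha0 ra0) (inE _ hb0 rb0) ra0 rb0 hcon.1 hcon.2
  obtain ⟨P', hP'⟩ : ∃ P', E1 ++ a :: r :: b :: E3 = x :: P' ++ [y] := by
    rcases snoc_cases (E1 ++ a :: r :: b :: E3) with e | ⟨_, e⟩ | ⟨x', P', y', e⟩
    · simp at e
    · have := congrArg List.length e; simp at this; omega
    · have e1 : x' = x := by
        have e1 : (E1 ++ a :: r :: b :: E3).head? = some x' := by rw [e]; simp
        have e2 : (E1 ++ a :: Em ++ b :: E3).head? = some x := by rw [← hE]; simp
        rcases E1 with _ | ⟨_, _⟩ <;> simp at e1 e2 <;> grind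
      have e2 : y' = y := by
        have e1 : (E1 ++ a :: r :: b :: E3).getLast? = some y' := by rw [e]; simp
        have e2 : (E1 ++ a :: Em ++ b :: E3).getLast? = some y := by rw [← hE]; simp
        simp at e1 e2; grind
      subst e1; subst e2; exact ⟨P', e⟩
  have ndE := ipE.nodup
  have ndE' := ipE'.nodup
  rw [hP'] at ipE' ndE'
  have hxP' : x ∉ P' ∧ y ∉ P' ∧ P'.Nodup := by
    rw [List.cons_append, List.nodup_cons] at ndE'
    refine ⟨fun e => ndE'.1 (by simp [e]), fun e => ?_, (List.nodup_append.1 ndE'.2).1⟩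
    exact List.disjoint_of_nodup_append ndE'.2 e (by simp)
  have memE : ∀ v, v ∈ x :: P ++ [y] ↔ v ∈ E1 ∨ v = a ∨ v ∈ Em ∨ v = b ∨ v ∈ E3 := by
    intro v; rw [hE]; simp
  have memE' : ∀ v, v ∈ x :: P' ++ [y] ↔ v ∈ E1 ∨ v = a ∨ v = r ∨ v = b ∨ v ∈ E3 := by
    intro v; rw [← hP']; simp
  have memP' : ∀ v ∈ P', v ∈ P ∨ v = r := by
    intro v hv
    have h1 := (memE' v).1 (by simp [hv])
    by_cases e : v = r
    · exact Or.inr e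
    · have h2 := (memE v).2 (by grind)
      have : v ≠ x := by rintro rfl; exact hxP'.1 hv
      have : v ≠ y := by rintro rfl; exact hxP'.2.1 hv
      simp at h2; grind
  have hru' : r ≠ u := by rintro rfl; simp at hrH
  have P'u : ∀ p ∈ P', p ≠ u ∧ ¬ G.Adj u p := by
    intro p hp
    rcases memP' p hp with e | rfl
    · exact h.Pu p e
    · exact ⟨hru', hru⟩
  have hlP' : P'.length < P.length := by
    have e1 := congrArg List.length hE
    have e2 := congrArg List.length hP'
    simp at e1 e2; omega
  have hP'ne : P' ≠ [] := by
    rintro rfl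
    have := (memE' r).2 (by simp)
    simp at this
    rcases this with rfl | rfl
    · simp at hrH
    · simp at hrH
  have hcP' : ∀ p ∈ P', ¬ G.Adj p c := by
    intro p hp hpc
    have hb : BadP G W u x y c P' := by
      refine ⟨h.uW, h.xW, h.yW, h.cW, h.ux, h.uy, h.uc, h.xy, h.xc, h.yc, ipE'.1.left, ?_, P'u, ?_, ?_, ⟨p, hp, hpc⟩⟩
      · intro v hv
        rcases memP' v hv with e | rfl
        · exact h.PW v e
        · exact hr
      · rcases P' with _ | ⟨q, P'⟩
        · exact absurd rfl hP'ne
        · exact ⟨q, rfl, ((ipE'.2 q (by simp)).2.2 (by simp)).symm⟩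
      · rcases List.eq_nil_or_concat P' with e | ⟨P'', q, rfl⟩
        · exact absurd e hP'ne
        · refine ⟨q, by simp, ?_⟩
          have := (IP_append.1 ipE').2.2 q (by simp) y (by simp)
          exact this.2.2 (by simp)
    have := hm _ _ _ _ _ hb
    omega
  have H' : HL G (u :: x :: P' ++ [y]) := HL_of_IP ipE' hP'ne (by
    have := h.ux.ne; have := h.uy.ne; have := P'u u; simp; grind) h.ux h.uy (fun p hp => (P'u p hp).2)
  have memH' : ∀ v, v ∈ u :: x :: P' ++ [y] ↔ v = u ∨ v ∈ E1 ∨ v = a ∨ v = r ∨ v = b ∨ v ∈ E3 := by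
    intro v; rw [← memE' v]; simp
  have hcH' : ∀ v ∈ u :: x :: P' ++ [y], G.Adj c v → v = u := by
    intro v hv hcv
    simp at hv
    rcases hv with rfl | rfl | hv | rfl
    · rfl
    · exact absurd (Or.inr hcv.symm) h.xc
    · exact absurd hcv.symm (hcP' v hv)
    · exact absurd (Or.inr hcv.symm) h.yc
  have hcnH' : c ∉ u :: x :: P' ++ [y] := by
    intro hv
    simp at hv
    rcases hv with e | e | hv | e
    · exact h.uc.ne e.symm
    · exact h.xc (Or.inl e.symm)
    · exact (P'u c hv).2 h.uc
    · exact h.yc (Or.inl e.symm)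
  -- r has a neighbour in Em
  have rEm : ∃ v ∈ Em, G.Adj r v := by
    have e1 : ∀ v ∈ u :: x :: P ++ [y], G.Adj r v → v = a ∨ v ∈ Em ∨ v = b := by
      intro v hv hrv
      have := (memE v).1 (inE v hv hrv)
      have := hE1 v; have := hE3 v; grind
    have f1 := e1 a' ha' ra'
    have f2 := e1 b' hb' rb'
    have f3 := e1 d' hd' rd'
    grind
  have cEm : ∃ v ∈ Em, G.Adj c v := by
    obtain ⟨p0, hp0, hp0c⟩ := h.mid
    refine ⟨p0, ?_, hp0c.symm⟩
    have h1 := (memE p0).1 (by simp [hp0])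
    by_contra hno
    have h2 := (memH' p0).2 (by grind)
    have := hcH' p0 h2 hp0c.symm
    exact (h.Pu p0 hp0).1 this
  have ipEm : IP G Em := by
    have := ipE; rw [hE] at this; exact this.left.right.1
  have EmE : ∀ v ∈ Em, v ∈ x :: P ++ [y] := fun v hv => (memE v).2 (by simp [hv])
  have ndE2 : (E1 ++ a :: Em ++ b :: E3).Nodup := by rw [← hE]; exact ndE
  have EmNot : ∀ v ∈ Em, v ∉ E1 ∧ v ≠ a ∧ v ≠ b ∧ v ∉ E3 := by
    intro v hv
    simp [List.nodup_append] at ndE2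
    grind
  have EmP : ∀ v ∈ Em, v ∈ P := by
    intro v hv
    have h1 := EmE v hv
    have h2 : v ≠ x := by
      rintro rfl
      have := (memE' v).1 (by simp)
      have := EmNot v hv
      have : v ≠ r := by rintro rfl; simp at hrH
      grind
    have h3 : v ≠ y := by
      rintro rfl
      have := (memE' v).1 (by simp)
      have := EmNot v hv
      have : v ≠ r := by rintro rfl; simp at hrH
      grind
    simp at h1; grind
  have EmAdj : ∀ v ∈ Em, ∀ w ∈ u :: x :: P' ++ [y], G.Adj v w → w = a ∨ w = r ∨ w = b := by
    intro v hv w hw hvw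
    have hip := ipE
    rw [hE] at hip
    rcases (memH' w).1 hw with rfl | hw | rfl | rfl | rfl | hw
    · exact absurd hvw.symm (h.Pu v (EmP v hv)).2
    · have hip' : IP G (E1 ++ (a :: (Em ++ b :: E3))) := by simpa using hip
      have := ((IP_append.1 hip').2.2 w hw v (by simp [hv])).2.1 hvw.symm
      simp at this
      exact absurd this.2.symm (EmNot v hv).2.1
    · exact Or.inl rfl
    · exact Or.inr (Or.inl rfl)
    · exact Or.inr (Or.inr rfl)
    · have hip' : IP G ((E1 ++ a :: Em ++ [b]) ++ E3) := by simpa using hip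
      have := ((IP_append.1 hip').2.2 v (by simp [hv]) w hw).2.1 hvw
      simp at this
      exact absurd this.1.symm (EmNot v hv).2.2.1
  have EmR : ∀ v ∈ Em, v ≠ r := by rintro v hv rfl; exact hrE (EmE v hv)
  have EmC : ∀ v ∈ Em, ∀ p ∈ u :: x :: P' ++ [y], ∀ q ∈ u :: x :: P' ++ [y], G.Adj v p → G.Adj v q → p = q ∨ G.Adj p q := by
    intro v hv p hp q hq hvp hvq
    have hnab2 : ¬ (G.Adj v a ∧ G.Adj v b) := fun e => EmR v hv (CN hG hab hnab e.1 e.2 ra rb)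
    have := EmAdj v hv p hp hvp
    have := EmAdj v hv q hq hvq
    have := ra.symm; have := rb.symm
    grind
  have EmNH' : ∀ v ∈ Em, v ∉ u :: x :: P' ++ [y] := by
    intro v hv hc
    have := (memH' v).1 hc
    have h1 := EmNot v hv; have h2 := EmR v hv; have h3 := (h.Pu v (EmP v hv)).1
    grind
  obtain ⟨vc, hvc, cvc⟩ := cEm
  obtain ⟨vr, hvr, rvr⟩ := rEm
  obtain ⟨L, ipL, LS, ⟨hd, hhd, hdX⟩, ⟨t, ht, htY⟩, LX, LY⟩ := SP (G := G) (S := {v | v ∈ Em}) (X := {v | G.Adj c v})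
    (Y := {v | G.Adj r v}) cvc rvr hvc (ipEm.lk (fun v hv => hv) hvc hvr)
  have hcc : ∀ p ∈ u :: x :: P' ++ [y], ∀ q ∈ u :: x :: P' ++ [y], G.Adj c p → G.Adj c q → p = q ∨ G.Adj p q :=
    fun p hp q hq cp cq => Or.inl ((hcH' p hp cp).trans (hcH' q hq cq).symm)
  have hcEm : ∀ v ∈ Em, v ≠ c := by
    rintro v hv rfl
    exact (h.Pu v (EmP v hv)).2 h.uc
  have hdEm : hd ∈ Em := LS hd (List.mem_of_head? hhd)
  by_cases hatt : ∃ q ∈ u :: x :: P' ++ [y], G.Adj hd q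
  · obtain ⟨q, hq, hdq⟩ := hatt
    have hqu : ¬ Nr G u q := by
      rintro (e | e)
      · subst e; exact (h.Pu hd (EmP hd hdEm)).2 hdq.symm
      · have := att_unique hG (h.Pu hd (EmP hd hdEm)).1 (h.Pu hd (EmP hd hdEm)).2 e h.uc hdq (G.adj_symm hdX)
        subst this; exact hcnH' hq
    refine hqu (LemmaU hG H' (r1 := c) (M := []) (rm := hd) (p := u) (q := q) ?_ ?_ (by simp) hcc (EmC hd hdEm) (by simp) hq h.uc.symm hdq)
    · simp [IP_cons, (hcEm hd hdEm).symm]; exact hdX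
    · intro v hv hv'
      simp at hv'
      rcases hv' with rfl | rfl
      · exact hcnH' hv
      · exact EmNH' _ hdEm hv
  push Not at hatt
  have hrmem : r ∈ u :: x :: P' ++ [y] := (memH' r).2 (by simp)
  have hdt : hd ≠ t := by
    rintro rfl
    exact hatt r hrmem (G.adj_symm htY)
  obtain ⟨M, rfl⟩ : ∃ M, L = hd :: M ++ [t] := by
    rcases snoc_cases L with rfl | ⟨v, rfl⟩ | ⟨v, M, w, rfl⟩
    · simp at hhd
    · simp at hhd ht; subst hhd; exact absurd ht hdt
    · simp at hhd ht; subst hhd; subst ht; exact ⟨M, rfl⟩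
  have ipR : IP G (c :: (hd :: M) ++ [t]) := by
    rw [List.cons_append, IP_cons]
    refine ⟨ipL, fun v hv => ⟨(hcEm v (LS v hv)).symm, fun e => LX v hv e, fun e => ?_⟩⟩
    simp at e; subst e; exact hdX
  have htEm : t ∈ Em := LS t (by simp)
  have : Nr G u r := by
    refine LemmaU hG H' (r1 := c) (M := hd :: M) (rm := t) (p := u) (q := r) ipR ?_ ?_ hcc (EmC t htEm) (by simp) hrmem h.uc.symm (G.adj_symm htY)
    · intro v hv hv'
      have hv' : v = c ∨ v ∈ hd :: M ++ [t] := by simpa using hv'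
      rcases hv' with rfl | hv'
      · exact hcnH' hv
      · exact EmNH' _ (LS v hv') hv
    · intro m hm v hv hmv
      rcases List.mem_cons.1 hm with rfl | hm
      · exact hatt v hv hmv
      obtain ⟨M1, M2, rfl⟩ := List.append_of_mem hm
      have hmL : m ∈ hd :: (M1 ++ m :: M2) ++ [t] := by simp
      have hmEm := LS m hmL
      have ndL := ipL.nodup
      have hmt : m ≠ t := by
        rintro rfl
        rw [List.cons_append, List.nodup_cons] at ndL
        exact List.disjoint_of_nodup_append ndL.2 (by simp) (by simp : m ∈ [m])
      have hmr : v ≠ r := by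
        rintro rfl
        have := LY m hmL hmv.symm
        simp at this; exact hmt this.symm
      obtain ⟨pr, hpr⟩ : ∃ pr, (hd :: M1).getLast? = some pr := by
        rw [← Option.isSome_iff_exists]; simp
      obtain ⟨su, hsu⟩ : ∃ su, (M2 ++ [t]).head? = some su := by
        rw [← Option.isSome_iff_exists]; simp
      have q1 : IP G ((hd :: M1) ++ (m :: (M2 ++ [t]))) := by simpa using ipL
      have hprm := List.mem_of_getLast? hpr
      have hsum := List.mem_of_head? hsu
      have a1 : G.Adj pr m := ((IP_append.1 q1).2.2 pr hprm m (by simp)).2.2 ⟨hpr, by simp⟩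
      have a2 : G.Adj m su := (q1.right.2 su hsum).2.2 hsu
      have a3 : pr ≠ su := ((IP_append.1 q1).2.2 pr hprm su (by simp at hsum ⊢; grind)).1
      have prEm : pr ∈ Em := LS pr (by simp at hprm ⊢; grind)
      have suEm : su ∈ Em := LS su (by simp at hsum ⊢; grind)
      have hvab : v = a ∨ v = b := by have := EmAdj m hmEm v hv hmv; grind
      have hvne : ∀ w ∈ Em, w ≠ v := by intro w hw; have := EmNot w hw; grind
      have hvE : v ∈ x :: P ++ [y] := (memE v).2 (by grind)
      exact ipE.deg (EmE m hmEm) (EmE pr prEm) (EmE su suEm) hvE a3 (hvne pr prEm) (hvne su suEm) a1.symm a2 hmv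
  rcases this with e | e
  · exact hru' e.symm
  · exact hru e

end Part9

section Part10
variable {V : Type*} {G : SimpleGraph V}

set_option maxHeartbeats 1000000 in
theorem M3 (hG : InC G) {W : Set V} {u x y c : V} {P : List V} (h : BadP G W u x y c P)
    (hm : MinBad G W P.length) (hD : ∀ a ∈ Dn G W c, ∀ b ∈ Dn G W c, Lk G (Dn G W c) a b) : False := by
  have H := bad_hole hG h hm
  have ipE : IP G (x :: P ++ [y]) := H.1
  have memH : ∀ v, v ∈ u :: x :: P ++ [y] ↔ v = u ∨ v ∈ x :: P ++ [y] := by intro v; simp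
  obtain ⟨p0, hp0, hp0c⟩ := h.mid
  obtain ⟨E1, s, E2, hE, hcs, hcE1⟩ := exists_first (p := fun v => G.Adj c v) (l := x :: P ++ [y])
    ⟨p0, by simp [hp0], hp0c.symm⟩
  have HW : ∀ v ∈ u :: x :: P ++ [y], v ∈ W := by
    intro v hv
    have := h.uW; have := h.xW; have := h.yW; have := h.PW v
    simp at hv; grind
  have hcx : ¬ G.Adj c x := fun e => h.xc (Or.inr e.symm)
  have hcy : ¬ G.Adj c y := fun e => h.yc (Or.inr e.symm)
  have hcH : c ∉ u :: x :: P ++ [y] := by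
    intro hv
    simp at hv
    rcases hv with e | e | hv | e
    · exact h.uc.ne e.symm
    · exact h.xc (Or.inl e.symm)
    · exact (h.Pu c hv).2 h.uc
    · exact h.yc (Or.inl e.symm)
  have memE : ∀ v, v ∈ x :: P ++ [y] ↔ v ∈ E1 ∨ v = s ∨ v ∈ E2 := by intro v; rw [hE]; simp
  have ndE := ipE.nodup
  rw [hE] at ipE ndE
  have E1H : ∀ v ∈ E1, v ∈ u :: x :: P ++ [y] := fun v hv => (memH v).2 (Or.inr ((memE v).2 (Or.inl hv)))
  have hxE1 : x ∈ E1 := by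
    rcases E1 with _ | ⟨e, E1⟩
    · simp at hE; rw [← hE.1] at hcs; exact absurd hcs hcx
    · simp at hE; simp [hE.1]
  have hyE1 : y ∉ E1 := by
    intro hy
    have : (E1 ++ s :: E2).getLast? = some y := by rw [← hE]; simp
    rw [getLast?_app] at this
    exact List.disjoint_of_nodup_append ndE hy (List.mem_of_getLast? this)
  let Ys : Set V := {v | v ∈ u :: x :: P ++ [y] ∧ v ∉ E1 ∧ ¬ G.Adj c v}
  have hyY : y ∈ Ys := ⟨by simp, hyE1, hcy⟩
  -- edges of H leaving E1
  have edgeE1 : ∀ e ∈ E1, ∀ v ∈ Ys, ¬ Nr G e v := by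
    rintro e he v ⟨hv, hv1, hcv⟩ (rfl | hev)
    · exact hv1 he
    rcases (memH v).1 hv with rfl | hv
    · exact hcv h.uc.symm
    · have hv2 : v = s ∨ v ∈ E2 := by have := (memE v).1 hv; grind
      have := ((IP_append.1 ipE).2.2 e he v (by simp; grind)).2.1 hev
      simp at this
      rw [this.2] at hcs
      exact hcv hcs
  have xD : x ∈ Dn G W c := ⟨h.xW, fun e => h.xc (Or.inl e), hcx⟩
  have yD : y ∈ Dn G W c := ⟨h.yW, fun e => h.yc (Or.inl e), hcy⟩
  let S : Set V := {v | v ∈ Dn G W c ∧ v ∉ u :: x :: P ++ [y]}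
  obtain ⟨L, ipL, LD, ⟨hd, hhd, hdX⟩, ⟨t, ht, htY⟩, LX, LY⟩ := SP (X := {v | v ∈ E1}) (Y := Ys) hxE1 hyY xD (hD x xD y yD)
  have hdX : hd ∈ E1 := hdX
  obtain ⟨R0, rfl⟩ : ∃ R0, L = hd :: R0 ++ [t] := by
    rcases snoc_cases L with rfl | ⟨v, rfl⟩ | ⟨v, M, w, rfl⟩
    · simp at hhd
    · simp at hhd ht; subst hhd; subst ht; exact absurd Nr.refl (edgeE1 _ hdX _ htY)
    · simp at hhd ht; subst hhd; subst ht; exact ⟨M, rfl⟩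
  have ndL := ipL.nodup
  rw [List.cons_append, List.nodup_cons] at ndL
  have R0S : ∀ r ∈ R0, r ∈ S := by
    intro r hr
    have hrL : r ∈ hd :: R0 ++ [t] := by simp [hr]
    refine ⟨LD r hrL, fun hrH => ?_⟩
    by_cases hrE : r ∈ E1
    · have := LX r hrL hrE
      simp at this; subst this; exact ndL.1 (by simp [hr])
    · have := LY r hrL ⟨hrH, hrE, (LD r hrL).2.2⟩
      simp at this; subst this
      exact List.disjoint_of_nodup_append ndL.2 hr (by simp)
  have hR0 : ∃ a ∈ R0, ∃ b ∈ R0, G.Adj a hd ∧ G.Adj b t := by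
    rcases List.eq_nil_or_concat R0 with rfl | ⟨R1, b, hb⟩
    · have : G.Adj hd t := (ipL.2 t (by simp)).2.2 (by simp)
      exact absurd (Or.inr this) (edgeE1 _ hdX _ htY)
    · have e1 : G.Adj b t := by
        have := (IP_append.1 ipL).2.2 b (by simp [hb]) t (by simp)
        exact this.2.2 (by simp [hb])
      rcases R0 with _ | ⟨a, R0⟩
      · simp at hb
      · exact ⟨a, by simp, b, by rw [hb]; simp, ((ipL.2 a (by simp)).2.2 (by simp)).symm, e1⟩
  obtain ⟨a, ha, b, hb, hahd, hbt⟩ := hR0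
  obtain ⟨R, ipR, RS, ⟨f, hf, e, he, hfe⟩, ⟨g, hg, e', he', hge⟩, RX, RY⟩ :=
    SP (X := {v | ∃ e ∈ E1, G.Adj v e}) (Y := {v | ∃ e ∈ Ys, G.Adj v e}) (S := S) ⟨hd, hdX, hahd⟩ ⟨t, htY, hbt⟩ (R0S a ha)
      ((IP.left (A := R0) (ipL.1)).lk R0S ha hb)
  have hSd : ∀ v ∈ u :: x :: P ++ [y], v ∉ R := fun v hv hvR => (RS v hvR).2 hv
  have hnn := edgeE1 e he e' he'
  simp only [Nr, not_or] at hnn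
  obtain ⟨r1, M, r2, p, z, q, l', k1, k2, k3, k4, k5, k6, k7, k8, k9, k10, ⟨m, hmM, hmz⟩, k12, k13⟩ :=
    LemmaUC hG H _ R rfl ipR hSd
      (fun r hr a ha b hb ra rb => M2 hG h hm (RS r hr).1.1 (RS r hr).2
        (by rintro (e | e); exact (RS r hr).1.2.1 e; exact (RS r hr).1.2.2 e.symm) ha hb ra rb)
      ⟨f, List.mem_of_head? hf, g, List.mem_of_getLast? hg, e, E1H e he, e', he'.1, hfe, hge, hnn⟩
  have hmR : m ∈ R := k1.subset (by simp [hmM])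
  have hzc : G.Adj c z := by
    obtain ⟨s1, s2, hs⟩ := k1
    have ndR := ipR.nodup
    rw [← hs] at ndR
    by_contra hcz
    by_cases hzE : z ∈ E1
    · have h1 := RX m hmR ⟨z, hzE, hmz⟩
      rw [← hs] at h1
      have h2 : (s1 ++ [r1]).head? = some m := by
        rcases s1 with _ | ⟨_, _⟩ <;> simpa using h1
      have h3 : ((s1 ++ [r1]) ++ (M ++ [r2] ++ s2)).Nodup := by simpa using ndR
      exact List.disjoint_of_nodup_append h3 (List.mem_of_head? h2) (by simp [hmM])
    · have h1 := RY m hmR ⟨z, ⟨k3, hzE, hcz⟩, hmz⟩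
      rw [← hs] at h1
      have h2 : (r2 :: s2).getLast? = some m := by
        simpa using h1
      have h3 : ((s1 ++ r1 :: M) ++ (r2 :: s2)).Nodup := by simpa using ndR
      exact List.disjoint_of_nodup_append h3 (by simp [hmM]) (List.mem_of_getLast? h2)
  have hcR : ∀ r ∈ r1 :: M ++ [r2], ¬ G.Adj c r := fun r hr => (RS r (k1.subset hr)).1.2.2
  obtain ⟨o1, a', ha', b', hb', d', hd', ca', cb', cd', j4, j5, j6, j7, j8, j9⟩ := LemmaA hG H hcH (a := u) (b := p0)
    (by simp) (by simp [hp0]) h.uc.symm hp0c.symm (h.Pu p0 hp0).1.symm (h.Pu p0 hp0).2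
  have hcnt := cnt_perm (G := G) (r := c) k13
  rw [cnt_append, cnt_cons_pos hzc, cnt_zero hcR] at hcnt
  have hl' : ∀ v ∈ u :: x :: P ++ [y], v ≠ z → v ∈ l' := fun v hv hvz =>
      mem_of_ne (k13.mem_iff.2 (List.mem_append_left _ hv)) hvz
  have hpair : ∃ a ∈ l', ∃ b ∈ l', G.Adj c a ∧ G.Adj c b ∧ a ≠ b ∧ ¬ G.Adj a b := by
    by_cases ca : a' = z
    · exact ⟨b', hl' b' hb' (by grind), d', hl' d' hd' (by grind), cb', cd', j6.symm, fun h => j9 h.symm⟩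
    · by_cases cb : b' = z
      · exact ⟨a', hl' a' ha' ca, d', hl' d' hd' (by grind), ca', cd', j5.symm, fun h => j8 h.symm⟩
      · exact ⟨a', hl' a' ha' ca, b', hl' b' hb' cb, ca', cb', j4, j7⟩
  obtain ⟨a, hal, b, hbl, hca, hcb, hab, hnab⟩ := hpair
  have o2 := (LemmaA hG k12 (r := c) (by
    intro hc
    have := k13.mem_iff.1 (List.mem_cons_of_mem z hc)
    rcases List.mem_append.1 this with e | e
    · exact hcH e
    · exact (RS c (k1.subset e)).1.2.1 rfl) hal hbl hca hcb hab hnab).1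
  grind

theorem struct (hG : InC G) {W : Set V} (hW : Atom G W)
    (hD : ∀ u ∈ W, ∀ x ∈ Dn G W u, ∀ y ∈ Dn G W u, Lk G (Dn G W u) x y) :
    Clq G W ∨ ∃ l, HL G l ∧ ∀ x, x ∈ W ↔ x ∈ l := by
  classical
  by_cases hB : ∃ n, ∃ u x y c P, BadP G W u x y c P ∧ P.length = n
  · exfalso
    obtain ⟨u, x, y, c, P, h, hn⟩ := Nat.find_spec hB
    have hm : MinBad G W P.length := by
      intro u' x' y' c' P' h'
      rw [hn]
      exact Nat.find_min' hB ⟨u', x', y', c', P', h', rfl⟩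
    exact M3 hG h hm (hD c h.cW)
  · exact struct_beta hG hW hD (fun u x y c P h => hB ⟨_, u, x, y, c, P, h, rfl⟩)

end Part10

section Part11
variable {V : Type*} {G : SimpleGraph V}

def Kk (G : SimpleGraph V) (W : Set V) (u x1 x2 : V) : Set V :=
  {w | w ∈ W ∧ G.Adj u w ∧ (Nr G w x1 ∨ Nr G w x2)}

structure Spl (G : SimpleGraph V) (W : Set V) (u x1 x2 : V) (P : List V) (C : Set V) : Prop where
  atom : Atom G W
  uW : u ∈ W
  x1W : x1 ∈ W
  x2W : x2 ∈ W
  u1 : G.Adj u x1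
  u2 : G.Adj u x2
  n12 : ¬ Nr G x1 x2
  ip : IP G P
  PW : ∀ p ∈ P, p ∈ W
  Pu : ∀ p ∈ P, p ≠ u ∧ ¬ G.Adj u p
  hd : ∃ h, P.head? = some h ∧ G.Adj h x1
  lt : ∃ t, P.getLast? = some t ∧ G.Adj t x2
  cl1 : ∀ p ∈ P, ∀ w ∈ W, G.Adj u w → Nr G w x1 → G.Adj p w → P.head? = some p ∧ w = x1
  cl2 : ∀ p ∈ P, ∀ w ∈ W, G.Adj u w → Nr G w x2 → G.Adj p w → P.getLast? = some p ∧ w = x2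
  CW : ∀ c ∈ C, c ∈ W
  uC : u ∉ C
  PC : ∀ p ∈ P, p ∉ C
  Clk : ∀ a ∈ C, ∀ b ∈ C, Lk G C a b
  bd : ∀ c ∈ C, ∀ w ∈ W, w ∉ C → G.Adj c w → w = u ∨ w ∈ Kk G W u x1 x2
  KC : ∀ w ∈ Kk G W u x1 x2, w ∉ C
  y1 : ∃ w ∈ W, G.Adj u w ∧ Nr G w x1 ∧ ∃ c ∈ C, G.Adj c w
  y2 : ∃ w ∈ W, G.Adj u w ∧ Nr G w x2 ∧ ∃ c ∈ C, G.Adj c w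
  pl : ∀ w ∈ W, G.Adj u w → ¬ Nr G w x1 → ¬ Nr G w x2 → ∀ p ∈ P, ¬ G.Adj w p

theorem Kk_comm {W : Set V} {u x1 x2 : V} : Kk G W u x1 x2 = Kk G W u x2 x1 := by
  ext w; simp only [Kk, Set.mem_ofPred_eq]; grind

theorem Spl.symm {W : Set V} {u x1 x2 : V} {P : List V} {C : Set V} (h : Spl G W u x1 x2 P C) :
    Spl G W u x2 x1 P.reverse C where
  atom := h.atom
  uW := h.uW
  x1W := h.x2W
  x2W := h.x1W
  u1 := h.u2
  u2 := h.u1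
  n12 := fun e => h.n12 e.symm
  ip := h.ip.rev
  PW := by simpa using h.PW
  Pu := by simpa using h.Pu
  hd := by simpa using h.lt
  lt := by simpa using h.hd
  cl1 := by simpa using h.cl2
  cl2 := by simpa using h.cl1
  CW := h.CW
  uC := h.uC
  PC := by simpa using h.PC
  Clk := h.Clk
  bd := by rw [Kk_comm]; exact h.bd
  KC := by rw [Kk_comm]; exact h.KC
  y1 := h.y2
  y2 := h.y1
  pl := by
    intro w hw a b c p hp
    exact h.pl w hw a c b p (by simpa using hp)

def SJ (G : SimpleGraph V) (W : Set V) (u x1 x2 : V) (C : Set V) : Set V :=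
  {k | k ∈ Kk G W u x1 x2 ∧ ∀ w ∈ W, w ∉ C → G.Adj k w → Nr G u w}
def SA (G : SimpleGraph V) (W : Set V) (u x1 x2 : V) (C : Set V) : Set V :=
  {v | v ∈ W ∧ v ∉ C ∧ v ∉ SJ G W u x1 x2 C}
def SB0 (G : SimpleGraph V) (W : Set V) (u x1 x2 : V) (C : Set V) : Set V :=
  {v | v ∈ C ∨ v = u ∨ v = x1 ∨ v = x2 ∨ (v ∈ Kk G W u x1 x2 ∧ ∃ c ∈ C, G.Adj c v)}
def SB (G : SimpleGraph V) (W : Set V) (u x1 x2 : V) (P : List V) (C : Set V) : Set V :=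
  {v | v ∈ SB0 G W u x1 x2 C ∨ v ∈ P}
def bdA (G : SimpleGraph V) (W : Set V) (u x1 x2 : V) (C : Set V) : Set V :=
  {v | v ∈ SA G W u x1 x2 C ∧ (v = u ∨ v ∈ Kk G W u x1 x2)}
def bdB (G : SimpleGraph V) (W : Set V) (u x1 x2 : V) (P : List V) (C : Set V) : Set V :=
  {v | v ∈ SB G W u x1 x2 P C ∧ v ∉ C}

theorem SA_comm {W C : Set V} {u x1 x2 : V} : SA G W u x1 x2 C = SA G W u x2 x1 C := by
  simp only [SA, SJ, Kk_comm]
theorem bdA_comm {W C : Set V} {u x1 x2 : V} : bdA G W u x1 x2 C = bdA G W u x2 x1 C := by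
  simp only [bdA]
  rw [SA_comm, Kk_comm]
theorem SB_comm {W C : Set V} {u x1 x2 : V} {P : List V} : SB G W u x1 x2 P C = SB G W u x2 x1 P.reverse C := by
  ext v; simp only [SB, SB0, Set.mem_ofPred_eq, List.mem_reverse]
  rw [Kk_comm]; grind
theorem bdB_comm {W C : Set V} {u x1 x2 : V} {P : List V} : bdB G W u x1 x2 P C = bdB G W u x2 x1 P.reverse C := by
  simp only [bdB]; rw [SB_comm]

/-- descent of links to a subset with linked boundary. -/
theorem Lk.descend {T A : Set V} {bd : Set V} {x y : V} (h : Lk G T x y) (hx : x ∈ A) (hxT : x ∈ T)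
    (hb : ∀ a ∈ T, a ∈ A → ∀ b ∈ T, b ∉ A → G.Adj a b → a ∈ bd)
    (hl : ∀ a ∈ T, a ∈ A → a ∈ bd → ∀ b ∈ T, b ∈ A → b ∈ bd → Lk G (T ∩ A) a b) :
    (y ∈ A → Lk G (T ∩ A) x y) ∧ (y ∉ A → ∃ e ∈ T ∩ A, e ∈ bd ∧ Lk G (T ∩ A) x e) := by
  induction h with
  | refl => exact ⟨fun _ => Lk.refl, fun h => absurd hx h⟩
  | @tail b c hxb hbc ih =>
    obtain ⟨hbc, hbT, hcT⟩ := hbc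
    by_cases hbA : b ∈ A
    · have := ih.1 hbA
      refine ⟨fun hc => this.trans (Lk.step hbc ⟨hbT, hbA⟩ ⟨hcT, hc⟩), fun hc => ⟨b, ⟨hbT, hbA⟩, hb b hbT hbA c hcT hc hbc, this⟩⟩
    · obtain ⟨e, he, heb, hxe⟩ := ih.2 hbA
      refine ⟨fun hc => ?_, fun _ => ⟨e, he, heb, hxe⟩⟩
      exact hxe.trans (hl e he.1 he.2 heb c hcT hc (hb c hcT hc b hbT hbA hbc.symm))

theorem Dn_inter {W A : Set V} (h : A ⊆ W) (z : V) : Dn G W z ∩ A = Dn G A z := by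
  ext v; simp only [Dn, Set.mem_inter_iff, Set.mem_ofPred_eq]; grind

/-- transfer of a link of non-neighbours -/
theorem path_transfer {W A bd : Set V} (hAW : A ⊆ W) {v a b a' b' : V} (h : Lk G (Dn G W v) a b) (ha : a ∈ Dn G W v)
    (hb : ∀ a ∈ A, ∀ b ∈ W, b ∉ A → G.Adj a b → a ∈ bd)
    (hl : ∀ a ∈ Dn G A v, a ∈ bd → ∀ b ∈ Dn G A v, b ∈ bd → Lk G (Dn G A v) a b)
    (ha' : a' ∈ Dn G A v) (hb' : b' ∈ Dn G A v)
    (h1 : a' = a ∨ (a' ∈ bd ∧ (a ∈ A → a ∈ bd))) (h2 : b' = b ∨ (b' ∈ bd ∧ (b ∈ A → b ∈ bd))) :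
    Lk G (Dn G A v) a' b' := by
  have hbD : b ∈ Dn G W v := h.mem ha
  have key : ∀ x y, x ∈ A → x ∈ Dn G W v → Lk G (Dn G W v) x y →
    (y ∈ A → Lk G (Dn G A v) x y) ∧ (y ∉ A → ∃ e ∈ Dn G A v, e ∈ bd ∧ Lk G (Dn G A v) x e) := by
    intro x y hx hxD hxy
    have := hxy.descend (A := A) (bd := bd) hx hxD (fun a ha haA b hb' hbA hab => hb a haA b hb'.1 hbA hab)
      (by
        intro a ha haA hab b hb hbA hbb
        rw [Dn_inter hAW]
        exact hl a ⟨haA, ha.2⟩ hab b ⟨hbA, hb.2⟩ hbb)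
    rwa [Dn_inter hAW] at this
  have toA : ∀ x, x ∈ A → x ∈ Dn G W v → x ∈ Dn G A v := fun x hx hxD => ⟨hx, hxD.2⟩
  by_cases hbb : b' ∈ bd
  · by_cases haa : a' ∈ bd
    · exact hl _ ha' haa _ hb' hbb
    · have haa' : a' = a := h1.resolve_right (fun e => haa e.1)
      subst haa'
      by_cases hbA : b ∈ A
      · have := (key a' b ha'.1 ha h).1 hbA
        rcases h2 with rfl | h2
        · exact this
        · exact this.trans (hl _ (toA _ hbA hbD) (h2.2 hbA) _ hb' hbb)
      · obtain ⟨e, he, heb, hae⟩ := (key a' b ha'.1 ha h).2 hbA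
        exact hae.trans (hl _ he heb _ hb' hbb)
  · have hbb' : b' = b := h2.resolve_right (fun e => hbb e.1)
    subst hbb'
    rcases h1 with rfl | h1
    · exact (key _ _ ha'.1 ha h).1 hb'.1
    · by_cases haA : a ∈ A
      · exact (hl _ ha' h1.1 _ (toA _ haA ha) (h1.2 haA)).trans ((key _ _ haA ha h).1 hb'.1)
      · obtain ⟨e, he, heb, hbe⟩ := (key b' a hb'.1 hbD h.symm).2 haA
        exact ((hl _ ha' h1.1 _ he heb).trans hbe.symm)

section
variable {W C : Set V} {u x1 x2 : V} {P : List V}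

theorem Spl.hole (h : Spl G W u x1 x2 P C) : HL G (u :: x1 :: P ++ [x2]) :=
  HB h.u1 h.u2 h.n12 h.ip h.Pu h.hd h.lt
    (fun p hp e => (h.cl1 p hp x1 h.x1W h.u1 Nr.refl e).1)
    (fun p hp e => (h.cl2 p hp x2 h.x2W h.u2 Nr.refl e).1)

theorem Spl.k1 (h : Spl G W u x1 x2 P C) : x1 ∈ Kk G W u x1 x2 := ⟨h.x1W, h.u1, Or.inl Nr.refl⟩
theorem Spl.k2 (h : Spl G W u x1 x2 P C) : x2 ∈ Kk G W u x1 x2 := ⟨h.x2W, h.u2, Or.inr Nr.refl⟩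

theorem Spl.PA (h : Spl G W u x1 x2 P C) : ∀ p ∈ P, p ∈ SA G W u x1 x2 C := fun p hp =>
  ⟨h.PW p hp, h.PC p hp, fun e => (h.Pu p hp).2 e.1.2.1⟩

theorem Spl.uA (h : Spl G W u x1 x2 P C) : u ∈ SA G W u x1 x2 C :=
  ⟨h.uW, h.uC, fun e => G.loopless.irrefl _ e.1.2.1⟩

theorem Spl.x1A (h : Spl G W u x1 x2 P C) : x1 ∈ SA G W u x1 x2 C := by
  refine ⟨h.x1W, h.KC _ h.k1, fun e => ?_⟩
  obtain ⟨p, hp, hpx⟩ := h.hd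
  have hp := List.mem_of_head? hp
  rcases e.2 p (h.PW p hp) (h.PC p hp) hpx.symm with e | e
  · exact (h.Pu p hp).1 e.symm
  · exact (h.Pu p hp).2 e

theorem Spl.x2A (h : Spl G W u x1 x2 P C) : x2 ∈ SA G W u x1 x2 C := by
  rw [SA_comm]; exact h.symm.x1A

theorem Spl.SAW : SA G W u x1 x2 C ⊆ W := fun _ h => h.1
theorem Spl.SB0W (h : Spl G W u x1 x2 P C) : SB0 G W u x1 x2 C ⊆ W := by
  rintro v (hv | rfl | rfl | rfl | hv)
  · exact h.CW v hv
  · exact h.uW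
  · exact h.x1W
  · exact h.x2W
  · exact hv.1.1
theorem Spl.SBW (h : Spl G W u x1 x2 P C) : SB G W u x1 x2 P C ⊆ W := by
  rintro v (hv | hv)
  · exact h.SB0W hv
  · exact h.PW v hv

/-- two vertices of the same class -/
theorem Kk_nr (hG : InC G) (h : Spl G W u x1 x2 P C) {k w : V} (hk : k ∈ Kk G W u x1 x2) (uw : G.Adj u w) (hw : w ∈ W)
    (hkw : G.Adj k w) : w ∈ Kk G W u x1 x2 := by
  refine ⟨hw, uw, ?_⟩
  rcases hk.2.2 with e | e
  · exact Or.inl ((Nr.symm (Or.inr hkw)).trans hG uw hk.2.1 h.u1 e)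
  · exact Or.inr ((Nr.symm (Or.inr hkw)).trans hG uw hk.2.1 h.u2 e)

theorem Spl.bdA_spec (hG : InC G) (h : Spl G W u x1 x2 P C) : ∀ a ∈ SA G W u x1 x2 C, ∀ b ∈ W, b ∉ SA G W u x1 x2 C → G.Adj a b →
    a ∈ bdA G W u x1 x2 C := by
  intro a ha b hb hbA hab
  refine ⟨ha, ?_⟩
  by_cases hbC : b ∈ C
  · exact h.bd b hbC a ha.1 ha.2.1 hab.symm
  · have hbJ : b ∈ SJ G W u x1 x2 C := by
      by_contra hh; exact hbA ⟨hb, hbC, hh⟩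
    rcases hbJ.2 a ha.1 ha.2.1 hab.symm with e | e
    · exact Or.inl e.symm
    · exact Or.inr (Kk_nr hG h hbJ.1 e ha.1 hab.symm)

theorem Spl.CSB0 (h : Spl G W u x1 x2 P C) : ∀ c ∈ C, ∀ w ∈ W, G.Adj c w → w ∈ SB0 G W u x1 x2 C := by
  intro c hc w hw hcw
  by_cases hwC : w ∈ C
  · exact Or.inl hwC
  · rcases h.bd c hc w hw hwC hcw with e | e
    · exact Or.inr (Or.inl e)
    · exact Or.inr (Or.inr (Or.inr (Or.inr ⟨e, c, hc, hcw⟩)))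

theorem Spl.bdB_spec (h : Spl G W u x1 x2 P C) : ∀ a ∈ SB G W u x1 x2 P C, ∀ b ∈ W, b ∉ SB G W u x1 x2 P C → G.Adj a b →
    a ∈ bdB G W u x1 x2 P C := by
  intro a ha b hb hbB hab
  exact ⟨ha, fun hc => hbB (Or.inl (h.CSB0 a hc b hb hab))⟩

theorem Spl.Cnbr (h : Spl G W u x1 x2 P C) {c p : V} (hc : c ∈ C) (hp : p ∈ P) : ¬ G.Adj c p := by
  intro e
  rcases h.bd c hc p (h.PW p hp) (h.PC p hp) e with e | e
  · exact (h.Pu p hp).1 e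
  · exact (h.Pu p hp).2 e.2.1

end

end Part11

section Part12
variable {V : Type*} {G : SimpleGraph V}

theorem Nr.lk {S : Set V} {a b : V} (h : Nr G a b) (ha : a ∈ S) (hb : b ∈ S) : Lk G S a b := by
  rcases h with rfl | h
  · exact Lk.refl
  · exact Lk.step h ha hb

theorem Lk.hub {S : Set V} {a b c : V} (h1 : Lk G S a c) (h2 : Lk G S b c) : Lk G S a b := h1.trans h2.symm

section
variable {W C : Set V} {u x1 x2 : V} {P : List V}

theorem Spl.lkP1 (h : Spl G W u x1 x2 P C) {S : Set V} (hS : ∀ p ∈ P, p ∈ S) (h1 : x1 ∈ S) {p : V} (hp : p ∈ P) :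
    Lk G S p x1 := by
  obtain ⟨d, hd, hdx⟩ := h.hd
  have hd := List.mem_of_head? hd
  exact (h.ip.lk hS hp hd).trans (Lk.step hdx (hS d hd) h1)

theorem Spl.lkP2 (h : Spl G W u x1 x2 P C) {S : Set V} (hS : ∀ p ∈ P, p ∈ S) (h1 : x2 ∈ S) {p : V} (hp : p ∈ P) :
    Lk G S p x2 := h.symm.lkP1 (by simpa using hS) h1 (by simpa using hp)

theorem Spl.lk12 (h : Spl G W u x1 x2 P C) {S : Set V} (hS : ∀ p ∈ P, p ∈ S) (h1 : x1 ∈ S) (h2 : x2 ∈ S) :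
    Lk G S x1 x2 := by
  obtain ⟨d, hd, hdx⟩ := h.hd
  have hd := List.mem_of_head? hd
  exact (h.lkP1 hS h1 hd).symm.trans (h.lkP2 hS h2 hd)

/-- classes: `z` not in the class of `x`, `k` in the class of `x`. -/
theorem nadj_class (hG : InC G) {u z k x : V} (uz : G.Adj u z) (uk : G.Adj u k) (ux : G.Adj u x)
    (hk : Nr G k x) (hz : ¬ Nr G z x) : k ≠ z ∧ ¬ G.Adj z k := by
  refine ⟨?_, ?_⟩
  · rintro rfl; exact hz hk
  · intro e; exact hz (Nr.trans hG uz uk ux (Or.inr e) hk)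

theorem Spl.keyA_aux (hG : InC G) (h : Spl G W u x1 x2 P C) {z : V} (uz : G.Adj u z) (hz : Nr G z x1) :
    ∀ a ∈ Dn G (SA G W u x1 x2 C) z, a ∈ bdA G W u x1 x2 C → ∀ b ∈ Dn G (SA G W u x1 x2 C) z, b ∈ bdA G W u x1 x2 C →
      Lk G (Dn G (SA G W u x1 x2 C) z) a b := by
  have hx2 : x2 ∈ Dn G (SA G W u x1 x2 C) z := ⟨h.x2A, nadj_class hG uz h.u2 h.u2 Nr.refl
    (fun e => h.n12 (hz.symm.trans hG h.u1 uz h.u2 e))⟩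
  have : ∀ a ∈ Dn G (SA G W u x1 x2 C) z, a ∈ bdA G W u x1 x2 C → Lk G (Dn G (SA G W u x1 x2 C) z) a x2 := by
    rintro a ha ⟨-, rfl | hak⟩
    · exact absurd uz.symm ha.2.2
    · rcases hak.2.2 with e | e
      · rcases hz.trans hG uz h.u1 hak.2.1 e.symm with e | e
        · exact absurd e.symm ha.2.1
        · exact absurd e ha.2.2
      · exact e.lk ha hx2
  intro a ha ha' b hb hb'
  exact (this a ha ha').hub (this b hb hb')

theorem Spl.keyA (hG : InC G) (h : Spl G W u x1 x2 P C) (z : V) (hzA : z ∈ SA G W u x1 x2 C) :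
    ∀ a ∈ Dn G (SA G W u x1 x2 C) z, a ∈ bdA G W u x1 x2 C → ∀ b ∈ Dn G (SA G W u x1 x2 C) z, b ∈ bdA G W u x1 x2 C →
      Lk G (Dn G (SA G W u x1 x2 C) z) a b := by
  by_cases hzu : z = u
  · subst hzu
    rintro a ha ⟨-, rfl | e⟩
    · exact absurd rfl ha.2.1
    · exact absurd e.2.1 ha.2.2
  by_cases uz : G.Adj u z
  · by_cases hz1 : Nr G z x1
    · exact h.keyA_aux hG uz hz1
    by_cases hz2 : Nr G z x2
    · rw [SA_comm, bdA_comm]; exact h.symm.keyA_aux hG uz hz2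
    have hx1 : x1 ∈ Dn G (SA G W u x1 x2 C) z := ⟨h.x1A, nadj_class hG uz h.u1 h.u1 Nr.refl hz1⟩
    have hx2 : x2 ∈ Dn G (SA G W u x1 x2 C) z := ⟨h.x2A, nadj_class hG uz h.u2 h.u2 Nr.refl hz2⟩
    have hP : ∀ p ∈ P, p ∈ Dn G (SA G W u x1 x2 C) z := fun p hp =>
      ⟨h.PA p hp, fun e => (h.Pu p hp).2 (e ▸ uz), h.pl z hzA.1 uz hz1 hz2 p hp⟩
    have : ∀ a ∈ Dn G (SA G W u x1 x2 C) z, a ∈ bdA G W u x1 x2 C → Lk G (Dn G (SA G W u x1 x2 C) z) a x2 := by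
      rintro a ha ⟨-, rfl | hak⟩
      · exact absurd uz.symm ha.2.2
      · rcases hak.2.2 with e | e
        · exact (e.lk ha hx1).trans (h.lk12 hP hx1 hx2)
        · exact e.lk ha hx2
    intro a ha ha' b hb hb'
    exact (this a ha ha').hub (this b hb hb')
  · have hu : u ∈ Dn G (SA G W u x1 x2 C) z := ⟨h.uA, fun e => hzu e.symm, fun e => uz e.symm⟩
    have : ∀ a ∈ Dn G (SA G W u x1 x2 C) z, a ∈ bdA G W u x1 x2 C → Lk G (Dn G (SA G W u x1 x2 C) z) a u := by
      rintro a ha ⟨-, rfl | hak⟩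
      · exact Lk.refl
      · exact Lk.step hak.2.1.symm ha hu
    intro a ha ha' b hb hb'
    exact (this a ha ha').hub (this b hb hb')

end
/-- removing a closed neighbourhood from a hole -/
theorem HL.lk_del {l : List V} (h : HL G l) {z a b : V} (hz : z ∈ l) (ha : a ∈ l) (hb : b ∈ l)
    {S : Set V} (hS : ∀ x ∈ l, x ≠ z → ¬ G.Adj z x → x ∈ S) (ha' : a ≠ z ∧ ¬ G.Adj z a) (hb' : b ≠ z ∧ ¬ G.Adj z b) :
    Lk G S a b := by
  obtain ⟨l', h', hp⟩ := h.rotTo hz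
  have hl' := h'.length
  obtain e | ⟨r, e⟩ | ⟨s, M, t, rfl⟩ := snoc_cases l'
  · subst e; simp at hl'
  · subst e; simp at hl'
  have hM : ∀ x ∈ l, x ≠ z → ¬ G.Adj z x → x ∈ M := by
    intro x hx hxz hzx
    have := hp.mem_iff.2 hx
    have h1 : G.Adj z s := (h'.2.2 s (by simp)).2.2 (by simp)
    have h2 : G.Adj z t := (h'.2.2 t (by simp)).2.2 (by simp)
    simp at this
    grind
  have ipM : IP G M := (h'.1.tail : IP G (M ++ [t])).left
  refine ipM.lk (fun x hx => ?_) (hM a ha ha'.1 ha'.2) (hM b hb hb'.1 hb'.2)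
  have hx' : x ∈ s :: M ++ [t] := by simp [hx]
  have hnd := h'.1.nodup
  refine hS x (hp.mem_iff.1 (List.mem_cons_of_mem _ hx')) (h'.2.2 x hx').1.symm ?_
  intro e
  have := (h'.2.2 x hx').2.1 e
  simp at this hnd
  grind

theorem HL.lk_clq {l : List V} (h : HL G l) {Z S : Set V} (hZ : Clq G Z) (hS : ∀ x ∈ l, x ∉ Z → x ∈ S)
    {a b : V} (ha : a ∈ l) (hb : b ∈ l) (haZ : a ∉ Z) (hbZ : b ∉ Z) : Lk G S a b := by
  by_cases hz : ∃ z ∈ l, z ∈ Z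
  · obtain ⟨z, hz, hzZ⟩ := hz
    obtain ⟨l', h', hp⟩ := h.rotTo hz
    have hl' := h'.length
    obtain e | ⟨r, e⟩ | ⟨s, M, t, rfl⟩ := snoc_cases l'
    · subst e; simp at hl'
    · subst e; simp at hl'
    have hnd := h'.1.nodup
    have hmem : ∀ x ∈ l, x ∉ Z → x ∈ s :: M ++ [t] := by
      intro x hx hxZ
      have := hp.mem_iff.2 hx
      rcases List.mem_cons.1 this with rfl | e
      · exact absurd hzZ hxZ
      · exact e
    have hMZ : ∀ x ∈ M, x ∉ Z := by
      intro x hx hxZ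
      have hx' : x ∈ s :: M ++ [t] := by simp [hx]
      rcases hZ z hzZ x hxZ with e | e
      · exact (h'.2.2 x hx').1 e
      · have := (h'.2.2 x hx').2.1 e
        simp at this hnd
        grind
    have hst : ¬ (s ∈ Z ∧ t ∈ Z) := by
      rintro ⟨hs, ht⟩
      rcases hZ s hs t ht with e | e
      · simp at hnd; grind
      · have := (h'.1.2 t (by simp)).2.1 e
        rcases M with _ | ⟨m, M⟩
        · simp at hl'
        · simp at this hnd; grind
    have hS' : ∀ x ∈ s :: M ++ [t], x ∉ Z → x ∈ S := fun x hx => hS x (hp.mem_iff.1 (List.mem_cons_of_mem _ hx))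
    have ha' := hmem a ha haZ
    have hb' := hmem b hb hbZ
    by_cases hs : s ∈ Z
    · have ip : IP G (M ++ [t]) := h'.1.tail
      refine ip.lk (fun x hx => hS' x (by simp at hx ⊢; grind) ?_) (by simp at ha' ⊢; grind) (by simp at hb' ⊢; grind)
      simp at hx; grind
    by_cases ht : t ∈ Z
    · have ip : IP G (s :: M) := h'.1.left
      refine ip.lk (fun x hx => hS' x (by simp at hx ⊢; grind) ?_) (by simp at ha' ⊢; grind) (by simp at hb' ⊢; grind)
      simp at hx; grind
    refine h'.1.lk (fun x hx => hS' x hx ?_) ha' hb'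
    simp at hx; grind
  · push Not at hz
    obtain ⟨l', h', hp⟩ := h.rotTo ha
    rcases l' with _ | ⟨s, M⟩
    · have := h'.length; simp at this
    have hS' : ∀ x ∈ a :: s :: M, x ∈ S := fun x hx => hS x (hp.mem_iff.1 hx) (hz x (hp.mem_iff.1 hx))
    rcases List.mem_cons.1 (hp.mem_iff.2 hb) with rfl | e
    · exact Lk.refl
    · have hst : G.Adj a s := (h'.2.2 s (by simp)).2.2 (by simp)
      exact (Lk.step hst (hS' _ (by simp)) (hS' _ (by simp))).trans
        (h'.1.lk (fun x hx => hS' x (List.mem_cons_of_mem _ hx)) (by simp) e)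

section
variable {W C : Set V} {u x1 x2 : V} {P : List V}

theorem Spl.uB (h : Spl G W u x1 x2 P C) : u ∈ SB G W u x1 x2 P C := Or.inl (Or.inr (Or.inl rfl))
theorem Spl.x1B (h : Spl G W u x1 x2 P C) : x1 ∈ SB G W u x1 x2 P C := Or.inl (Or.inr (Or.inr (Or.inl rfl)))
theorem Spl.x2B (h : Spl G W u x1 x2 P C) : x2 ∈ SB G W u x1 x2 P C := Or.inl (Or.inr (Or.inr (Or.inr (Or.inl rfl))))
theorem Spl.PB (h : Spl G W u x1 x2 P C) : ∀ p ∈ P, p ∈ SB G W u x1 x2 P C := fun _ hp => Or.inr hp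
theorem Spl.CB (h : Spl G W u x1 x2 P C) : ∀ c ∈ C, c ∈ SB G W u x1 x2 P C := fun _ hp => Or.inl (Or.inl hp)

theorem Spl.bdB_cases (h : Spl G W u x1 x2 P C) {a : V} (ha : a ∈ bdB G W u x1 x2 P C) :
    a = u ∨ a ∈ P ∨ (G.Adj u a ∧ a ∈ Kk G W u x1 x2) := by
  obtain ⟨(hc | rfl | rfl | rfl | hv) | hv, hC⟩ := ha
  · exact absurd hc hC
  · exact Or.inl rfl
  · exact Or.inr (Or.inr ⟨h.u1, h.k1⟩)
  · exact Or.inr (Or.inr ⟨h.u2, h.k2⟩)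
  · exact Or.inr (Or.inr ⟨hv.1.2.1, hv.1⟩)
  · exact Or.inr (Or.inl hv)

theorem Spl.mem_hole (h : Spl G W u x1 x2 P C) {x : V} : x ∈ u :: x1 :: P ++ [x2] ↔ x = u ∨ x = x1 ∨ x = x2 ∨ x ∈ P := by
  simp; grind

theorem Spl.holeB (h : Spl G W u x1 x2 P C) : ∀ x ∈ u :: x1 :: P ++ [x2], x ∈ SB G W u x1 x2 P C := by
  intro x hx
  rcases h.mem_hole.1 hx with rfl | rfl | rfl | hx
  · exact h.uB
  · exact h.x1B
  · exact h.x2B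
  · exact h.PB x hx

/-- case `z` in class 1 -/
theorem Spl.keyB_aux (hG : InC G) (h : Spl G W u x1 x2 P C) {z : V} (hzW : z ∈ W) (uz : G.Adj u z) (hz : Nr G z x1) :
    ∀ a ∈ Dn G (SB G W u x1 x2 P C) z, a ∈ bdB G W u x1 x2 P C → ∀ b ∈ Dn G (SB G W u x1 x2 P C) z, b ∈ bdB G W u x1 x2 P C →
      Lk G (Dn G (SB G W u x1 x2 P C) z) a b := by
  have hx2 : x2 ∈ Dn G (SB G W u x1 x2 P C) z := ⟨h.x2B, nadj_class hG uz h.u2 h.u2 Nr.refl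
    (fun e => h.n12 (hz.symm.trans hG h.u1 uz h.u2 e))⟩
  have : ∀ a ∈ Dn G (SB G W u x1 x2 P C) z, a ∈ bdB G W u x1 x2 P C → Lk G (Dn G (SB G W u x1 x2 P C) z) a x2 := by
    rintro a ha ha'
    rcases h.bdB_cases ha' with rfl | hp | ⟨-, hak⟩
    · exact absurd uz.symm ha.2.2
    · by_cases hzx : z = x1
      · subst hzx
        refine h.hole.lk_del (z := z) (by simp) (h.mem_hole.2 (by simp [hp])) (by simp) (fun x hx hxz hzx => ⟨h.holeB x hx, hxz, hzx⟩) ha.2 hx2.2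
      · refine h.lkP2 (S := Dn G (SB G W u x1 x2 P C) z) (fun p hp => ⟨h.PB p hp, ?_, ?_⟩) hx2 hp
        · rintro rfl; exact (h.Pu _ hp).2 uz
        · intro e; exact hzx (h.cl1 p hp z hzW uz hz e.symm).2
    · rcases hak.2.2 with e | e
      · rcases hz.trans hG uz h.u1 hak.2.1 e.symm with e | e
        · exact absurd e.symm ha.2.1
        · exact absurd e ha.2.2
      · exact e.lk ha hx2
  intro a ha ha' b hb hb'
  exact (this a ha ha').hub (this b hb hb')

set_option maxHeartbeats 1000000 in
theorem Spl.keyB (hG : InC G) (h : Spl G W u x1 x2 P C) (z : V) (hzB : z ∈ SB G W u x1 x2 P C) :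
    ∀ a ∈ Dn G (SB G W u x1 x2 P C) z, a ∈ bdB G W u x1 x2 P C → ∀ b ∈ Dn G (SB G W u x1 x2 P C) z, b ∈ bdB G W u x1 x2 P C →
      Lk G (Dn G (SB G W u x1 x2 P C) z) a b := by
  by_cases hzC : z ∈ C
  · have hzP : ∀ p ∈ P, p ∈ Dn G (SB G W u x1 x2 P C) z := fun p hp =>
      ⟨h.PB p hp, fun e => h.PC p hp (e ▸ hzC), h.Cnbr hzC hp⟩
    by_cases uz : G.Adj u z
    · have hz : ∀ x, x ∈ Kk G W u x1 x2 → x ≠ z ∧ ¬ G.Adj z x := by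
        intro x hx
        refine ⟨fun e => h.KC x hx (e ▸ hzC), fun e => ?_⟩
        exact h.KC z (Kk_nr hG h hx uz (h.CW z hzC) e.symm) hzC
      have hx1 : x1 ∈ Dn G (SB G W u x1 x2 P C) z := ⟨h.x1B, hz _ h.k1⟩
      have hx2 : x2 ∈ Dn G (SB G W u x1 x2 P C) z := ⟨h.x2B, hz _ h.k2⟩
      have : ∀ a ∈ Dn G (SB G W u x1 x2 P C) z, a ∈ bdB G W u x1 x2 P C → Lk G (Dn G (SB G W u x1 x2 P C) z) a x2 := by
        rintro a ha ha'
        rcases h.bdB_cases ha' with rfl | hp | ⟨-, hak⟩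
        · exact absurd uz.symm ha.2.2
        · exact h.lkP2 hzP hx2 hp
        · rcases hak.2.2 with e | e
          · exact (e.lk ha hx1).trans (h.lk12 hzP hx1 hx2)
          · exact e.lk ha hx2
      intro a ha ha' b hb hb'
      exact (this a ha ha').hub (this b hb hb')
    · have hu : u ∈ Dn G (SB G W u x1 x2 P C) z := ⟨h.uB, fun e => h.uC (e ▸ hzC), fun e => uz e.symm⟩
      have hP : ∀ p ∈ P, Lk G (Dn G (SB G W u x1 x2 P C) z) p u := by
        intro p hp
        by_cases hx1 : G.Adj z x1
        · have hx2 : x2 ∈ Dn G (SB G W u x1 x2 P C) z := by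
            refine ⟨h.x2B, fun e => h.KC x2 h.k2 (e ▸ hzC), fun e => ?_⟩
            exact h.n12 (Or.inl (att_unique hG hu.2.1.symm uz h.u1 h.u2 hx1 e))
          exact (h.lkP2 hzP hx2 hp).trans (Lk.step h.u2.symm hx2 hu)
        · have hx1 : x1 ∈ Dn G (SB G W u x1 x2 P C) z := ⟨h.x1B, fun e => h.KC x1 h.k1 (e ▸ hzC), hx1⟩
          exact (h.lkP1 hzP hx1 hp).trans (Lk.step h.u1.symm hx1 hu)
      have : ∀ a ∈ Dn G (SB G W u x1 x2 P C) z, a ∈ bdB G W u x1 x2 P C → Lk G (Dn G (SB G W u x1 x2 P C) z) a u := by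
        rintro a ha ha'
        rcases h.bdB_cases ha' with rfl | hp | ⟨hk, -⟩
        · exact Lk.refl
        · exact hP a hp
        · exact Lk.step hk.symm ha hu
      intro a ha ha' b hb hb'
      exact (this a ha ha').hub (this b hb hb')
  · have hzb : z ∈ bdB G W u x1 x2 P C := ⟨hzB, hzC⟩
    rcases h.bdB_cases hzb with hzu | hzp | ⟨uz, hk⟩
    · subst hzu
      rintro a ha ha' b hb hb'
      have hh : ∀ a ∈ Dn G (SB G W z x1 x2 P C) z, a ∈ bdB G W z x1 x2 P C → a ∈ P := by
        intro a ha ha'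
        rcases h.bdB_cases ha' with e | hp | ⟨hk, -⟩
        · exact absurd e ha.2.1
        · exact hp
        · exact absurd hk ha.2.2
      exact h.ip.lk (S := Dn G (SB G W z x1 x2 P C) z) (fun p hp => ⟨h.PB p hp, h.Pu p hp⟩) (hh a ha ha') (hh b hb hb')
    · have hu : u ∈ Dn G (SB G W u x1 x2 P C) z := ⟨h.uB, (h.Pu z hzp).1.symm, fun e => (h.Pu z hzp).2 e.symm⟩
      have : ∀ a ∈ Dn G (SB G W u x1 x2 P C) z, a ∈ bdB G W u x1 x2 P C → Lk G (Dn G (SB G W u x1 x2 P C) z) a u := by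
        rintro a ha ha'
        rcases h.bdB_cases ha' with rfl | hp | ⟨hk, -⟩
        · exact Lk.refl
        · exact h.hole.lk_del (z := z) (h.mem_hole.2 (by simp [hzp])) (h.mem_hole.2 (by simp [hp])) (by simp) (fun x hx hxz hzx => ⟨h.holeB x hx, hxz, hzx⟩) ha.2 hu.2
        · exact Lk.step hk.symm ha hu
      intro a ha ha' b hb hb'
      exact (this a ha ha').hub (this b hb hb')
    · rcases hk.2.2 with e | e
      · exact h.keyB_aux hG hk.1 uz e
      · rw [SB_comm, bdB_comm]; exact h.symm.keyB_aux hG hk.1 uz e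

end

end Part12

section Part13
variable {V : Type*} {G : SimpleGraph V}

theorem Atom.descend {W A bd : Set V} (hW : Atom G W) (hAW : A ⊆ W)
    (hb : ∀ a ∈ A, ∀ b ∈ W, b ∉ A → G.Adj a b → a ∈ bd) {Z : Set V} (hZA : Z ⊆ A) (hZ : Clq G Z)
    (hl : ∀ a ∈ A \ Z, a ∈ bd → ∀ b ∈ A \ Z, b ∈ bd → Lk G (A \ Z) a b) :
    ∀ x ∈ A \ Z, ∀ y ∈ A \ Z, Lk G (A \ Z) x y := by
  have e : (W \ Z) ∩ A = A \ Z := by ext v; simp; grind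
  intro x hx y hy
  have := hW Z (hZA.trans hAW) hZ x ⟨hAW hx.1, hx.2⟩ y ⟨hAW hy.1, hy.2⟩
  have := (this.descend (A := A) (bd := bd) hx.1 ⟨hAW hx.1, hx.2⟩
    (fun a _ haA b hb' hbA hab => hb a haA b hb'.1 hbA hab) (by
      intro a ha haA hab b hb hbA hbb
      rw [e]
      exact hl a ⟨haA, ha.2⟩ hab b ⟨hbA, hb.2⟩ hbb)).1 hy.1
  rwa [e] at this

section
variable {W C : Set V} {u x1 x2 : V} {P : List V}

theorem Spl.k1_lk (hG : InC G) (h : Spl G W u x1 x2 P C) {Z : Set V} (hZ : ∀ z ∈ Z, z = u ∨ (G.Adj u z ∧ Nr G z x1))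
    {k : V} (hk : k ∈ SA G W u x1 x2 C) (uk : G.Adj u k) (hk1 : Nr G k x1) (hkZ : k ∉ Z) :
    Lk G (SA G W u x1 x2 C \ Z) k x2 := by
  set A := SA G W u x1 x2 C with hA
  have hkK : k ∈ Kk G W u x1 x2 := ⟨hk.1, uk, Or.inl hk1⟩
  obtain ⟨w, hwW, hwC, hkw, hnu⟩ : ∃ w ∈ W, w ∉ C ∧ G.Adj k w ∧ ¬ Nr G u w := by
    by_contra hno
    push Not at hno
    exact hk.2.2 ⟨hkK, fun w hw hwC hkw => hno w hw hwC hkw⟩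
  simp only [Nr, not_or] at hnu
  have hwA : w ∈ A := ⟨hwW, hwC, fun e => hnu.2 e.1.2.1⟩
  let Z' : Set V := {z | z ∈ W ∧ (z = u ∨ (G.Adj u z ∧ Nr G z x1))}
  have hZ' : Clq G Z' := by
    rintro a ⟨-, rfl | ha⟩ b ⟨-, rfl | hb⟩
    · exact Nr.refl
    · exact Or.inr hb.1
    · exact Or.inr ha.1.symm
    · exact ha.2.trans hG ha.1 h.u1 hb.1 hb.2.symm
  have hx2Z : x2 ∉ Z' := by
    rintro ⟨-, e | e⟩
    · exact h.u2.ne e.symm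
    · exact h.n12 e.2.symm
  have hwZ : w ∉ Z' := by
    rintro ⟨-, e | e⟩
    · exact hnu.1 e.symm
    · exact hnu.2 e.1
  have e : (W \ Z') ∩ A = A \ Z' := by ext v; simp [hA, SA]; grind
  have hl := h.atom Z' (fun z hz => hz.1) hZ' w ⟨hwW, hwZ⟩ x2 ⟨h.x2W, hx2Z⟩
  have := (hl.descend (A := A) (bd := bdA G W u x1 x2 C) hwA ⟨hwW, hwZ⟩
    (fun a _ haA b hb' hbA hab => h.bdA_spec hG a haA b hb'.1 hbA hab) (by
      have : ∀ a ∈ W \ Z', a ∈ A → a ∈ bdA G W u x1 x2 C → Lk G (W \ Z' ∩ A) a x2 := by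
        rintro a ⟨haW, haZ⟩ haA ⟨-, rfl | ha⟩
        · exact absurd ⟨haW, Or.inl rfl⟩ haZ
        · rcases ha.2.2 with e | e
          · exact absurd ⟨haW, Or.inr ⟨ha.2.1, e⟩⟩ haZ
          · exact e.lk ⟨⟨haW, haZ⟩, haA⟩ ⟨⟨h.x2W, hx2Z⟩, h.x2A⟩
      intro a ha haA hab b hb hbA hbb
      exact (this a ha haA hab).hub (this b hb hbA hbb))).1 h.x2A
  rw [e] at this
  have hsub : A \ Z' ⊆ A \ Z := by
    rintro v ⟨hv, hv'⟩
    exact ⟨hv, fun hz => hv' ⟨hv.1, hZ v hz⟩⟩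
  exact (Lk.step (S := A \ Z) hkw ⟨hk, hkZ⟩ (hsub ⟨hwA, hwZ⟩)).trans (this.mono hsub)

theorem Spl.atomA_aux (hG : InC G) (h : Spl G W u x1 x2 P C) {Z : Set V} (hZ : ∀ z ∈ Z, z = u ∨ (G.Adj u z ∧ Nr G z x1))
    (huZ : u ∈ Z) : ∀ a ∈ SA G W u x1 x2 C \ Z, a ∈ bdA G W u x1 x2 C → ∀ b ∈ SA G W u x1 x2 C \ Z,
      b ∈ bdA G W u x1 x2 C → Lk G (SA G W u x1 x2 C \ Z) a b := by
  have hx2Z : x2 ∉ Z := by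
    intro e
    rcases hZ _ e with e | e
    · exact h.u2.ne e.symm
    · exact h.n12 e.2.symm
  have : ∀ a ∈ SA G W u x1 x2 C \ Z, a ∈ bdA G W u x1 x2 C → Lk G (SA G W u x1 x2 C \ Z) a x2 := by
    rintro a ha ⟨-, rfl | hk⟩
    · exact absurd huZ ha.2
    · rcases hk.2.2 with e | e
      · exact h.k1_lk hG hZ ha.1 hk.2.1 e ha.2
      · exact e.lk ha ⟨h.x2A, hx2Z⟩
  intro a ha ha' b hb hb'
  exact (this a ha ha').hub (this b hb hb')

theorem Spl.atomA (hG : InC G) (h : Spl G W u x1 x2 P C) : Atom G (SA G W u x1 x2 C) := by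
  intro Z hZA hZ
  refine h.atom.descend Spl.SAW (h.bdA_spec hG) hZA hZ ?_
  by_cases huZ : u ∈ Z
  · have hcl : ∀ x, x ∈ Z → G.Adj u x → ∀ x1, G.Adj u x1 → Nr G x x1 → ∀ z ∈ Z, z = u ∨ (G.Adj u z ∧ Nr G z x1) := by
      intro x hx ux x1 ux1 hxx z hz
      rcases hZ u huZ z hz with e | e
      · exact Or.inl e.symm
      · exact Or.inr ⟨e, (hZ z hz x hx).trans hG e ux ux1 hxx⟩
    by_cases h1 : ∃ z ∈ Z, G.Adj u z ∧ Nr G z x1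
    · obtain ⟨z, hz, uz, hz1⟩ := h1
      exact h.atomA_aux hG (hcl z hz uz x1 h.u1 hz1) huZ
    by_cases h2 : ∃ z ∈ Z, G.Adj u z ∧ Nr G z x2
    · obtain ⟨z, hz, uz, hz2⟩ := h2
      rw [SA_comm, bdA_comm]
      exact h.symm.atomA_aux hG (hcl z hz uz x2 h.u2 hz2) huZ
    push Not at h1 h2
    have hZu : ∀ z ∈ Z, z = u ∨ G.Adj u z := fun z hz => by
      rcases hZ u huZ z hz with e | e
      · exact Or.inl e.symm
      · exact Or.inr e
    have hx1 : x1 ∈ SA G W u x1 x2 C \ Z := ⟨h.x1A, fun e => h1 _ e h.u1 Nr.refl⟩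
    have hx2 : x2 ∈ SA G W u x1 x2 C \ Z := ⟨h.x2A, fun e => h2 _ e h.u2 Nr.refl⟩
    have hP : ∀ p ∈ P, p ∈ SA G W u x1 x2 C \ Z := fun p hp => ⟨h.PA p hp, fun e => by
      rcases hZu p e with e | e
      · exact (h.Pu p hp).1 e
      · exact (h.Pu p hp).2 e⟩
    have : ∀ a ∈ SA G W u x1 x2 C \ Z, a ∈ bdA G W u x1 x2 C → Lk G (SA G W u x1 x2 C \ Z) a x2 := by
      rintro a ha ⟨-, rfl | hk⟩
      · exact absurd huZ ha.2
      · rcases hk.2.2 with e | e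
        · exact (e.lk ha hx1).trans (h.lk12 hP hx1 hx2)
        · exact e.lk ha hx2
    intro a ha ha' b hb hb'
    exact (this a ha ha').hub (this b hb hb')
  · have : ∀ a ∈ SA G W u x1 x2 C \ Z, a ∈ bdA G W u x1 x2 C → Lk G (SA G W u x1 x2 C \ Z) a u := by
      rintro a ha ⟨-, rfl | hk⟩
      · exact Lk.refl
      · exact Lk.step hk.2.1.symm ha ⟨h.uA, huZ⟩
    intro a ha ha' b hb hb'
    exact (this a ha ha').hub (this b hb hb')

/-- linking a vertex of the first class to the hole -/
theorem Spl.atomB_aux (hG : InC G) (h : Spl G W u x1 x2 P C) {Z : Set V} (hZ : Clq G Z)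
    {k : V} (hk : k ∈ SB G W u x1 x2 P C) (hkb : k ∈ bdB G W u x1 x2 P C) (uk : G.Adj u k) (hk1 : Nr G k x1) (hkZ : k ∉ Z) :
    ∃ x ∈ u :: x1 :: P ++ [x2], x ∉ Z ∧ Lk G (SB G W u x1 x2 P C \ Z) k x := by
  by_cases huZ : u ∈ Z
  swap
  · exact ⟨u, by simp, huZ, Lk.step uk.symm ⟨hk, hkZ⟩ ⟨h.uB, huZ⟩⟩
  by_cases hxZ : x1 ∈ Z
  swap
  · exact ⟨x1, by simp, hxZ, hk1.lk ⟨hk, hkZ⟩ ⟨h.x1B, hxZ⟩⟩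
  have hZu : ∀ z ∈ Z, z = u ∨ (G.Adj u z ∧ Nr G z x1) := fun z hz => by
    rcases hZ u huZ z hz with e | e
    · exact Or.inl e.symm
    · exact Or.inr ⟨e, hZ _ hz _ hxZ⟩
  have hn2 : ∀ z, G.Adj u z → Nr G z x2 → z ∉ Z := by
    intro z uz hz hzZ
    rcases hZu z hzZ with e | e
    · exact uz.ne e.symm
    · exact h.n12 (e.2.symm.trans hG h.u1 uz h.u2 hz)
  refine ⟨x2, by simp, hn2 x2 h.u2 Nr.refl, ?_⟩
  have hx2 : x2 ∈ SB G W u x1 x2 P C \ Z := ⟨h.x2B, hn2 x2 h.u2 Nr.refl⟩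
  have hCZ : ∀ c ∈ C, c ∈ SB G W u x1 x2 P C \ Z := by
    refine fun c hc => ⟨h.CB c hc, fun hz => ?_⟩
    rcases hZu c hz with e | e
    · exact h.uC (e ▸ hc)
    · exact h.KC c ⟨h.CW c hc, e.1, Or.inl e.2⟩ hc
  obtain ⟨y, hyW, uy, hy2, c', hc', hcy⟩ := h.y2
  obtain ⟨(hc | e | e | e | hv) | hv, hC⟩ := hkb
  · exact absurd hc hC
  · exact absurd e uk.ne'
  · exact absurd hxZ (e ▸ hkZ)
  · exact absurd hk1.symm (e ▸ h.n12)
  · obtain ⟨c, hc, hck⟩ := hv.2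
    have hyB : y ∈ SB G W u x1 x2 P C \ Z :=
      ⟨Or.inl (Or.inr (Or.inr (Or.inr (Or.inr ⟨⟨hyW, uy, Or.inr hy2⟩, c', hc', hcy⟩)))), hn2 y uy hy2⟩
    exact (((Lk.step (S := SB G W u x1 x2 P C \ Z) hck.symm ⟨hk, hkZ⟩ (hCZ c hc)).trans ((h.Clk c hc c' hc').mono hCZ)).trans
      (Lk.step hcy (hCZ _ hc') hyB)).trans (hy2.lk hyB hx2)
  · exact absurd uk (h.Pu k hv).2

theorem Spl.atomB (hG : InC G) (h : Spl G W u x1 x2 P C) : Atom G (SB G W u x1 x2 P C) := by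
  intro Z hZA hZ
  refine h.atom.descend h.SBW h.bdB_spec hZA hZ ?_
  have : ∀ a ∈ SB G W u x1 x2 P C \ Z, a ∈ bdB G W u x1 x2 P C →
      ∃ x ∈ u :: x1 :: P ++ [x2], x ∉ Z ∧ Lk G (SB G W u x1 x2 P C \ Z) a x := by
    intro a ha hab
    rcases h.bdB_cases hab with e | hp | ⟨ua, hk⟩
    · exact ⟨a, h.mem_hole.2 (Or.inl e), ha.2, Lk.refl⟩
    · exact ⟨a, h.mem_hole.2 (by simp [hp]), ha.2, Lk.refl⟩
    · rcases hk.2.2 with e | e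
      · exact h.atomB_aux hG hZ ha.1 hab ua e ha.2
      · rw [SB_comm, bdB_comm] at *
        obtain ⟨x, hx, hx'⟩ := h.symm.atomB_aux hG hZ ha.1 hab ua e ha.2
        refine ⟨x, ?_, hx'⟩
        have := h.symm.mem_hole.1 hx
        rw [h.mem_hole]; simp at this; grind
  intro a ha ha' b hb hb'
  obtain ⟨x, hx, hxZ, hax⟩ := this a ha ha'
  obtain ⟨y, hy, hyZ, hby⟩ := this b hb hb'
  exact (hax.trans (h.hole.lk_clq (S := SB G W u x1 x2 P C \ Z) hZ (fun x hx hxZ => ⟨h.holeB x hx, hxZ⟩) hx hy hxZ hyZ)).trans hby.symm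

/-- `J ⊆ Y`. -/
theorem Spl.JB0 (hG : InC G) (h : Spl G W u x1 x2 P C) : ∀ k ∈ SJ G W u x1 x2 C, ∃ c ∈ C, G.Adj c k := by
  intro k hk
  by_contra hno
  push Not at hno
  let Z : Set V := {z | z ∈ W ∧ z ≠ k ∧ (z = u ∨ (G.Adj u z ∧ G.Adj k z))}
  have hZ : Clq G Z := by
    rintro a ⟨-, -, rfl | ha⟩ b ⟨-, -, rfl | hb⟩
    · exact Nr.refl
    · exact Or.inr hb.1
    · exact Or.inr ha.1.symm
    · exact Nr.trans hG ha.1 hk.1.2.1 hb.1 (Or.inr ha.2.symm) (Or.inr hb.2)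
  obtain ⟨p, hp, hpx⟩ := h.hd
  have hp := List.mem_of_head? hp
  have hl := h.atom Z (fun z hz => hz.1) hZ k ⟨hk.1.1, fun e => e.2.1 rfl⟩ p ⟨h.PW p hp, by
    rintro ⟨-, -, e | e⟩
    · exact (h.Pu p hp).1 e
    · exact (h.Pu p hp).2 e.1⟩
  obtain ⟨a, ha, b, hb, hab, rfl, hbk⟩ := hl.cross (p := fun v => v = k) rfl (by
    rintro rfl
    exact (h.Pu _ hp).2 hk.1.2.1)
  apply hb.2
  refine ⟨hb.1, hbk, ?_⟩
  rcases hk.2 b hb.1 (fun hc => hno b hc hab.symm) hab with e | e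
  · exact Or.inl e.symm
  · exact Or.inr ⟨e, hab⟩

theorem Spl.cover (hG : InC G) (h : Spl G W u x1 x2 P C) {v : V} (hv : v ∈ W) (hA : v ∉ SA G W u x1 x2 C) :
    v ∈ SB0 G W u x1 x2 C := by
  by_cases hC : v ∈ C
  · exact Or.inl hC
  · have hJ : v ∈ SJ G W u x1 x2 C := by by_contra hJ; exact hA ⟨hv, hC, hJ⟩
    exact Or.inr (Or.inr (Or.inr (Or.inr ⟨hJ.1, h.JB0 hG v hJ⟩)))

end

end Part13

section Part14
set_option linter.unusedVariables false
variable {V : Type*} {G : SimpleGraph V}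

def Cp (G : SimpleGraph V) (W : Set V) (v x y : V) : Prop :=
  v ∈ W ∧ x ∈ W ∧ y ∈ W ∧ G.Adj v x ∧ G.Adj v y ∧ ¬ Nr G x y ∧
  (∃ a b, a ∈ Dn G W v ∧ Att G W v x a ∧ Att G W v y b ∧ Lk G (Dn G W v) a b) ∧
  (∀ z ∈ W, G.Adj v z → ¬ Nr G z x → ¬ Nr G z y → Lk G (Dn G W z) x y)

def GoodR (G : SimpleGraph V) (X X0 bd : Set V) (v x a : V) : Prop :=
  ∃ x' ∈ X, x' ∈ X0 ∧ G.Adj v x' ∧ Nr G x' x ∧ ∃ a' ∈ Dn G X v, Att G X v x' a' ∧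
    (a' = a ∨ (a' ∈ bd ∧ (a ∈ X → a ∈ bd)))

theorem Cp_inherit (hG : InC G) {W X X0 bd : Set V} (hXW : X ⊆ W)
    (hb : ∀ a ∈ X, ∀ b ∈ W, b ∉ X → G.Adj a b → a ∈ bd)
    (hl : ∀ z ∈ X, ∀ a ∈ Dn G X z, a ∈ bd → ∀ b ∈ Dn G X z, b ∈ bd → Lk G (Dn G X z) a b)
    {v x y a b : V} (hv : v ∈ X) (h : Cp G W v x y) (ha : a ∈ Dn G W v) (hab : Lk G (Dn G W v) a b)
    (h1 : GoodR G X X0 bd v x a) (h2 : GoodR G X X0 bd v y b) :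
    ∃ x' ∈ X0, ∃ y' ∈ X0, Nr G x' x ∧ Nr G y' y ∧ Cp G X v x' y' := by
  obtain ⟨x', hx', hx0, vx', nx, a', ha', at1, ca⟩ := h1
  obtain ⟨y', hy', hy0, vy', ny, b', hb', at2, cb⟩ := h2
  obtain ⟨hvW, hxW, hyW, vx, vy, nxy, -, hii⟩ := h
  refine ⟨x', hx0, y', hy0, nx, ny, hv, hx', hy', vx', vy', ne_of_class hG vx vy vx' vy' nxy nx ny,
    ⟨a', b', ha', at1, at2, path_transfer hXW hab ha hb (hl v hv) ha' hb' ca cb⟩, ?_⟩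
  intro z hz vz hzx hzy
  have hzx' : ¬ Nr G z x := fun e => hzx (e.trans hG vz vx vx' nx.symm)
  have hzy' : ¬ Nr G z y := fun e => hzy (e.trans hG vz vy vy' ny.symm)
  have m : ∀ c, c ∈ W → ¬ Nr G z c → c ∈ Dn G W z := fun c hc hn =>
    ⟨hc, fun e => hn (Or.inl e.symm), fun e => hn (Or.inr e)⟩
  have := hii z (hXW hz) vz hzx' hzy'
  have h3 := ((nx.lk (m _ (hXW hx') hzx) (m _ hxW hzx')).trans this).trans (ny.symm.lk (m _ hyW hzy') (m _ (hXW hy') hzy))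
  exact path_transfer hXW h3 (m _ (hXW hx') hzx) hb (hl z hz) ⟨hx', (m _ (hXW hx') hzx).2⟩ ⟨hy', (m _ (hXW hy') hzy).2⟩
    (Or.inl rfl) (Or.inl rfl)

section
variable {W C : Set V} {u x1 x2 : V} {P : List V}

theorem Spl.Cp12 (hG : InC G) (h : Spl G W u x1 x2 P C) {X : Set V} (hXW : X ⊆ W) (hu : u ∈ X) (h1 : x1 ∈ X) (h2 : x2 ∈ X)
    (hP : ∀ p ∈ P, p ∈ X) : Cp G X u x1 x2 := by
  obtain ⟨d, hd, hdx⟩ := h.hd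
  have hd := List.mem_of_head? hd
  obtain ⟨t, ht, htx⟩ := h.lt
  have ht := List.mem_of_getLast? ht
  have hPD : ∀ p ∈ P, p ∈ Dn G X u := fun p hp => ⟨hP p hp, h.Pu p hp⟩
  refine ⟨hu, h1, h2, h.u1, h.u2, h.n12, ⟨d, t, hPD d hd, ⟨x1, h1, h.u1, Nr.refl, hdx⟩, ⟨x2, h2, h.u2, Nr.refl, htx⟩,
    h.ip.lk hPD hd ht⟩, ?_⟩
  intro z hz uz hz1 hz2
  refine h.lk12 (S := Dn G X z) (fun p hp => ⟨hP p hp, ?_, h.pl z (hXW hz) uz hz1 hz2 p hp⟩) ⟨h1, nadj_class hG uz h.u1 h.u1 Nr.refl hz1⟩ ⟨h2, nadj_class hG uz h.u2 h.u2 Nr.refl hz2⟩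
  rintro rfl
  exact (h.Pu _ hp).2 uz

theorem Spl.CpA (hG : InC G) (h : Spl G W u x1 x2 P C) : Cp G (SA G W u x1 x2 C) u x1 x2 :=
  h.Cp12 hG Spl.SAW h.uA h.x1A h.x2A h.PA
theorem Spl.CpB (hG : InC G) (h : Spl G W u x1 x2 P C) : Cp G (SB G W u x1 x2 P C) u x1 x2 :=
  h.Cp12 hG h.SBW h.uB h.x1B h.x2B h.PB

/-- `v` not in the boundary: all neighbours of `v` are in `X`. -/
theorem Spl.good_int (hG : InC G) (h : Spl G W u x1 x2 P C) {X X0 bd : Set V} (hXW : X ⊆ W)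
    (hu : u ∈ X) (hub : u ∈ bd) (h1 : x1 ∈ X) (h1b : x1 ∈ bd)
    (hb : ∀ a ∈ X, ∀ b ∈ W, b ∉ X → G.Adj a b → a ∈ bd)
    {v : V} (hv : v ∈ X) (hvu : v ≠ u) (hvK : v ∉ Kk G W u x1 x2)
    (hnb : ∀ w ∈ W, G.Adj v w → w ∈ X ∧ w ∈ X0 ∧ (w ∈ bd → w = u ∨ w ∈ Kk G W u x1 x2))
    {x a : V} (hx : x ∈ W) (vx : G.Adj v x) (ha : a ∈ Dn G W v) (hat : Att G W v x a) :
    GoodR G X X0 bd v x a := by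
  refine ⟨x, (hnb x hx vx).1, (hnb x hx vx).2.1, vx, Nr.refl, ?_⟩
  obtain ⟨w, hw, vw, nw, aw⟩ := hat
  obtain ⟨hwX, -, hwb⟩ := hnb w hw vw
  by_cases haX : a ∈ X
  · exact ⟨a, ⟨haX, ha.2⟩, ⟨w, hwX, vw, nw, aw⟩, Or.inl rfl⟩
  · rcases hwb (hb w hwX a ha.1 haX aw.symm) with rfl | hk
    · refine ⟨x1, ⟨h1, ?_, ?_⟩, ⟨w, hwX, vw, nw, h.u1.symm⟩, Or.inr ⟨h1b, fun e => absurd e haX⟩⟩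
      · rintro rfl; exact hvK h.k1
      · intro e; exact hvK (Kk_nr hG h h.k1 vw.symm (hXW hv) e.symm)
    · refine ⟨u, ⟨hu, hvu.symm, fun e => ?_⟩, ⟨w, hwX, vw, nw, hk.2.1⟩, Or.inr ⟨hub, fun e => absurd e haX⟩⟩
      exact hvK (Kk_nr hG h hk e.symm (hXW hv) vw.symm)

/-- `v` in the first class, `x` in the class of `u` -/
theorem Spl.good_u (hG : InC G) (h : Spl G W u x1 x2 P C) {X X0 bd : Set V} (hXW : X ⊆ W)
    (hu : u ∈ X) (hu0 : u ∈ X0) (h2 : x2 ∈ X) (h2b : x2 ∈ bd)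
    (hb : ∀ a ∈ X, ∀ b ∈ W, b ∉ X → G.Adj a b → a ∈ bd)
    {v : V} (hv : v ∈ X) (uv : G.Adj u v) (hv1 : Nr G v x1)
    {x a : V} (hx : x ∈ W) (vx : G.Adj v x) (hxu : Nr G u x) (ha : a ∈ Dn G W v) (hat : Att G W v x a) :
    GoodR G X X0 bd v x a := by
  refine ⟨u, hu, hu0, uv.symm, hxu, ?_⟩
  obtain ⟨w, hw, vw, nw, aw⟩ := hat
  have nwu : Nr G w u := nw.trans hG vw vx uv.symm hxu.symm
  by_cases hc : w ∈ X ∧ a ∈ X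
  · exact ⟨a, ⟨hc.2, ha.2⟩, ⟨w, hc.1, vw, nwu, aw⟩, Or.inl rfl⟩
  · refine ⟨x2, ⟨h2, nadj_class hG uv h.u2 h.u2 Nr.refl (fun e => h.n12 (hv1.symm.trans hG h.u1 uv h.u2 e))⟩,
      ⟨u, hu, uv.symm, Nr.refl, h.u2.symm⟩, Or.inr ⟨h2b, fun haX => ?_⟩⟩
    exact hb a haX w hw (fun hwX => hc ⟨hwX, haX⟩) aw

set_option maxHeartbeats 1000000 in
theorem Spl.inherit_K (hG : InC G) (h : Spl G W u x1 x2 P C) {v x y : V} (hc : Cp G W v x y)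
    (uv : G.Adj u v) (hv1 : Nr G v x1) :
    (∃ x' y', Nr G x' x ∧ Nr G y' y ∧ Cp G (SA G W u x1 x2 C) v x' y') ∨
    (v ∈ SB0 G W u x1 x2 C ∧ ∃ x' ∈ SB0 G W u x1 x2 C, ∃ y' ∈ SB0 G W u x1 x2 C, Nr G x' x ∧ Nr G y' y ∧
      Cp G (SB G W u x1 x2 P C) v x' y') := by
  obtain ⟨hvW, hxW, hyW, vx, vy, nxy, ⟨a, b, haD, at1, at2, hab⟩, hii⟩ := id hc
  have hvK : v ∈ Kk G W u x1 x2 := ⟨hvW, uv, Or.inl hv1⟩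
  have hvC : v ∉ C := h.KC v hvK
  have hbD := hab.mem haD
  -- a neighbour of `v` outside the class of `u` is a nonneighbour of `u`
  have nbu : ∀ w, G.Adj v w → ¬ Nr G u w → w ∉ Kk G W u x1 x2 := fun w vw hn hk => hn (Or.inr hk.2.1)
  have same : ∀ w w', w ∈ W → w' ∈ W → G.Adj v w → G.Adj v w' → Nr G w w' → ¬ Nr G u w → w ∈ C → w' ∈ C := by
    intro w w' hw hw' vw vw' hn hu hwC
    by_contra hwC'
    rcases hn with rfl | hn
    · exact hwC' hwC
    · rcases h.bd w hwC w' hw' hwC' hn with e | e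
      · exact hu (Or.inr (e ▸ hn.symm))
      · exact hu (Nr.trans hG uv.symm vw' vw (Or.inr e.2.1) (Or.inr hn.symm))
  have gB : ∀ x a, x ∈ W → G.Adj v x → a ∈ Dn G W v → Att G W v x a → (Nr G u x ∨ x ∈ C) → v ∈ SB0 G W u x1 x2 C →
      GoodR G (SB G W u x1 x2 P C) (SB0 G W u x1 x2 C) (bdB G W u x1 x2 P C) v x a := by
    intro x a hx vx ha hat hor hvB
    by_cases hxu : Nr G u x
    · exact h.good_u hG (X := SB G W u x1 x2 P C) (X0 := SB0 G W u x1 x2 C) (bd := bdB G W u x1 x2 P C) h.SBW h.uB (Or.inr (Or.inl rfl)) h.x2B ⟨h.x2B, h.KC _ h.k2⟩ h.bdB_spec (Or.inl hvB) uv hv1 hx vx hxu ha hat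
    · have hxC := hor.resolve_left hxu
      obtain ⟨w, hw, vw, nw, aw⟩ := hat
      have hwC : w ∈ C := same x w hx hw vx vw nw.symm hxu hxC
      exact ⟨x, h.CB x hxC, Or.inl hxC, vx, Nr.refl, a, ⟨Or.inl (h.CSB0 w hwC a ha.1 aw.symm), ha.2⟩, ⟨w, h.CB w hwC, vw, nw, aw⟩, Or.inl rfl⟩
  have gA : ∀ x a, x ∈ W → G.Adj v x → a ∈ Dn G W v → Att G W v x a → (Nr G u x ∨ x ∉ C) → v ∈ SA G W u x1 x2 C →
      GoodR G (SA G W u x1 x2 C) (SA G W u x1 x2 C) (bdA G W u x1 x2 C) v x a := by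
    intro x a hx vx ha hat hor hvA
    by_cases hxu : Nr G u x
    · exact h.good_u hG (X := SA G W u x1 x2 C) (X0 := SA G W u x1 x2 C) (bd := bdA G W u x1 x2 C) Spl.SAW h.uA h.uA h.x2A ⟨h.x2A, Or.inr h.k2⟩ (h.bdA_spec hG) hvA uv hv1 hx vx hxu ha hat
    · have hxC := hor.resolve_left hxu
      obtain ⟨w, hw, vw, nw, aw⟩ := hat
      have hwu : ¬ Nr G u w := fun e => hxu (e.trans hG uv.symm vw vx nw)
      have hwC : w ∉ C := fun hwC => hxC (same w x hw hx vw vx nw hwu hwC)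
      have hxA : x ∈ SA G W u x1 x2 C := ⟨hx, hxC, fun e => nbu x vx hxu e.1⟩
      have hwA : w ∈ SA G W u x1 x2 C := ⟨hw, hwC, fun e => nbu w vw hwu e.1⟩
      have haA : a ∈ SA G W u x1 x2 C := by
        by_contra haA
        rcases (h.bdA_spec hG w hwA a ha.1 haA aw.symm).2 with e | e
        · exact hwu (Or.inl e.symm)
        · exact nbu w vw hwu e
      exact ⟨x, hxA, hxA, vx, Nr.refl, a, ⟨haA, ha.2⟩, ⟨w, hwA, vw, nw, aw⟩, Or.inl rfl⟩
  have hnot : ¬ (Nr G u x ∧ Nr G u y) := fun e => nxy (e.1.symm.trans hG vx uv.symm vy e.2)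
  by_cases hB : (Nr G u x ∨ x ∈ C) ∧ (Nr G u y ∨ y ∈ C)
  · right
    have hvB : v ∈ SB0 G W u x1 x2 C := by
      refine Or.inr (Or.inr (Or.inr (Or.inr ⟨hvK, ?_⟩)))
      by_cases hxu : Nr G u x
      · have hyC := hB.2.resolve_left (fun e => hnot ⟨hxu, e⟩)
        exact ⟨y, hyC, vy.symm⟩
      · exact ⟨x, hB.1.resolve_left hxu, vx.symm⟩
    exact ⟨hvB, Cp_inherit hG h.SBW h.bdB_spec (h.keyB hG) (Or.inl hvB) hc haD hab
      (gB x a hxW vx haD at1 hB.1 hvB) (gB y b hyW vy hbD at2 hB.2 hvB)⟩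
  by_cases hA : (Nr G u x ∨ x ∉ C) ∧ (Nr G u y ∨ y ∉ C)
  · left
    have hvA : v ∈ SA G W u x1 x2 C := by
      refine ⟨hvW, hvC, fun hJ => ?_⟩
      by_cases hxu : Nr G u x
      · have hyu := fun e => hnot ⟨hxu, e⟩
        exact hyu (hJ.2 y hyW (hA.2.resolve_left hyu) vy)
      · exact hxu (hJ.2 x hxW (hA.1.resolve_left hxu) vx)
    obtain ⟨x', -, y', -, hh⟩ := Cp_inherit hG Spl.SAW (h.bdA_spec hG) (h.keyA hG) hvA hc haD hab
      (gA x a hxW vx haD at1 hA.1 hvA) (gA y b hyW vy hbD at2 hA.2 hvA)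
    exact ⟨x', y', hh⟩
  exfalso
  have hxu : ¬ Nr G u x := by grind
  have hyu : ¬ Nr G u y := by grind
  have hl := hii u h.uW uv.symm hxu hyu
  have key : ∀ s t, Lk G (Dn G W u) s t → s ∈ C → t ∉ C → False := by
    intro s t hst hs ht
    obtain ⟨c, hc, d, hd, hcd, pc, pd⟩ := hst.cross (p := fun v => v ∈ C) hs ht
    rcases h.bd c pc d hd.1 pd hcd with e | e
    · exact hd.2.1 e
    · exact hd.2.2 e.2.1
  by_cases hxC : x ∈ C
  · exact key x y hl hxC (by grind)
  · exact key y x hl.symm (by grind) hxC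

set_option maxHeartbeats 1000000 in
theorem Spl.inherit (hG : InC G) (h : Spl G W u x1 x2 P C) {v x y : V} (hc : Cp G W v x y) :
    (∃ x' y', Nr G x' x ∧ Nr G y' y ∧ Cp G (SA G W u x1 x2 C) v x' y') ∨
    (v ∈ SB0 G W u x1 x2 C ∧ ∃ x' ∈ SB0 G W u x1 x2 C, ∃ y' ∈ SB0 G W u x1 x2 C, Nr G x' x ∧ Nr G y' y ∧
      Cp G (SB G W u x1 x2 P C) v x' y') := by
  by_cases hvK : v ∈ Kk G W u x1 x2
  · rcases hvK.2.2 with e | e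
    · exact h.inherit_K hG hc hvK.2.1 e
    · have := h.symm.inherit_K hG hc hvK.2.1 e
      rw [SA_comm (x1 := x2), ← SB_comm] at this
      have e0 : SB0 G W u x2 x1 C = SB0 G W u x1 x2 C := by
        ext v; simp only [SB0]; rw [Kk_comm]; simp; grind
      rwa [e0] at this
  obtain ⟨hvW, hxW, hyW, vx, vy, nxy, ⟨a, b, haD, at1, at2, hab⟩, hii⟩ := id hc
  have hbD := hab.mem haD
  by_cases hvu : v = u
  · subst hvu
    have key : ∀ s t, Lk G (Dn G W v) s t → s ∈ C → t ∈ C := by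
      intro s t hst hs
      by_contra ht
      obtain ⟨c, hc, d, hd, hcd, pc, pd⟩ := hst.cross (p := fun v => v ∈ C) hs ht
      rcases h.bd c pc d hd.1 pd hcd with e | e
      · exact hd.2.1 e
      · exact hd.2.2 e.2.1
    by_cases haC : a ∈ C
    · right
      have hbC := key a b hab haC
      have g : ∀ x a, G.Adj v x → a ∈ Dn G W v → Att G W v x a → a ∈ C →
          GoodR G (SB G W v x1 x2 P C) (SB0 G W v x1 x2 C) (bdB G W v x1 x2 P C) v x a := by
        rintro x a vx ha ⟨w, hw, vw, nw, aw⟩ haC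
        have := h.CSB0 a haC w hw aw
        exact ⟨w, Or.inl this, this, vw, nw, a, ⟨h.CB a haC, ha.2⟩, ⟨w, Or.inl this, vw, Nr.refl, aw⟩, Or.inl rfl⟩
      exact ⟨Or.inr (Or.inl rfl), Cp_inherit hG h.SBW h.bdB_spec (h.keyB hG) h.uB hc haD hab
        (g x a vx haD at1 haC) (g y b vy hbD at2 hbC)⟩
    · left
      have hbC : b ∉ C := fun hb => haC (key b a hab.symm hb)
      have g : ∀ x a, G.Adj v x → a ∈ Dn G W v → Att G W v x a → a ∉ C →
          GoodR G (SA G W v x1 x2 C) (SA G W v x1 x2 C) (bdA G W v x1 x2 C) v x a := by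
        rintro x a vx ha ⟨w, hw, vw, nw, aw⟩ haC
        have haA : a ∈ SA G W v x1 x2 C := ⟨ha.1, haC, fun e => ha.2.2 e.1.2.1⟩
        have hwC : w ∉ C := by
          intro hwC
          rcases h.bd w hwC a ha.1 haC aw.symm with e | e
          · exact ha.2.1 e
          · exact ha.2.2 e.2.1
        have hwA : w ∈ SA G W v x1 x2 C := by
          refine ⟨hw, hwC, fun hJ => ?_⟩
          rcases hJ.2 a ha.1 haC aw.symm with e | e
          · exact ha.2.1 e.symm
          · exact ha.2.2 e
        exact ⟨w, hwA, hwA, vw, nw, a, ⟨haA, ha.2⟩, ⟨w, hwA, vw, Nr.refl, aw⟩, Or.inl rfl⟩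
      obtain ⟨x', -, y', -, hh⟩ := Cp_inherit hG Spl.SAW (h.bdA_spec hG) (h.keyA hG) h.uA hc haD hab
        (g x a vx haD at1 haC) (g y b vy hbD at2 hbC)
      exact ⟨x', y', hh⟩
  by_cases hvC : v ∈ C
  · right
    refine ⟨Or.inl hvC, ?_⟩
    have g : ∀ x a, x ∈ W → G.Adj v x → a ∈ Dn G W v → Att G W v x a →
        GoodR G (SB G W u x1 x2 P C) (SB0 G W u x1 x2 C) (bdB G W u x1 x2 P C) v x a := by
      intro x a hx vx ha hat
      refine h.good_int hG (X := SB G W u x1 x2 P C) (X0 := SB0 G W u x1 x2 C) (bd := bdB G W u x1 x2 P C) h.SBW h.uB ⟨h.uB, h.uC⟩ h.x1B ⟨h.x1B, h.KC _ h.k1⟩ h.bdB_spec (h.CB v hvC) hvu hvK ?_ hx vx ha hat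
      intro w hw vw
      refine ⟨Or.inl (h.CSB0 v hvC w hw vw), h.CSB0 v hvC w hw vw, fun hwb => ?_⟩
      exact h.bd v hvC w hw hwb.2 vw
    exact Cp_inherit hG h.SBW h.bdB_spec (h.keyB hG) (h.CB v hvC) hc haD hab
      (g x a hxW vx haD at1) (g y b hyW vy hbD at2)
  · left
    have hvA : v ∈ SA G W u x1 x2 C := ⟨hvW, hvC, fun e => hvK e.1⟩
    have g : ∀ x a, x ∈ W → G.Adj v x → a ∈ Dn G W v → Att G W v x a →
        GoodR G (SA G W u x1 x2 C) (SA G W u x1 x2 C) (bdA G W u x1 x2 C) v x a := by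
      intro x a hx vx ha hat
      refine h.good_int hG (X := SA G W u x1 x2 C) (X0 := SA G W u x1 x2 C) (bd := bdA G W u x1 x2 C) Spl.SAW h.uA ⟨h.uA, Or.inl rfl⟩ h.x1A ⟨h.x1A, Or.inr h.k1⟩ (h.bdA_spec hG) hvA hvu hvK ?_ hx vx ha hat
      intro w hw vw
      have hwA : w ∈ SA G W u x1 x2 C := by
        by_contra hwA
        rcases (h.bdA_spec hG v hvA w hw hwA vw).2 with e | e
        · exact hvu e
        · exact hvK e
      exact ⟨hwA, hwA, fun hwb => hwb.2⟩
    obtain ⟨x', -, y', -, hh⟩ := Cp_inherit hG Spl.SAW (h.bdA_spec hG) (h.keyA hG) hvA hc haD hab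
      (g x a hxW vx haD at1) (g y b hyW vy hbD at2)
    exact ⟨x', y', hh⟩

end

end Part14

section Part15
set_option linter.unusedVariables false
variable {V : Type*} {G : SimpleGraph V}

theorem Lk.comp {S : Set V} {a b : V} (h : Lk G S a b) : Lk G {e | Lk G S a e} a b := by
  induction h with
  | refl => exact Lk.refl
  | @tail b c hab hbc ih =>
    exact ih.trans (Lk.step (S := {e | Lk G S a e}) hbc.1 hab (Lk.trans hab (Lk.step hbc.1 hbc.2.1 hbc.2.2)))

set_option maxHeartbeats 1000000 in
theorem PL_C (hG : InC G) {W C : Set V} {u x1 x2 w y1 y2 : V} {P : List V}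
    (u1 : G.Adj u x1) (u2 : G.Adj u x2) (uw : G.Adj u w) (n12 : ¬ Nr G x1 x2)
    (nw1 : ¬ Nr G w x1) (nw2 : ¬ Nr G w x2)
    (ip : IP G P) (Pu : ∀ p ∈ P, p ≠ u ∧ ¬ G.Adj u p)
    (hd : ∃ h, P.head? = some h ∧ G.Adj h x1) (lt : ∃ t, P.getLast? = some t ∧ G.Adj t x2)
    (x1W : x1 ∈ W) (x2W : x2 ∈ W)
    (cl : ∀ p ∈ P, ∀ k ∈ W, G.Adj u k → (Nr G k x1 ∨ Nr G k x2) → G.Adj p k →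
      (P.head? = some p ∧ k = x1) ∨ (P.getLast? = some p ∧ k = x2))
    (Clk : ∀ a ∈ C, ∀ b ∈ C, Lk G C a b) (uC : u ∉ C) (PC : ∀ c ∈ C, c ∉ P ∧ ∀ p ∈ P, ¬ G.Adj c p)
    (x1C : x1 ∉ C) (x2C : x2 ∉ C)
    (hy1 : y1 ∈ W) (uy1 : G.Adj u y1) (ny1 : Nr G y1 x1) (yc1 : ∃ c ∈ C, G.Adj c y1)
    (hy2 : y2 ∈ W) (uy2 : G.Adj u y2) (ny2 : Nr G y2 x2) (yc2 : ∃ c ∈ C, G.Adj c y2)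
    (wC : w ∉ C) (hw : ∀ r ∈ C, G.Adj u r → ¬ G.Adj w r) : ∀ p ∈ P, ¬ G.Adj w p := by
  let S : Set V := {r | (r ∈ C ∨ (r ∈ W ∧ G.Adj u r ∧ (Nr G r x1 ∨ Nr G r x2))) ∧ r ≠ x1 ∧ r ≠ x2}
  have CS : C ⊆ S := fun c hc => ⟨Or.inl hc, fun e => x1C (e ▸ hc), fun e => x2C (e ▸ hc)⟩
  obtain ⟨c1, hc1, k1⟩ := yc1
  obtain ⟨c2, hc2, k2⟩ := yc2
  have st : ∃ a, G.Adj a x1 ∧ a ∈ S ∧ Lk G S a c1 := by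
    by_cases e : y1 = x1
    · subst e; exact ⟨c1, k1, CS hc1, Lk.refl⟩
    · have : y1 ∈ S := ⟨Or.inr ⟨hy1, uy1, Or.inl ny1⟩, e, fun e' => n12 (e' ▸ ny1.symm)⟩
      exact ⟨y1, ny1.resolve_left e, this, Lk.step k1.symm this (CS hc1)⟩
  have en : ∃ b, G.Adj b x2 ∧ b ∈ S ∧ Lk G S c2 b := by
    by_cases e : y2 = x2
    · subst e; exact ⟨c2, k2, CS hc2, Lk.refl⟩
    · have : y2 ∈ S := ⟨Or.inr ⟨hy2, uy2, Or.inr ny2⟩, fun e' => n12 (e' ▸ ny2), e⟩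
      exact ⟨y2, ny2.resolve_left e, this, Lk.step k2 (CS hc2) this⟩
  obtain ⟨a, ha, haS, la⟩ := st
  obtain ⟨b, hb, hbS, lb⟩ := en
  obtain ⟨R, ipR, RS, hdR, ltR, hxR, hyR⟩ := SP (X := {r | G.Adj r x1}) (Y := {r | G.Adj r x2}) ha hb haS
    ((la.trans ((Clk c1 hc1 c2 hc2).mono CS)).trans lb)
  refine LemmaPL hG u1 u2 uw n12 nw1 nw2 ip Pu hd lt ?_ ?_ ipR hdR ltR hxR hyR ?_ ?_
  · intro p hp h
    rcases cl p hp x1 x1W u1 (Or.inl Nr.refl) h with e | e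
    · exact e.1
    · exact absurd (Or.inl e.2) n12
  · intro p hp h
    rcases cl p hp x2 x2W u2 (Or.inr Nr.refl) h with e | e
    · exact absurd (Or.inl e.2.symm) n12
    · exact e.1
  · intro r hr
    obtain ⟨h1, h2, h3⟩ := RS r hr
    rcases h1 with hC | ⟨rW, ur, hk⟩
    · exact ⟨fun e => uC (e ▸ hC), h2, h3, fun e => wC (e ▸ hC), PC r hC⟩
    · refine ⟨ur.ne', h2, h3, fun e => ?_, fun e => (Pu r e).2 ur, fun p hp hrp => ?_⟩
      · subst e; grind
      · rcases cl p hp r rW ur hk hrp.symm with e | e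
        · exact h2 e.2
        · exact h3 e.2
  · intro r hr ur wr
    obtain ⟨h1, h2, h3⟩ := RS r hr
    rcases h1 with hC | ⟨rW, _, hk⟩
    · exact hw r hC ur wr
    · rcases hk with e | e
      · exact nw1 (Nr.trans hG uw ur u1 (Or.inr wr) e)
      · exact nw2 (Nr.trans hG uw ur u2 (Or.inr wr) e)

set_option maxHeartbeats 2000000 in
theorem split_exists (hG : InC G) {W : Set V} (hW : Atom G W) {u d1 d2 : V} (hu : u ∈ W)
    (hd1 : d1 ∈ Dn G W u) (hd2 : d2 ∈ Dn G W u) (hn : ¬ Lk G (Dn G W u) d1 d2) :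
    ∃ x1 x2 P C, Spl G W u x1 x2 P C ∧ d2 ∈ C ∧ (∀ p ∈ P, Lk G (Dn G W u) d1 p) ∧
      (∀ d, Lk G (Dn G W u) d1 d → d ∉ C) := by
  let D : Set V := {d | Lk G (Dn G W u) d1 d}
  have DD : ∀ d ∈ D, d ∈ Dn G W u := fun d hd => Lk.mem hd hd1
  have Dlk : ∀ x ∈ D, ∀ y ∈ D, Lk G D x y := fun x hx y hy => (Lk.comp hx).symm.trans (Lk.comp hy)
  let X : Set V := {k | k ∈ W ∧ G.Adj u k ∧ ∃ d ∈ D, Att G W u k d}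
  have Xcl : ∀ k ∈ W, G.Adj u k → ∀ y ∈ X, Nr G k y → k ∈ X := by
    rintro k hk uk y ⟨hy, uy, d, hd, w, hw, uw, nw, dw⟩ hn
    exact ⟨hk, uk, d, hd, w, hw, uw, nw.trans hG uw uy uk hn.symm, dw⟩
  let C0 : Set V := {c | c ∈ W ∧ c ∉ D ∧ c ∉ X ∧ c ≠ u}
  have d2C0 : d2 ∈ C0 := ⟨hd2.1, hn, fun e => hd2.2.2 e.2.1, hd2.2.1⟩
  let C : Set V := {c | Lk G C0 d2 c}
  have CC0 : ∀ c ∈ C, c ∈ C0 := fun c hc => Lk.mem hc d2C0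
  have Clk : ∀ x ∈ C, ∀ y ∈ C, Lk G C x y := fun x hx y hy => (Lk.comp hx).symm.trans (Lk.comp hy)
  have CD : ∀ c ∈ C, ∀ d ∈ D, ¬ G.Adj c d := by
    intro c hc d hd hcd
    obtain ⟨h1, h2, h3, h4⟩ := CC0 c hc
    by_cases uc : G.Adj u c
    · exact h3 ⟨h1, uc, d, hd, c, h1, uc, Nr.refl, hcd.symm⟩
    · exact h2 (Lk.trans hd (Lk.step hcd.symm (DD d hd) ⟨h1, h4, uc⟩))
  have bd : ∀ c ∈ C, ∀ w ∈ W, w ∉ C → G.Adj c w → w = u ∨ w ∈ X := by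
    intro c hc w hw hwC hcw
    by_contra hcon
    push Not at hcon
    have : w ∈ C0 := ⟨hw, fun e => CD c hc w e hcw, hcon.2, hcon.1⟩
    exact hwC (Lk.trans hc (Lk.step hcw (CC0 c hc) this))
  have d2C : d2 ∈ C := Lk.refl
  have two : ∃ y1 y2, y1 ∈ X ∧ y2 ∈ X ∧ (∃ c ∈ C, G.Adj c y1) ∧ (∃ c ∈ C, G.Adj c y2) ∧ ¬ Nr G y1 y2 := by
    by_contra hcon
    push Not at hcon
    let Z : Set V := {z | z = u ∨ (z ∈ X ∧ ∃ c ∈ C, G.Adj c z)}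
    have hZ : Clq G Z := by
      rintro a (rfl | ⟨ha, ca⟩) b (rfl | ⟨hb, cb⟩)
      · exact Nr.refl
      · exact Or.inr hb.2.1
      · exact Or.inr ha.2.1.symm
      · obtain ⟨c, hc, hca⟩ := ca
        obtain ⟨c', hc', hcb⟩ := cb
        exact hcon a b ha hb ⟨c, hc, hca⟩ ⟨c', hc', hcb⟩
    have nZ : ∀ d ∈ Dn G W u, d ∉ Z := by
      rintro d hd (e | e)
      · exact hd.2.1 e
      · exact hd.2.2 e.1.2.1
    have ZW : Z ⊆ W := by
      rintro z (rfl | e)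
      · exact hu
      · exact e.1.1
    have := hW Z ZW hZ d2 ⟨hd2.1, nZ d2 hd2⟩ d1 ⟨hd1.1, nZ d1 hd1⟩
    obtain ⟨a, ha, b, hb, hab, pa, pb⟩ := this.cross (p := fun v => v ∈ C) d2C
      (fun e => (CC0 d1 e).2.1 Lk.refl)
    rcases bd a pa b hb.1 pb hab with e | e
    · exact hb.2 (Or.inl e)
    · exact hb.2 (Or.inr ⟨e, a, pa, hab⟩)
  obtain ⟨y1, y2, y1X, y2X, yc1, yc2, n12⟩ := two
  have XC : ∀ x ∈ X, x ∉ C := fun x hx hc => (CC0 x hc).2.2.1 hx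
  have uC : u ∉ C := fun hc => (CC0 u hc).2.2.2 rfl
  have DC : ∀ d ∈ D, d ∉ C := fun d hd hc => (CC0 d hc).2.1 hd
  have third : ∀ y3 ∈ X, (∃ c ∈ C, G.Adj c y3) → Nr G y3 y1 ∨ Nr G y3 y2 := by
    intro y3 y3X yc3
    by_contra hcon
    push Not at hcon
    obtain ⟨n31, n32⟩ := hcon
    let W' : Set V := {v | v ∈ D ∨ v = u ∨ (v ∈ W ∧ G.Adj u v ∧ (Nr G v y1 ∨ Nr G v y2 ∨ Nr G v y3))}
    have at' : ∀ y ∈ X, (y = y1 ∨ y = y2 ∨ y = y3) → ∃ d ∈ D, Att G W' u y d := by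
      rintro y ⟨hy, uy, d, hd, w, hw, uw, nw, dw⟩ ho
      refine ⟨d, hd, w, Or.inr (Or.inr ⟨hw, uw, ?_⟩), uw, nw, dw⟩
      rcases ho with rfl | rfl | rfl
      · exact Or.inl nw
      · exact Or.inr (Or.inl nw)
      · exact Or.inr (Or.inr nw)
    obtain ⟨x, y, c, P, hB, -⟩ := LemmaM hG (W := W') (D := D) (fun d hd => Or.inl hd) (Or.inr (Or.inl rfl))
      (fun d hd => (DD d hd).2) Dlk y1X.2.1 y2X.2.1 y3X.2.1 n12 (fun e => n31 e.symm) (fun e => n32 e.symm)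
      (at' y1 y1X (Or.inl rfl)) (at' y2 y2X (Or.inr (Or.inl rfl))) (at' y3 y3X (Or.inr (Or.inr rfl)))
    have hex : ∃ n, ∃ x y c P, BadP G W' u x y c P ∧ P.length = n := ⟨_, x, y, c, P, hB, rfl⟩
    clear hB x y c P
    classical
    obtain ⟨x, y, c, P, hB, hlen⟩ := Nat.find_spec hex
    have hm : MinBadU G W' u P.length := by
      intro x' y' c' P' h'
      rw [hlen]
      exact Nat.find_min' hex ⟨x', y', c', P', h', rfl⟩
    have PD : ∀ p ∈ P, p ∈ D := by
      intro p hp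
      have := hB.Pu p hp
      rcases hB.PW p hp with e | e | e
      · exact e
      · exact absurd e this.1
      · exact absurd e.2.1 this.2
    have cls : ∀ k ∈ W', G.Adj u k → k ∈ X ∧ ∃ y ∈ W', G.Adj u y ∧ Nr G y k ∧ ∃ c ∈ C, G.Adj c y := by
      intro k hk uk
      rcases hk with e | e | ⟨kW, -, e⟩
      · exact absurd uk (DD k e).2.2
      · exact absurd e uk.ne'
      · rcases e with e | e | e
        · exact ⟨Xcl k kW uk y1 y1X e, y1, Or.inr (Or.inr ⟨y1X.1, y1X.2.1, Or.inl Nr.refl⟩), y1X.2.1, e.symm, yc1⟩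
        · exact ⟨Xcl k kW uk y2 y2X e, y2, Or.inr (Or.inr ⟨y2X.1, y2X.2.1, Or.inr (Or.inl Nr.refl)⟩), y2X.2.1, e.symm, yc2⟩
        · exact ⟨Xcl k kW uk y3 y3X e, y3, Or.inr (Or.inr ⟨y3X.1, y3X.2.1, Or.inr (Or.inr Nr.refl)⟩), y3X.2.1, e.symm, yc3⟩
    obtain ⟨xX, a, haW, ua, nax, hac⟩ := cls x hB.xW hB.ux
    obtain ⟨yX, b, hbW, ub, nby, hbc⟩ := cls y hB.yW hB.uy
    obtain ⟨cX, -⟩ := cls c hB.cW hB.uc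
    obtain ⟨p, hp, hpc⟩ := hB.mid
    refine PL_C hG (W := W') (C := C) (w := c) hB.ux hB.uy hB.uc hB.xy (fun e => hB.xc e.symm) (fun e => hB.yc e.symm)
      hB.ip hB.Pu hB.hd hB.lt hB.xW hB.yW ?_ Clk uC (fun c' hc' => ⟨fun e => DC _ (PD _ e) hc', fun p hp => CD c' hc' p (PD p hp)⟩)
      (XC x xX) (XC y yX) haW ua nax hac hbW ub nby hbc (XC c cX) ?_ p hp hpc.symm
    · intro p hp k hk uk hkn hpk
      refine M1 hG hB hm hp hk uk hpk ?_
      intro hkc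
      rcases hkn with e | e
      · exact hB.xc (e.symm.trans hG hB.ux uk hB.uc hkc)
      · exact hB.yc (e.symm.trans hG hB.uy uk hB.uc hkc)
    · intro r hr ur cr
      exact XC r (Xcl r (CC0 r hr).1 ur c cX (Or.inr cr.symm)) hr
  obtain ⟨y1W, uy1, a1⟩ := id y1X
  obtain ⟨y2W, uy2, a2⟩ := id y2X
  obtain ⟨x1, x2, P, x1W, x2W, ux1, ux2, nx1, nx2, ip, PD, hd, lt, PX, PY⟩ := getPath Dlk a1 a2
  have x1X : x1 ∈ X := Xcl x1 x1W ux1 y1 y1X nx1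
  have x2X : x2 ∈ X := Xcl x2 x2W ux2 y2 y2X nx2
  have m12 : ¬ Nr G x1 x2 := ne_of_class hG uy1 uy2 ux1 ux2 n12 nx1 nx2
  have Pu : ∀ p ∈ P, p ≠ u ∧ ¬ G.Adj u p := fun p hp => (DD p (PD p hp)).2
  have cl1 : ∀ p ∈ P, ∀ w ∈ W, G.Adj u w → Nr G w x1 → G.Adj p w → P.head? = some p ∧ w = x1 := by
    intro p hp w hw uw hwn hpw
    have h1 := PX p hp ⟨w, hw, uw, hwn.trans hG uw ux1 uy1 nx1, hpw⟩
    obtain ⟨h, hh, hhx⟩ := hd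
    obtain rfl : h = p := by simpa [hh] using h1
    exact ⟨h1, att_unique hG (Pu _ hp).1 (Pu _ hp).2 uw ux1 hpw hhx⟩
  have cl2 : ∀ p ∈ P, ∀ w ∈ W, G.Adj u w → Nr G w x2 → G.Adj p w → P.getLast? = some p ∧ w = x2 := by
    intro p hp w hw uw hwn hpw
    have h1 := PY p hp ⟨w, hw, uw, hwn.trans hG uw ux2 uy2 nx2, hpw⟩
    obtain ⟨h, hh, hhx⟩ := lt
    obtain rfl : h = p := by simpa [hh] using h1
    exact ⟨h1, att_unique hG (Pu _ hp).1 (Pu _ hp).2 uw ux2 hpw hhx⟩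
  have bdK : ∀ c ∈ C, ∀ w ∈ W, w ∉ C → G.Adj c w → w = u ∨ w ∈ Kk G W u x1 x2 := by
    intro c hc w hw hwC hcw
    rcases bd c hc w hw hwC hcw with e | e
    · exact Or.inl e
    · right
      refine ⟨hw, e.2.1, ?_⟩
      rcases third w e ⟨c, hc, hcw⟩ with e' | e'
      · exact Or.inl (e'.trans hG e.2.1 uy1 ux1 nx1.symm)
      · exact Or.inr (e'.trans hG e.2.1 uy2 ux2 nx2.symm)
  have PC : ∀ c ∈ C, c ∉ P ∧ ∀ p ∈ P, ¬ G.Adj c p :=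
    fun c' hc' => ⟨fun e => DC _ (PD _ e) hc', fun p hp => CD c' hc' p (PD p hp)⟩
  refine ⟨x1, x2, P, C, ⟨hW, hu, x1W, x2W, ux1, ux2, m12, ip, fun p hp => (DD p (PD p hp)).1, Pu, hd, lt, cl1, cl2,
    fun c hc => (CC0 c hc).1, uC, fun p hp hc => (PC p hc).1 hp, Clk, bdK, ?_, ⟨y1, y1W, uy1, nx1.symm, yc1⟩, ⟨y2, y2W, uy2, nx2.symm, yc2⟩, ?_⟩, d2C, PD, DC⟩
  · rintro w ⟨hw, uw, e | e⟩
    · exact XC w (Xcl w hw uw x1 x1X e)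
    · exact XC w (Xcl w hw uw x2 x2X e)
  · intro w hw uw nw1 nw2 p hp hwp
    by_cases hwC : w ∈ C
    · exact (PC w hwC).2 p hp hwp
    refine PL_C hG (W := W) (C := C) (w := w) ux1 ux2 uw m12 nw1 nw2
      ip Pu hd lt x1W x2W ?_ Clk uC PC
      (XC x1 x1X) (XC x2 x2X) y1W uy1 nx1.symm yc1 y2W uy2 nx2.symm yc2 hwC ?_ p hp hwp
    · intro p hp k hk uk hkn hpk
      rcases hkn with e | e
      · exact Or.inl (cl1 p hp k hk uk e hpk)
      · exact Or.inr (cl2 p hp k hk uk e hpk)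
    · intro r hr ur wr
      rcases bdK r hr w hw hwC wr.symm with e | e
      · exact uw.ne' e
      · rcases e.2.2 with e | e
        · exact nw1 e
        · exact nw2 e

end Part15

section Part16
set_option linter.unusedVariables false
variable {V : Type*} {G : SimpleGraph V}

/-- in a hole every vertex has exactly two neighbours -/
theorem HL.two {l : List V} (h : HL G l) {y : V} (hy : y ∈ l) :
    ∃ a ∈ l, ∃ b ∈ l, a ≠ b ∧ G.Adj y a ∧ G.Adj y b ∧ ∀ c ∈ l, G.Adj y c → c = a ∨ c = b := by
  obtain ⟨l', h', hp⟩ := h.rotTo hy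
  have hm : ∀ c, c ∈ l ↔ c = y ∨ c ∈ l' := fun c => by rw [← hp.mem_iff]; simp
  obtain ⟨ip, hlen, hadj⟩ := h'
  rcases snoc_cases l' with rfl | ⟨r, rfl⟩ | ⟨a, M, b, rfl⟩
  · simp at hlen
  · simp at hlen
  · have hn := ip.nodup
    refine ⟨a, (hm a).2 (by simp), b, (hm b).2 (by simp), ?_, ?_, ?_, ?_⟩
    · rintro rfl; simp at hn
    · exact (hadj a (by simp)).2.2 (by simp)
    · exact (hadj b (by simp)).2.2 (by simp)
    · intro c hc yc
      rcases (hm c).1 hc with rfl | hc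
      · exact absurd yc (G.loopless.irrefl _)
      · have := (hadj c hc).2.1 yc
        simp at this
        rcases this with e | e
        · exact Or.inl e.symm
        · exact Or.inr e.symm

theorem HL_two_paths {x1 x2 : V} {P R : List V} (hx12 : x1 ≠ x2) (n12 : ¬ G.Adj x1 x2) (ip : IP G P) (ipR : IP G R)
    (x1P : x1 ∉ P) (x2P : x2 ∉ P) (x1R : x1 ∉ R) (x2R : x2 ∉ R)
    (hd : ∃ h, P.head? = some h ∧ G.Adj h x1) (lt : ∃ t, P.getLast? = some t ∧ G.Adj t x2)
    (hx : ∀ p ∈ P, G.Adj p x1 → P.head? = some p) (hy : ∀ p ∈ P, G.Adj p x2 → P.getLast? = some p)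
    (hdR : ∃ h, R.head? = some h ∧ G.Adj h x1) (ltR : ∃ t, R.getLast? = some t ∧ G.Adj t x2)
    (hxR : ∀ p ∈ R, G.Adj p x1 → R.head? = some p) (hyR : ∀ p ∈ R, G.Adj p x2 → R.getLast? = some p)
    (dis : ∀ r ∈ R, r ∉ P ∧ ∀ p ∈ P, ¬ G.Adj r p) : HL G ((x1 :: P) ++ (x2 :: R.reverse)) := by
  obtain ⟨p0, hp0, ap0⟩ := hd
  obtain ⟨p1, hp1, ap1⟩ := lt
  obtain ⟨r0, hr0, ar0⟩ := hdR
  obtain ⟨r1, hr1, ar1⟩ := ltR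
  have hP : P ≠ [] := by rintro rfl; simp at hp0
  have hR : R ≠ [] := by rintro rfl; simp at hr0
  have gl : (x1 :: P).getLast? = some p1 := by
    rw [← hp1]; rcases P with _ | ⟨a, P⟩
    · simp at hP
    · simp
  have gr : (x2 :: R.reverse).getLast? = some r0 := by
    rw [← hr0, ← List.getLast?_reverse]
    have : R.reverse ≠ [] := by simpa using hR
    rcases hQ : R.reverse with _ | ⟨a, Q⟩
    · exact absurd hQ this
    · simp
  rw [HL_append (by simp) (by simp), gl, gr]
  refine ⟨⟨ip, ?_⟩, ⟨ipR.rev, ?_⟩, ?_, ?_⟩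
  · intro x hxP
    refine ⟨fun e => x1P (e ▸ hxP), fun e => hx x hxP e.symm, fun e => ?_⟩
    rw [hp0] at e; cases e; exact ap0.symm
  · intro x hxR'
    simp only [List.mem_reverse] at hxR'
    rw [List.head?_reverse]
    refine ⟨fun e => x2R (e ▸ hxR'), fun e => hyR x hxR' e.symm, fun e => ?_⟩
    rw [hr1] at e; cases e; exact ar1.symm
  · have := List.length_pos_iff.2 hP
    have := List.length_pos_iff.2 hR
    simp; omega
  · intro a ha b hb
    simp only [List.mem_cons, List.mem_reverse] at ha hb
    simp only [List.head?_cons, Option.some.injEq]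
    have m0 := List.mem_of_head? hp0
    have m1 := List.mem_of_getLast? hp1
    have q0 := List.mem_of_head? hr0
    rcases ha with rfl | ha <;> rcases hb with rfl | hb
    · refine ⟨hx12, fun e => absurd e n12, ?_⟩
      rintro (e | e)
      · exact absurd (e.1 ▸ m1) x1P
      · exact absurd (e.2 ▸ q0) x2R
    · refine ⟨fun e => x1R (e ▸ hb), fun e => ?_, ?_⟩
      · have := hxR b hb e.symm
        rw [hr0] at this; cases this; exact Or.inr ⟨rfl, rfl⟩
      · rintro (e | e)
        · exact absurd (e.1 ▸ m1) x1P
        · rw [← e.2]; exact ar0.symm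
    · refine ⟨fun e => x2P (e ▸ ha), fun e => ?_, ?_⟩
      · have := hy a ha e
        rw [hp1] at this; cases this; exact Or.inl ⟨rfl, rfl⟩
      · rintro (e | e)
        · rw [← e.1]; exact ap1
        · exact absurd (e.1 ▸ ha) x1P
    · have := dis b hb
      refine ⟨fun e => this.1 (e ▸ ha), fun e => absurd e.symm (this.2 a ha), ?_⟩
      rintro (e | e)
      · exact absurd (e.2 ▸ hb) x2R
      · exact absurd (e.1 ▸ ha) x1P

set_option maxHeartbeats 1000000 in
theorem Spl.ring (hG : InC G) {W C : Set V} {u x1 x2 : V} {P : List V} (h : Spl G W u x1 x2 P C) :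
    ∃ l, HL G l ∧ u ∉ l ∧ ∀ x ∈ l, x ∈ W := by
  let S : Set V := {r | (r ∈ C ∨ (r ∈ W ∧ G.Adj u r ∧ (Nr G r x1 ∨ Nr G r x2))) ∧ r ≠ x1 ∧ r ≠ x2}
  have x1C := h.KC _ h.k1
  have x2C := h.KC _ h.k2
  have CS : C ⊆ S := fun c hc => ⟨Or.inl hc, fun e => x1C (e ▸ hc), fun e => x2C (e ▸ hc)⟩
  obtain ⟨y1, hy1, uy1, ny1, c1, hc1, k1⟩ := h.y1
  obtain ⟨y2, hy2, uy2, ny2, c2, hc2, k2⟩ := h.y2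
  have n12 := h.n12
  have st : ∃ a, G.Adj a x1 ∧ a ∈ S ∧ Lk G S a c1 := by
    by_cases e : y1 = x1
    · subst e; exact ⟨c1, k1, CS hc1, Lk.refl⟩
    · have : y1 ∈ S := ⟨Or.inr ⟨hy1, uy1, Or.inl ny1⟩, e, fun e' => n12 (e' ▸ ny1.symm)⟩
      exact ⟨y1, ny1.resolve_left e, this, Lk.step k1.symm this (CS hc1)⟩
  have en : ∃ b, G.Adj b x2 ∧ b ∈ S ∧ Lk G S c2 b := by
    by_cases e : y2 = x2
    · subst e; exact ⟨c2, k2, CS hc2, Lk.refl⟩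
    · have : y2 ∈ S := ⟨Or.inr ⟨hy2, uy2, Or.inr ny2⟩, fun e' => n12 (e' ▸ ny2), e⟩
      exact ⟨y2, ny2.resolve_left e, this, Lk.step k2 (CS hc2) this⟩
  obtain ⟨a, ha, haS, la⟩ := st
  obtain ⟨b, hb, hbS, lb⟩ := en
  obtain ⟨R, ipR, RS, hdR, ltR, hxR, hyR⟩ := SP (X := {r | G.Adj r x1}) (Y := {r | G.Adj r x2}) ha hb haS
    ((la.trans ((h.Clk c1 hc1 c2 hc2).mono CS)).trans lb)
  refine ⟨_, HL_two_paths (fun e => n12 (Or.inl e)) (fun e => n12 (Or.inr e)) h.ip ipR (fun e => (h.Pu _ e).2 h.u1) (fun e => (h.Pu _ e).2 h.u2)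
    (fun e => (RS _ e).2.1 rfl) (fun e => (RS _ e).2.2 rfl) h.hd h.lt
    (fun p hp e => (h.cl1 p hp x1 h.x1W h.u1 Nr.refl e).1) (fun p hp e => (h.cl2 p hp x2 h.x2W h.u2 Nr.refl e).1)
    hdR ltR hxR hyR ?_, ?_, ?_⟩
  · intro r hr
    obtain ⟨h1, h2, h3⟩ := RS r hr
    rcases h1 with hC | ⟨rW, ur, hk⟩
    · refine ⟨fun e => h.PC r e hC, fun p hp hrp => ?_⟩
      rcases h.bd r hC p (h.PW p hp) (h.PC p hp) hrp with e | e
      · exact (h.Pu p hp).1 e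
      · exact (h.Pu p hp).2 e.2.1
    · refine ⟨fun e => (h.Pu r e).2 ur, fun p hp hrp => ?_⟩
      rcases hk with e | e
      · exact h2 (h.cl1 p hp r rW ur e hrp.symm).2
      · exact h3 (h.cl2 p hp r rW ur e hrp.symm).2
  · intro hu
    simp only [List.mem_append, List.mem_cons, List.mem_reverse] at hu
    rcases hu with (e | e) | e | e
    · exact h.u1.ne e
    · exact (h.Pu u e).1 rfl
    · exact h.u2.ne e
    · rcases (RS u e).1 with e | e
      · exact h.uC e
      · exact G.loopless.irrefl _ e.2.1
  · intro x hx
    simp only [List.mem_append, List.mem_cons, List.mem_reverse] at hx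
    rcases hx with (rfl | e) | rfl | e
    · exact h.x1W
    · exact h.PW x e
    · exact h.x2W
    · rcases (RS x e).1 with e | e
      · exact h.CW x e
      · exact e.1

theorem Spl.deg2 (hG : InC G) {W C : Set V} {u x1 x2 d : V} {P : List V} (h : Spl G W u x1 x2 P C)
    (hWS : ∀ x ∈ W, x ∈ SB G W u x1 x2 P C) (hd : d ∈ Dn G W u) (hdC : d ∉ C) {a b c : V} (ha : a ∈ W) (hb : b ∈ W) (hc : c ∈ W)
    (da : G.Adj d a) (db : G.Adj d b) (dc : G.Adj d c) : a = b ∨ a = c ∨ b = c := by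
  have hdP : d ∈ P := by
    rcases hWS d hd.1 with (e | e | e | e | e) | e
    · exact absurd e hdC
    · exact absurd e hd.2.1
    · subst e; exact absurd h.u1 hd.2.2
    · subst e; exact absurd h.u2 hd.2.2
    · exact absurd e.1.2.1 hd.2.2
    · exact e
  have key : ∀ w ∈ W, G.Adj d w → w ∈ u :: x1 :: P ++ [x2] := by
    intro w hw dw
    rw [h.mem_hole]
    rcases hWS w hw with (e | e | e | e | e) | e
    · exfalso
      rcases h.bd w e d hd.1 hdC dw.symm with e | e
      · exact hd.2.1 e
      · exact hd.2.2 e.2.1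
    · simp [e]
    · simp [e]
    · simp [e]
    · rcases e.1.2.2 with e' | e'
      · have := (h.cl1 d hdP w hw e.1.2.1 e' dw).2; simp [this]
      · have := (h.cl2 d hdP w hw e.1.2.1 e' dw).2; simp [this]
    · simp [e]
  obtain ⟨s, hs, t, ht, -, -, -, hst⟩ := h.hole.two (h.mem_hole.2 (Or.inr (Or.inr (Or.inr hdP))))
  have h1 := hst a (key a ha da) da
  have h2 := hst b (key b hb db) db
  have h3 := hst c (key c hc dc) dc
  grind

set_option maxHeartbeats 1000000 in
theorem wheel_base (hG : InC G) {W : Set V} (hW : Atom G W) {u d1 d2 : V} (hu : u ∈ W)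
    (hd1 : d1 ∈ Dn G W u) (hd2 : d2 ∈ Dn G W u) (hn : ¬ Lk G (Dn G W u) d1 d2)
    (hall : ∀ x1 x2 P C, Spl G W u x1 x2 P C → ∀ x ∈ W, x ∈ SB G W u x1 x2 P C) :
    ∃ l, HL G l ∧ u ∉ l ∧ ∀ x, x ∈ W ↔ x = u ∨ x ∈ l := by
  have deg : ∀ d ∈ Dn G W u, ∀ a ∈ W, ∀ b ∈ W, ∀ c ∈ W, G.Adj d a → G.Adj d b → G.Adj d c → a = b ∨ a = c ∨ b = c := by
    intro d hd a ha b hb c hc da db dc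
    have : ∃ d' ∈ Dn G W u, ¬ Lk G (Dn G W u) d d' := by
      by_contra hcon
      push Not at hcon
      exact hn ((hcon d1 hd1).symm.trans (hcon d2 hd2))
    obtain ⟨d', hd', hn'⟩ := this
    obtain ⟨x1, x2, P, C, h, -, -, hC⟩ := split_exists hG hW hu hd hd' hn'
    exact h.deg2 hG (hall _ _ _ _ h) hd (hC d Lk.refl) ha hb hc da db dc
  obtain ⟨x1, x2, P, C, h, -, -, -⟩ := split_exists hG hW hu hd1 hd2 hn
  obtain ⟨l, hl, hul, hlW⟩ := h.ring hG
  refine ⟨l, hl, hul, fun x => ⟨fun hx => ?_, ?_⟩⟩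
  swap
  · rintro (rfl | e)
    · exact hu
    · exact hlW x e
  by_contra hcon
  push Not at hcon
  obtain ⟨hxu, hxl⟩ := hcon
  have att : ∀ r ∈ W, r ∉ l → r ≠ u → ∀ y ∈ l, G.Adj r y → G.Adj u y := by
    intro r hr hrl hru y hy hry
    by_contra huy
    obtain ⟨a, ha, b, hb, hab, ya, yb, -⟩ := hl.two hy
    rcases deg y ⟨hlW y hy, fun e => hul (e ▸ hy), huy⟩ a (hlW a ha) b (hlW b hb) r hr ya yb hry.symm with e | e | e
    · exact hab e
    · exact hrl (e ▸ ha)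
    · exact hrl (e ▸ hb)
  let S : Set V := {r | r ∈ W ∧ r ∉ l ∧ r ≠ u}
  have hc : ∀ r ∈ S, ∀ x ∈ l, ∀ y ∈ l, G.Adj r x → G.Adj r y → Nr G x y := by
    rintro r ⟨hr, hrl, hru⟩ x hx y hy rx ry
    have ux := att r hr hrl hru x hx rx
    have uy := att r hr hrl hru y hy ry
    by_cases ur : G.Adj u r
    · exact Nr.trans hG ux ur uy (Or.inr rx.symm) (Or.inr ry)
    · exact Or.inl (att_unique hG hru ur ux uy rx ry)
  have xS : x ∈ S := ⟨hx, hxl, hxu⟩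
  by_cases hb : ∃ c c' p q, Lk G S x c ∧ Lk G S x c' ∧ p ∈ l ∧ q ∈ l ∧ G.Adj c p ∧ G.Adj c' q ∧ ¬ Nr G p q
  · obtain ⟨c, c', p, q, h1, h2, hp, hq, hcp, hcq, hpq⟩ := hb
    obtain ⟨R, r1, M, r2, p, z, q, l', RS, -, k1, k2, k3, k4, k5, k6, k7, k8, k9, k10, ⟨m, hm, hmz⟩, k12, k13, k14⟩ :=
      UCset hG hl (S := S) (fun x hx hx' => hx'.2.1 hx) hc
        (h1.mem xS) (h1.symm.trans h2) hp hq hcp hcq hpq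
    have mm : ∀ r ∈ r1 :: M ++ [r2], ∀ y ∈ l, G.Adj r y → G.Adj u y := by
      intro r hr y hy hry
      have := RS r (k1.subset hr)
      exact att r this.1 this.2.1 this.2.2 y hy hry
    have up := mm r1 (by simp) p k2 k9
    have uq := mm r2 (by simp) q k4 k10
    have uz := mm m (by simp [hm]) z k3 hmz
    rcases Nr.trans hG up uz uq (Or.inr k5) (Or.inr k6) with e | e
    · exact k7 e
    · exact k8 e
  · push Not at hb
    let Z : Set V := {p | p = u ∨ (p ∈ l ∧ ∃ c, Lk G S x c ∧ G.Adj c p)}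
    have uZ : ∀ p ∈ l, ∀ c, Lk G S x c → G.Adj c p → G.Adj u p := by
      intro p hp c hc hcp
      have := Lk.mem hc xS
      exact att c this.1 this.2.1 this.2.2 p hp hcp
    have hZ : Clq G Z := by
      rintro a (rfl | ⟨hx, c, h1, h2⟩) b (rfl | ⟨hy, c', h3, h4⟩)
      · exact Nr.refl
      · exact Or.inr (uZ b hy c' h3 h4)
      · exact Or.inr (uZ a hx c h1 h2).symm
      · exact hb c c' a b h1 h3 hx hy h2 h4
    obtain ⟨a, ha, haZ⟩ : ∃ a ∈ l, a ∉ Z := by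
      by_contra hno
      push Not at hno
      obtain ⟨a, ha, b, hb, hab⟩ := hl.not_clq
      exact hab (hZ a (hno a ha) b (hno b hb))
    have ZW : Z ⊆ W := by
      rintro z (rfl | e)
      · exact hu
      · exact hlW z e.1
    have xZ : x ∉ Z := by
      rintro (e | e)
      · exact hxu e
      · exact hxl e.1
    have := hW Z ZW hZ x ⟨hx, xZ⟩ a ⟨hlW a ha, haZ⟩
    obtain ⟨a', ha', b, hb', hab, pa, pb⟩ := this.cross
      (p := fun v => v ∉ l ∧ Lk G S x v) ⟨hxl, Lk.refl⟩ (fun hh => hh.1 ha)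
    by_cases hbl : b ∈ l
    · exact hb'.2 (Or.inr ⟨hbl, a', pa.2, hab⟩)
    · exact pb ⟨hbl, pa.2.trans (Lk.step hab (Lk.mem pa.2 xS) ⟨hb'.1, hbl, fun e => hb'.2 (Or.inl e)⟩)⟩

end Part16

section Part17
set_option linter.unusedVariables false
variable {V : Type*} {G : SimpleGraph V}

/-! ### lines -/

def ln (G : SimpleGraph V) (u v : V) : Set V := {w | Nr G w u ∧ Nr G w v}

theorem ln_left {u v : V} (h : G.Adj u v) : u ∈ ln G u v := ⟨Or.inl rfl, Or.inr h⟩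
theorem ln_right {u v : V} (h : G.Adj u v) : v ∈ ln G u v := ⟨Or.inr h.symm, Or.inl rfl⟩
theorem ln_comm {u v : V} : ln G u v = ln G v u := by
  ext w; simp only [ln, Set.mem_ofPred_eq]; exact and_comm

theorem ln_clq (hG : InC G) {u v : V} (h : G.Adj u v) : Clq G (ln G u v) := by
  intro a ha b hb
  by_contra hn
  unfold Nr at hn
  push Not at hn
  have hu : G.Adj u a := by
    rcases ha.1 with e | e
    · subst e
      rcases hb.1 with e | e
      · exact absurd e.symm hn.1
      · exact absurd e.symm hn.2
    · exact e.symm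
  have hv : G.Adj v a := by
    rcases ha.2 with e | e
    · subst e
      rcases hb.2 with e | e
      · exact absurd e.symm hn.1
      · exact absurd e.symm hn.2
    · exact e.symm
  have hu' : G.Adj u b := by
    rcases hb.1 with e | e
    · subst e; exact absurd hu.symm hn.2
    · exact e.symm
  have hv' : G.Adj v b := by
    rcases hb.2 with e | e
    · subst e; exact absurd hv.symm hn.2
    · exact e.symm
  exact h.ne (CN hG hn.1 hn.2 hu hu' hv hv')

theorem ln_adj (hG : InC G) {u v a b : V} (h : G.Adj u v) (ha : a ∈ ln G u v) (hb : b ∈ ln G u v) (hab : a ≠ b) :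
    G.Adj a b := by
  rcases ln_clq hG h a ha b hb with e | e
  · exact absurd e hab
  · exact e

theorem ln_eq (hG : InC G) {u v a b : V} (h : G.Adj u v) (ha : a ∈ ln G u v) (hb : b ∈ ln G u v) (hab : a ≠ b) :
    ln G a b = ln G u v := by
  have hadj := ln_adj hG h ha hb hab
  have hu : u ∈ ln G a b := ⟨ha.1.symm, hb.1.symm⟩
  have hv : v ∈ ln G a b := ⟨ha.2.symm, hb.2.symm⟩
  ext w
  exact ⟨fun hw => ⟨ln_clq hG hadj w hw u hu, ln_clq hG hadj w hw v hv⟩,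
    fun hw => ⟨ln_clq hG h w hw a ha, ln_clq hG h w hw b hb⟩⟩

theorem ln_nr (hG : InC G) {v x x' : V} (h : G.Adj v x) (h' : G.Adj v x') (hn : Nr G x' x) : ln G v x' = ln G v x :=
  ln_eq hG h (ln_left h) ⟨Or.inr h'.symm, hn⟩ h'.ne

def Ln (G : SimpleGraph V) (A M : Set V) : Prop := ∃ u ∈ A, ∃ v ∈ A, G.Adj u v ∧ M = ln G u v

theorem Ln.mono {A B M : Set V} (h : Ln G A M) (hAB : A ⊆ B) : Ln G B M := by
  obtain ⟨u, hu, v, hv, uv, e⟩ := h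
  exact ⟨u, hAB hu, v, hAB hv, uv, e⟩

theorem Ln.not_sub {A M : Set V} (h : Ln G A M) : ¬ M.Subsingleton := by
  obtain ⟨u, hu, v, hv, uv, rfl⟩ := h
  intro e
  exact uv.ne (e (ln_left uv) (ln_right uv))

theorem Ln.clq (hG : InC G) {A M : Set V} (h : Ln G A M) : Clq G M := by
  obtain ⟨u, hu, v, hv, uv, rfl⟩ := h
  exact ln_clq hG uv

theorem Ln.of_two (hG : InC G) {A B M : Set V} (h : Ln G A M) {a b : V} (ha : a ∈ M) (hb : b ∈ M) (hab : a ≠ b)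
    (ha' : a ∈ B) (hb' : b ∈ B) : Ln G B M := by
  obtain ⟨u, hu, v, hv, uv, rfl⟩ := h
  exact ⟨a, ha', b, hb', ln_adj hG uv ha hb hab, (ln_eq hG uv ha hb hab).symm⟩

theorem Ln.sub_clq {A Z M : Set V} (h : Ln G A M) (hZ : Clq G Z) (hAZ : A ⊆ Z) : Z ⊆ M := by
  obtain ⟨u, hu, v, hv, uv, rfl⟩ := h
  exact fun z hz => ⟨hZ z hz u (hAZ hu), hZ z hz v (hAZ hv)⟩

/-! ### acyclicity by cuts -/

theorem acyclic_of_cut {ι : Type*} {T : SimpleGraph ι}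
    (h : ∀ u v, T.Adj u v → ∃ p : ι → Prop, p u ∧ ¬ p v ∧ ∀ a b, T.Adj a b → p a → ¬ p b → a = u ∧ b = v) :
    T.IsAcyclic := by
  rw [isAcyclic_iff_forall_adj_isBridge]
  intro u v huv
  rw [isBridge_iff]
  obtain ⟨p, hu, hv, hp⟩ := h u v huv
  intro hr
  rw [reachable_iff_reflTransGen] at hr
  have : ∀ w, Relation.ReflTransGen (T.deleteEdges {s(u, v)}).Adj u w → p w := by
    intro w hw
    induction hw with
    | refl => exact hu
    | tail _ hbc ih =>
      by_contra hc
      rw [deleteEdges_adj] at hbc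
      obtain ⟨rfl, rfl⟩ := hp _ _ hbc.1 ih hc
      exact hbc.2 (by simp)
  exact hv (this v hr)

theorem cut_of_acyclic {ι : Type*} {T : SimpleGraph ι} (h : T.IsAcyclic) {u v : ι} (huv : T.Adj u v) :
    ∃ p : ι → Prop, p u ∧ ¬ p v ∧ ∀ a b, T.Adj a b → p a → ¬ p b → a = u ∧ b = v := by
  rw [isAcyclic_iff_forall_adj_isBridge] at h
  have hb := h huv
  rw [isBridge_iff] at hb
  refine ⟨fun a => (T.deleteEdges {s(u, v)}).Reachable u a, Reachable.refl _, hb, ?_⟩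
  intro a b hab ha hnb
  by_cases he : s(a, b) = s(u, v)
  · rw [Sym2.eq_iff] at he
    rcases he with he | ⟨rfl, rfl⟩
    · exact he
    · exact absurd (Reachable.refl _) hnb
  · exact absurd (ha.trans (Adj.reachable (by rw [deleteEdges_adj]; exact ⟨hab, by simpa using he⟩))) hnb

/-- join of two graphs by an edge -/
abbrev Jn {ι κ : Type*} (T1 : SimpleGraph ι) (T2 : SimpleGraph κ) (t1 : ι) (t2 : κ) : SimpleGraph (ι ⊕ κ) :=
  (T1 ⊕g T2) ⊔ edge (.inl t1) (.inr t2)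

theorem Jn_edge {ι κ : Type*} {T1 : SimpleGraph ι} {T2 : SimpleGraph κ} {t1 : ι} {t2 : κ} :
    (Jn T1 T2 t1 t2).Adj (.inl t1) (.inr t2) := by simp [Jn, edge_adj]

theorem Jn_tree {ι κ : Type*} {T1 : SimpleGraph ι} {T2 : SimpleGraph κ} (h1 : T1.IsTree) (h2 : T2.IsTree)
    (t1 : ι) (t2 : κ) : (Jn T1 T2 t1 t2).IsTree := by
  refine ⟨h1.connected.sum_sup_edge h2.connected, ?_⟩
  refine IsAcyclic.sup_edge_of_not_reachable (not_reachable_sum_inl_inr _ _) ?_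
  apply acyclic_of_cut
  rintro (u | u) (v | v) huv
  · rw [sum_adj_inl] at huv
    obtain ⟨p, hu, hv, hp⟩ := cut_of_acyclic h1.isAcyclic huv
    refine ⟨Sum.elim p (fun _ => False), hu, hv, ?_⟩
    rintro (a | a) (b | b) hab ha hb
    · rw [sum_adj_inl] at hab
      obtain ⟨rfl, rfl⟩ := hp a b hab ha hb
      exact ⟨rfl, rfl⟩
    · simp at hab
    · simp at hab
    · exact absurd ha id
  · simp at huv
  · simp at huv
  · rw [sum_adj_inr] at huv
    obtain ⟨p, hu, hv, hp⟩ := cut_of_acyclic h2.isAcyclic huv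
    refine ⟨Sum.elim (fun _ => False) p, hu, hv, ?_⟩
    rintro (a | a) (b | b) hab ha hb
    · exact absurd ha id
    · simp at hab
    · simp at hab
    · rw [sum_adj_inr] at hab
      obtain ⟨rfl, rfl⟩ := hp a b hab ha hb
      exact ⟨rfl, rfl⟩

theorem path_acyclic (n : ℕ) : (pathGraph n).IsAcyclic := by
  apply acyclic_of_cut
  intro u v huv
  rw [pathGraph_adj] at huv
  rcases huv with e | e
  · refine ⟨fun a => a.1 ≤ u.1, le_refl _, by omega, ?_⟩
    intro a b hab ha hb
    rw [pathGraph_adj] at hab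
    constructor <;> apply Fin.ext <;> omega
  · refine ⟨fun a => u.1 ≤ a.1, le_refl _, by omega, ?_⟩
    intro a b hab ha hb
    rw [pathGraph_adj] at hab
    constructor <;> apply Fin.ext <;> omega

theorem Lk.map {ι κ : Type*} {T1 : SimpleGraph ι} {T2 : SimpleGraph κ} {S : Set ι} {S' : Set κ} {f : ι → κ}
    (hf : ∀ a b, T1.Adj a b → T2.Adj (f a) (f b)) (hS : ∀ a ∈ S, f a ∈ S') {a b : ι} (h : Lk T1 S a b) :
    Lk T2 S' (f a) (f b) := by
  induction h with
  | refl => exact Lk.refl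
  | tail _ hbc ih => exact ih.trans (Lk.step (hf _ _ hbc.1) (hS _ hbc.2.1) (hS _ hbc.2.2))

/-! ### decompositions -/

structure Dc (G : SimpleGraph V) {ι : Type} (T : SimpleGraph ι) (L : ι → Fin 6 → Set V) (A : Set V) : Prop where
  tree : T.IsTree
  l1 : ∀ t i, (L t i ⊆ A ∧ (L t i).Subsingleton) ∨ Ln G A (L t i)
  l2 : ∀ M, Ln G A M → ∃ t i, L t i = M
  l2' : ∀ M, Ln G A M → ∀ t i s j, L t i = M → L s j = M → Lk T {t | ∃ i, L t i = M} t s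
  l3 : ∀ x ∈ A, ∃ t i, x ∈ L t i
  l3' : ∀ x ∈ A, ∀ t i s j, x ∈ L t i → x ∈ L s j → Lk T {t | ∃ i, x ∈ L t i} t s

def Cpl (G : SimpleGraph V) {ι : Type} (L : ι → Fin 6 → Set V) (A : Set V) : Prop :=
  ∀ v x y, Cp G A v x y → ∃ t i j, L t i = ln G v x ∧ L t j = ln G v y

def Dec0 (G : SimpleGraph V) (A : Set V) : Prop :=
  ∃ (ι : Type) (T : SimpleGraph ι) (L : ι → Fin 6 → Set V), Dc G T L A

def Dec (G : SimpleGraph V) (A : Set V) : Prop :=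
  ∃ (ι : Type) (T : SimpleGraph ι) (L : ι → Fin 6 → Set V), Dc G T L A ∧ Cpl G L A

open Classical in
/-- restriction -/
noncomputable def Rs (G : SimpleGraph V) {ι : Type} (L : ι → Fin 6 → Set V) (B0 : Set V) : ι → Fin 6 → Set V :=
  fun t i => if Ln G B0 (L t i) then L t i else L t i ∩ B0

theorem Rs_mem {ι : Type} {L : ι → Fin 6 → Set V} {B0 : Set V} {t : ι} {i : Fin 6} {x : V} (hx : x ∈ B0) :
    x ∈ Rs G L B0 t i ↔ x ∈ L t i := by
  unfold Rs
  split_ifs with h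
  · rfl
  · exact ⟨fun h => h.1, fun h => ⟨h, hx⟩⟩

theorem Rs_dicho {ι : Type} {T : SimpleGraph ι} {L : ι → Fin 6 → Set V} {B B0 : Set V} (hG : InC G)
    (h : Dc G T L B) (hB : B0 ⊆ B) (t i) :
    (Rs G L B0 t i ⊆ B0 ∧ (Rs G L B0 t i).Subsingleton ∧ ¬ Ln G B0 (L t i)) ∨ (Ln G B0 (Rs G L B0 t i) ∧ Rs G L B0 t i = L t i) := by
  unfold Rs
  split_ifs with hL
  · exact Or.inr ⟨hL, rfl⟩
  · refine Or.inl ⟨Set.inter_subset_right, ?_, hL⟩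
    intro a ha b hb
    rcases h.l1 t i with e | e
    · exact e.2 ha.1 hb.1
    · by_contra hab
      exact hL (e.of_two hG ha.1 hb.1 hab ha.2 hb.2)

theorem Rs_eq {ι : Type} {T : SimpleGraph ι} {L : ι → Fin 6 → Set V} {B B0 : Set V} (hG : InC G)
    (h : Dc G T L B) (hB : B0 ⊆ B) {M : Set V} (hM : Ln G B0 M) (t i) : Rs G L B0 t i = M ↔ L t i = M := by
  constructor
  · intro e
    rcases Rs_dicho hG h hB t i with h' | h'
    · rw [e] at h'
      exact absurd h'.2.1 hM.not_sub
    · rw [← h'.2, e]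
  · intro e
    unfold Rs
    rw [e, if_pos hM]

theorem Dc.restrict {ι : Type} {T : SimpleGraph ι} {L : ι → Fin 6 → Set V} {B B0 : Set V} (hG : InC G)
    (h : Dc G T L B) (hB : B0 ⊆ B) : Dc G T (Rs G L B0) B0 where
  tree := h.tree
  l1 := fun t i => by
    rcases Rs_dicho hG h hB t i with e | e
    · exact Or.inl ⟨e.1, e.2.1⟩
    · exact Or.inr e.1
  l2 := fun M hM => by
    obtain ⟨t, i, e⟩ := h.l2 M (hM.mono hB)
    exact ⟨t, i, (Rs_eq hG h hB hM t i).2 e⟩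
  l2' := fun M hM t i s j e e' => by
    refine (h.l2' M (hM.mono hB) t i s j ((Rs_eq hG h hB hM t i).1 e) ((Rs_eq hG h hB hM s j).1 e')).mono ?_
    rintro t ⟨i, e⟩
    exact ⟨i, (Rs_eq hG h hB hM t i).2 e⟩
  l3 := fun x hx => by
    obtain ⟨t, i, e⟩ := h.l3 x (hB hx)
    exact ⟨t, i, (Rs_mem hx).2 e⟩
  l3' := fun x hx t i s j e e' => by
    refine (h.l3' x (hB hx) t i s j ((Rs_mem hx).1 e) ((Rs_mem hx).1 e')).mono ?_
    rintro t ⟨i, e⟩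
    exact ⟨i, (Rs_mem hx).2 e⟩

/-- Linking in a join. -/
theorem Jn_lk {ι κ : Type} {T1 : SimpleGraph ι} {T2 : SimpleGraph κ} {t1 : ι} {t2 : κ} {S : Set (ι ⊕ κ)}
    (h1 : ∀ a b, Sum.inl a ∈ S → Sum.inl b ∈ S → Lk T1 {t | Sum.inl t ∈ S} a b)
    (h2 : ∀ a b, Sum.inr a ∈ S → Sum.inr b ∈ S → Lk T2 {t | Sum.inr t ∈ S} a b)
    (h12 : ∀ a b, Sum.inl a ∈ S → Sum.inr b ∈ S → Sum.inl t1 ∈ S ∧ Sum.inr t2 ∈ S) :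
    ∀ a ∈ S, ∀ b ∈ S, Lk (Jn T1 T2 t1 t2) S a b := by
  have k1 : ∀ a b, Sum.inl a ∈ S → Sum.inl b ∈ S → Lk (Jn T1 T2 t1 t2) S (.inl a) (.inl b) := fun a b ha hb =>
    (h1 a b ha hb).map (f := Sum.inl) (fun a b hab => Or.inl (sum_adj_inl.2 hab)) (fun a ha => ha)
  have k2 : ∀ a b, Sum.inr a ∈ S → Sum.inr b ∈ S → Lk (Jn T1 T2 t1 t2) S (.inr a) (.inr b) := fun a b ha hb =>
    (h2 a b ha hb).map (f := Sum.inr) (fun a b hab => Or.inl (sum_adj_inr.2 hab)) (fun a ha => ha)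
  have k12 : ∀ a b, Sum.inl a ∈ S → Sum.inr b ∈ S → Lk (Jn T1 T2 t1 t2) S (.inl a) (.inr b) := fun a b ha hb => by
    obtain ⟨c1, c2⟩ := h12 a b ha hb
    exact ((k1 a t1 ha c1).trans (Lk.step Jn_edge c1 c2)).trans (k2 t2 b c2 hb)
  rintro (a | a) ha (b | b) hb
  · exact k1 a b ha hb
  · exact k12 a b ha hb
  · exact (k12 b a hb ha).symm
  · exact k2 a b ha hb

set_option maxHeartbeats 1000000 in
theorem Dc.glue {ι κ : Type} {T1 : SimpleGraph ι} {T2 : SimpleGraph κ} {L1 : ι → Fin 6 → Set V}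
    {L2 : κ → Fin 6 → Set V} {A B W : Set V} (d1 : Dc G T1 L1 A) (d2 : Dc G T2 L2 B) (t1 : ι) (t2 : κ)
    (h1 : ∀ M, Ln G A M → Ln G B M → (∃ i, L1 t1 i = M) ∧ ∃ i, L2 t2 i = M)
    (h2 : ∀ x ∈ A, x ∈ B → (∃ i, x ∈ L1 t1 i) ∧ ∃ i, x ∈ L2 t2 i)
    (h3 : ∀ x ∈ W, x ∉ B → ∀ M, Ln G B M → x ∈ M → Ln G A M)
    (h3' : ∀ x ∈ W, x ∉ A → ∀ M, Ln G A M → x ∈ M → Ln G B M)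
    (hA : A ⊆ W) (hB : B ⊆ W) (hW : ∀ x ∈ W, x ∈ A ∨ x ∈ B) (h5 : ∀ M, Ln G W M → Ln G A M ∨ Ln G B M) :
    Dc G (Jn T1 T2 t1 t2) (Sum.elim L1 L2) W where
  tree := Jn_tree d1.tree d2.tree _ _
  l1 := by
    rintro (t | t) i
    · rcases d1.l1 t i with e | e
      · exact Or.inl ⟨e.1.trans hA, e.2⟩
      · exact Or.inr (e.mono hA)
    · rcases d2.l1 t i with e | e
      · exact Or.inl ⟨e.1.trans hB, e.2⟩
      · exact Or.inr (e.mono hB)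
  l2 := by
    intro M hM
    rcases h5 M hM with h | h
    · obtain ⟨t, i, e⟩ := d1.l2 M h
      exact ⟨.inl t, i, e⟩
    · obtain ⟨t, i, e⟩ := d2.l2 M h
      exact ⟨.inr t, i, e⟩
  l2' := by
    intro M hM t i s j e e'
    have f1 : ∀ t i, L1 t i = M → Ln G A M := by
      intro t i e
      rcases d1.l1 t i with h | h
      · rw [e] at h; exact absurd h.2 hM.not_sub
      · rw [e] at h; exact h
    have f2 : ∀ t i, L2 t i = M → Ln G B M := by
      intro t i e
      rcases d2.l1 t i with h | h
      · rw [e] at h; exact absurd h.2 hM.not_sub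
      · rw [e] at h; exact h
    refine Jn_lk (S := {t | ∃ i, Sum.elim L1 L2 t i = M}) ?_ ?_ ?_ t ⟨i, e⟩ s ⟨j, e'⟩
    · rintro a b ⟨i, ha⟩ ⟨j, hb⟩
      exact d1.l2' M (f1 a i ha) a i b j ha hb
    · rintro a b ⟨i, ha⟩ ⟨j, hb⟩
      exact d2.l2' M (f2 a i ha) a i b j ha hb
    · rintro a b ⟨i, ha⟩ ⟨j, hb⟩
      exact h1 M (f1 a i ha) (f2 b j hb)
  l3 := by
    intro x hx
    rcases hW x hx with h | h
    · obtain ⟨t, i, e⟩ := d1.l3 x h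
      exact ⟨.inl t, i, e⟩
    · obtain ⟨t, i, e⟩ := d2.l3 x h
      exact ⟨.inr t, i, e⟩
  l3' := by
    intro x hx t i s j e e'
    refine Jn_lk (S := {t | ∃ i, x ∈ Sum.elim L1 L2 t i}) ?_ ?_ ?_ t ⟨i, e⟩ s ⟨j, e'⟩
    · rintro a b ⟨i, ha⟩ ⟨j, hb⟩
      by_cases hxA : x ∈ A
      · exact d1.l3' x hxA a i b j ha hb
      · have key : ∀ a i, x ∈ L1 a i → Lk T1 {t | ∃ i, x ∈ L1 t i} a t1 := by
          intro a i ha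
          have hl : Ln G A (L1 a i) := by
            rcases d1.l1 a i with h | h
            · exact absurd (h.1 ha) hxA
            · exact h
          obtain ⟨⟨k, hk⟩, _⟩ := h1 _ hl (h3' x hx hxA _ hl ha)
          refine (d1.l2' _ hl a i t1 k rfl hk).mono ?_
          rintro s ⟨j, hj⟩
          exact ⟨j, hj ▸ ha⟩
        exact (key a i ha).trans (key b j hb).symm
    · rintro a b ⟨i, ha⟩ ⟨j, hb⟩
      by_cases hxB : x ∈ B
      · exact d2.l3' x hxB a i b j ha hb
      · have key : ∀ a i, x ∈ L2 a i → Lk T2 {t | ∃ i, x ∈ L2 t i} a t2 := by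
          intro a i ha
          have hl : Ln G B (L2 a i) := by
            rcases d2.l1 a i with h | h
            · exact absurd (h.1 ha) hxB
            · exact h
          obtain ⟨_, k, hk⟩ := h1 _ (h3 x hx hxB _ hl ha) hl
          refine (d2.l2' _ hl a i t2 k rfl hk).mono ?_
          rintro s ⟨j, hj⟩
          exact ⟨j, hj ▸ ha⟩
        exact (key a i ha).trans (key b j hb).symm
    · rintro a b ⟨i, ha⟩ ⟨j, hb⟩
      change x ∈ L1 a i at ha
      change x ∈ L2 b j at hb
      by_cases hxA : x ∈ A
      · by_cases hxB : x ∈ B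
        · exact h2 x hxA hxB
        · have hl : Ln G B (L2 b j) := by
            rcases d2.l1 b j with h | h
            · exact absurd (h.1 hb) hxB
            · exact h
          obtain ⟨⟨k, hk⟩, k', hk'⟩ := h1 _ (h3 x hx hxB _ hl hb) hl
          exact ⟨⟨k, show x ∈ L1 t1 k by rw [hk]; exact hb⟩, k', show x ∈ L2 t2 k' by rw [hk']; exact hb⟩
      · have hl : Ln G A (L1 a i) := by
            rcases d1.l1 a i with h | h
            · exact absurd (h.1 ha) hxA
            · exact h
        obtain ⟨⟨k, hk⟩, k', hk'⟩ := h1 _ hl (h3' x hx hxA _ hl ha)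
        exact ⟨⟨k, show x ∈ L1 t1 k by rw [hk]; exact ha⟩, k', show x ∈ L2 t2 k' by rw [hk']; exact ha⟩

/-- clique base -/
theorem Dec_clq (hG : InC G) {W : Set V} (hW : Clq G W) : Dec G W := by
  have hcp : ∀ v x y, ¬ Cp G W v x y := fun v x y h => h.2.2.2.2.2.1 (hW x h.2.1 y h.2.2.1)
  by_cases hs : W.Subsingleton
  · have hl : ∀ M, ¬ Ln G W M := by
      rintro M ⟨u, hu, v, hv, uv, _⟩
      exact uv.ne (hs hu hv)
    refine ⟨Unit, ⊥, fun _ _ => W, ⟨IsTree.of_subsingleton, fun _ _ => Or.inl ⟨subset_rfl, hs⟩, fun M h => absurd h (hl M),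
      fun M h => absurd h (hl M), fun x hx => ⟨(), 0, hx⟩, fun x hx t i s j _ _ => Lk.refl⟩, fun v x y h => absurd h (hcp v x y)⟩
  · have : ∃ a ∈ W, ∃ b ∈ W, a ≠ b := by
      by_contra hn
      push Not at hn
      exact hs (fun a ha b hb => hn a ha b hb)
    obtain ⟨a, ha, b, hb, hab⟩ := this
    have adj : G.Adj a b := (hW a ha b hb).resolve_left hab
    have hWM : W ⊆ ln G a b := fun z hz => ⟨hW z hz a ha, hW z hz b hb⟩
    refine ⟨Unit, ⊥, fun _ _ => ln G a b, ⟨IsTree.of_subsingleton, fun _ _ => Or.inr ⟨a, ha, b, hb, adj, rfl⟩, ?_,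
      fun _ _ _ _ _ _ _ _ => Lk.refl, fun x hx => ⟨(), 0, hWM hx⟩, fun x hx t i s j _ _ => Lk.refl⟩, fun v x y h => absurd h (hcp v x y)⟩
    rintro M ⟨u, hu, v, hv, uv, rfl⟩
    exact ⟨(), 0, (ln_eq hG adj (hWM hu) (hWM hv) uv.ne).symm⟩

end Part17

section Part18
set_option linter.unusedVariables false
variable {V : Type*} {G : SimpleGraph V} {W : Set V} {u x1 x2 : V} {P : List V} {C : Set V}

theorem Spl.line (hG : InC G) (h : Spl G W u x1 x2 P C) {b b' : V} (hb : b = u ∨ b ∈ Kk G W u x1 x2)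
    (hb' : b' = u ∨ b' ∈ Kk G W u x1 x2) (hbb : G.Adj b b') : ln G b b' = ln G u x1 ∨ ln G b b' = ln G u x2 := by
  have key : ∀ b', b' ∈ Kk G W u x1 x2 → ln G u b' = ln G u x1 ∨ ln G u b' = ln G u x2 := by
    rintro b' ⟨_, ub, e | e⟩
    · exact Or.inl (ln_nr hG h.u1 ub e)
    · exact Or.inr (ln_nr hG h.u2 ub e)
  rcases hb with rfl | hb
  · rcases hb' with rfl | hb'
    · exact absurd hbb (G.loopless.irrefl _)
    · exact key _ hb'
  · rcases hb' with rfl | hb'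
    · rw [ln_comm]; exact key _ hb
    · have : ln G b b' = ln G u b :=
        ln_eq hG hb.2.1 (ln_right hb.2.1) ⟨Or.inr hb'.2.1.symm, Or.inr hbb.symm⟩ hbb.ne
      rw [this]
      exact key _ hb

theorem Spl.Kb (h : Spl G W u x1 x2 P C) {v : V} (hv : v ∈ SB0 G W u x1 x2 C) (hC : v ∉ C) :
    v = u ∨ v ∈ Kk G W u x1 x2 := by
  rcases hv with e | e | e | e | e
  · exact absurd e hC
  · exact Or.inl e
  · exact Or.inr (e ▸ h.k1)
  · exact Or.inr (e ▸ h.k2)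
  · exact Or.inr e.1

theorem adj_of_ln {x b b' : V} (hx : x ∈ ln G b b') (hn : x ≠ b) : G.Adj x b := hx.1.resolve_left hn
theorem adj_of_ln' {x b b' : V} (hx : x ∈ ln G b b') (hn : x ≠ b') : G.Adj x b' := hx.2.resolve_left hn

set_option maxHeartbeats 1000000 in
theorem Spl.dec (hG : InC G) (h : Spl G W u x1 x2 P C) (hA : Dec G (SA G W u x1 x2 C)) (hB : Dec G (SB G W u x1 x2 P C)) :
    Dec G W := by
  obtain ⟨ι, T1, L1, d1, c1⟩ := hA
  obtain ⟨κ, T2, L2, d2', c2⟩ := hB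
  have hsub : SB0 G W u x1 x2 C ⊆ SB G W u x1 x2 P C := fun v hv => Or.inl hv
  have d2 := d2'.restrict hG hsub
  have u0 : u ∈ SB0 G W u x1 x2 C := Or.inr (Or.inl rfl)
  have x10 : x1 ∈ SB0 G W u x1 x2 C := Or.inr (Or.inr (Or.inl rfl))
  have x20 : x2 ∈ SB0 G W u x1 x2 C := Or.inr (Or.inr (Or.inr (Or.inl rfl)))
  obtain ⟨t1, i1, j1, e1, e2⟩ := c1 u x1 x2 (h.CpA hG)
  obtain ⟨t2, i2, j2, f1', f2'⟩ := c2 u x1 x2 (h.CpB hG)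
  have lA1 : Ln G (SA G W u x1 x2 C) (ln G u x1) := ⟨u, h.uA, x1, h.x1A, h.u1, rfl⟩
  have lA2 : Ln G (SA G W u x1 x2 C) (ln G u x2) := ⟨u, h.uA, x2, h.x2A, h.u2, rfl⟩
  have lB1 : Ln G (SB0 G W u x1 x2 C) (ln G u x1) := ⟨u, u0, x1, x10, h.u1, rfl⟩
  have lB2 : Ln G (SB0 G W u x1 x2 C) (ln G u x2) := ⟨u, u0, x2, x20, h.u2, rfl⟩
  have f1 := (Rs_eq hG d2' hsub lB1 t2 i2).2 f1'
  have f2 := (Rs_eq hG d2' hsub lB2 t2 j2).2 f2'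
  -- lines on the boundary
  have bdA : ∀ b b', (b = u ∨ b ∈ Kk G W u x1 x2) → (b' = u ∨ b' ∈ Kk G W u x1 x2) → G.Adj b b' →
      Ln G (SA G W u x1 x2 C) (ln G b b') := by
    intro b b' hb hb' hbb
    rcases h.line hG hb hb' hbb with e | e <;> rw [e] <;> assumption
  have bdB : ∀ b b', (b = u ∨ b ∈ Kk G W u x1 x2) → (b' = u ∨ b' ∈ Kk G W u x1 x2) → G.Adj b b' →
      Ln G (SB0 G W u x1 x2 C) (ln G b b') := by
    intro b b' hb hb' hbb
    rcases h.line hG hb hb' hbb with e | e <;> rw [e] <;> assumption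
  have nb : ∀ x ∈ W, x ∉ SA G W u x1 x2 C → ∀ a ∈ W, a ∉ C → G.Adj x a → a = u ∨ a ∈ Kk G W u x1 x2 := by
    intro x hx hxA a ha haC hxa
    by_cases hxC : x ∈ C
    · exact h.bd x hxC a ha haC hxa
    · have hJ : x ∈ SJ G W u x1 x2 C := by by_contra hJ; exact hxA ⟨hx, hxC, hJ⟩
      rcases hJ.2 a ha haC hxa with e | e
      · exact Or.inl e.symm
      · exact Or.inr (Kk_nr hG h hJ.1 e ha hxa)
  refine ⟨_, _, _, Dc.glue (W := W) d1 d2 t1 t2 ?_ ?_ ?_ ?_ Spl.SAW h.SB0W ?_ ?_, ?_⟩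
  · intro M hMA hMB
    have hM : M = ln G u x1 ∨ M = ln G u x2 := by
      obtain ⟨a, ha, a', ha', haa, hMa⟩ := hMA
      obtain ⟨b, hb, b', hb', hbb, hMb⟩ := hMB
      have haM : a ∈ ln G b b' := by rw [← hMb, hMa]; exact ln_left haa
      have haM' : a' ∈ ln G b b' := by rw [← hMb, hMa]; exact ln_right haa
      by_cases hbC : b ∈ C
      · rw [hMa]
        have na : a ≠ b := fun e => ha.2.1 (e ▸ hbC)
        have na' : a' ≠ b := fun e => ha'.2.1 (e ▸ hbC)
        exact h.line hG (h.bd b hbC a ha.1 ha.2.1 (adj_of_ln haM na).symm)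
          (h.bd b hbC a' ha'.1 ha'.2.1 (adj_of_ln haM' na').symm) haa
      by_cases hbC' : b' ∈ C
      · rw [hMa]
        have na : a ≠ b' := fun e => ha.2.1 (e ▸ hbC')
        have na' : a' ≠ b' := fun e => ha'.2.1 (e ▸ hbC')
        exact h.line hG (h.bd b' hbC' a ha.1 ha.2.1 (adj_of_ln' haM na).symm)
          (h.bd b' hbC' a' ha'.1 ha'.2.1 (adj_of_ln' haM' na').symm) haa
      · rw [hMb]
        exact h.line hG (h.Kb hb hbC) (h.Kb hb' hbC') hbb
    rcases hM with rfl | rfl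
    · exact ⟨⟨_, e1⟩, _, f1⟩
    · exact ⟨⟨_, e2⟩, _, f2⟩
  · intro x hxA hxB
    have hx : x ∈ ln G u x1 ∨ x ∈ ln G u x2 := by
      rcases h.Kb hxB hxA.2.1 with rfl | e
      · exact Or.inl (ln_left h.u1)
      · rcases e.2.2 with e' | e'
        · exact Or.inl ⟨Or.inr e.2.1.symm, e'⟩
        · exact Or.inr ⟨Or.inr e.2.1.symm, e'⟩
    rcases hx with hx | hx
    · exact ⟨⟨i1, by rw [e1]; exact hx⟩, i2, by rw [f1]; exact hx⟩
    · exact ⟨⟨j1, by rw [e2]; exact hx⟩, j2, by rw [f2]; exact hx⟩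
  · rintro x hx hxB M ⟨b, hb, b', hb', hbb, rfl⟩ hxM
    have na : x ≠ b := fun e => hxB (e ▸ hb)
    have na' : x ≠ b' := fun e => hxB (e ▸ hb')
    have hbC : b ∉ C := fun hc => hxB (h.CSB0 b hc x hx (adj_of_ln hxM na).symm)
    have hbC' : b' ∉ C := fun hc => hxB (h.CSB0 b' hc x hx (adj_of_ln' hxM na').symm)
    exact bdA b b' (h.Kb hb hbC) (h.Kb hb' hbC') hbb
  · rintro x hx hxA M ⟨a, ha, a', ha', haa, rfl⟩ hxM
    have na : x ≠ a := fun e => hxA (e ▸ ha)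
    have na' : x ≠ a' := fun e => hxA (e ▸ ha')
    exact bdB a a' (nb x hx hxA a ha.1 ha.2.1 (adj_of_ln hxM na)) (nb x hx hxA a' ha'.1 ha'.2.1 (adj_of_ln' hxM na')) haa
  · intro x hx
    by_cases hA : x ∈ SA G W u x1 x2 C
    · exact Or.inl hA
    · exact Or.inr (h.cover hG hx hA)
  · have key : ∀ v ∈ W, ∀ w ∈ W, G.Adj v w → v ∉ SA G W u x1 x2 C →
        Ln G (SA G W u x1 x2 C) (ln G v w) ∨ Ln G (SB0 G W u x1 x2 C) (ln G v w) := by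
      intro v hv w hw vw hvA
      by_cases hwC : w ∈ C
      · exact Or.inr ⟨v, h.cover hG hv hvA, w, Or.inl hwC, vw, rfl⟩
      by_cases hvC : v ∈ C
      · exact Or.inr ⟨v, Or.inl hvC, w, h.CSB0 v hvC w hw vw, vw, rfl⟩
      · exact Or.inr (bdB v w (h.Kb (h.cover hG hv hvA) hvC) (nb v hv hvA w hw hwC vw) vw)
    rintro M ⟨v, hv, w, hw, vw, rfl⟩
    by_cases hvA : v ∈ SA G W u x1 x2 C
    · by_cases hwA : w ∈ SA G W u x1 x2 C
      · exact Or.inl ⟨v, hvA, w, hwA, vw, rfl⟩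
      · rw [ln_comm]; exact key w hw v hv vw.symm hwA
    · exact key v hv w hw vw hvA
  · intro v x y hc
    rcases h.inherit hG hc with ⟨x', y', nx, ny, hc'⟩ | ⟨hv, x', hx', y', hy', nx, ny, hc'⟩
    · obtain ⟨t, i, j, ei, ej⟩ := c1 v x' y' hc'
      refine ⟨.inl t, i, j, ?_, ?_⟩
      · rw [← ln_nr hG hc.2.2.2.1 hc'.2.2.2.1 nx]; exact ei
      · rw [← ln_nr hG hc.2.2.2.2.1 hc'.2.2.2.2.1 ny]; exact ej
    · obtain ⟨t, i, j, ei, ej⟩ := c2 v x' y' hc'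
      refine ⟨.inr t, i, j, ?_, ?_⟩
      · rw [← ln_nr hG hc.2.2.2.1 hc'.2.2.2.1 nx]
        exact (Rs_eq hG d2' hsub ⟨v, hv, x', hx', hc'.2.2.2.1, rfl⟩ t i).2 ei
      · rw [← ln_nr hG hc.2.2.2.2.1 hc'.2.2.2.2.1 ny]
        exact (Rs_eq hG d2' hsub ⟨v, hv, y', hy', hc'.2.2.2.2.1, rfl⟩ t j).2 ej

set_option maxHeartbeats 1000000 in
/-- gluing along a clique cutset -/
theorem Dec0_cut (hG : InC G) {Z S : Set V} (hZW : Z ⊆ W) (hZ : Clq G Z) (hSW : S ⊆ W) (hSZ : ∀ x ∈ S, x ∉ Z)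
    (hS : ∀ x ∈ S, ∀ y ∈ W, G.Adj x y → y ∈ S ∨ y ∈ Z) (hA : Dec0 G (Z ∪ S)) (hB : Dec0 G (W \ S)) : Dec0 G W := by
  obtain ⟨ι, T1, L1, d1⟩ := hA
  obtain ⟨κ, T2, L2, d2⟩ := hB
  have ZA : Z ⊆ Z ∪ S := Set.subset_union_left
  have ZB : Z ⊆ W \ S := fun z hz => ⟨hZW hz, fun hs => hSZ z hs hz⟩
  have common : ∀ M, Ln G (Z ∪ S) M → Ln G (W \ S) M → Ln G Z M := by
    rintro M ⟨a, ha, a', ha', haa, hMa⟩ ⟨b, hb, b', hb', hbb, hMb⟩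
    have haM : a ∈ ln G b b' := by rw [← hMb, hMa]; exact ln_left haa
    have haM' : a' ∈ ln G b b' := by rw [← hMb, hMa]; exact ln_right haa
    have key : ∀ a ∈ Z ∪ S, ∀ b ∈ W \ S, b ∉ Z → Nr G a b → a ∈ Z := by
      intro a ha b hb hbZ hn
      rcases ha with ha | ha
      · exact ha
      · rcases hn with e | e
        · exact absurd (e ▸ ha) hb.2
        · rcases hS a ha b hb.1 e with e | e
          · exact absurd e hb.2
          · exact absurd e hbZ
    by_cases hbZ : b ∈ Z
    · by_cases hbZ' : b' ∈ Z
      · exact ⟨b, hbZ, b', hbZ', hbb, hMb⟩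
      · exact ⟨a, key a ha b' hb' hbZ' haM.2, a', key a' ha' b' hb' hbZ' haM'.2, haa, hMa⟩
    · exact ⟨a, key a ha b hb hbZ haM.1, a', key a' ha' b hb hbZ haM'.1, haa, hMa⟩
  have hN : ∃ t1 t2, (∀ M, Ln G Z M → (∃ i, L1 t1 i = M) ∧ ∃ i, L2 t2 i = M) ∧
      ∀ x ∈ Z, (∃ i, x ∈ L1 t1 i) ∧ ∃ i, x ∈ L2 t2 i := by
    by_cases hl : ∃ M, Ln G Z M
    · obtain ⟨M, hM⟩ := hl
      have hZM := hM.sub_clq hZ subset_rfl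
      obtain ⟨t1, i, e1⟩ := d1.l2 M (hM.mono ZA)
      obtain ⟨t2, j, e2⟩ := d2.l2 M (hM.mono ZB)
      refine ⟨t1, t2, ?_, fun x hx => ⟨⟨i, e1 ▸ hZM hx⟩, j, e2 ▸ hZM hx⟩⟩
      rintro M' ⟨a, ha, b, hb, hab, rfl⟩
      obtain ⟨c, hc, d, hd, hcd, rfl⟩ := hM
      have e := ln_eq hG hcd (hZM ha) (hZM hb) hab.ne
      exact ⟨⟨i, by rw [e1, e]⟩, j, by rw [e2, e]⟩
    · have hs : Z.Subsingleton := by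
        intro a ha b hb
        by_contra hab
        exact hl ⟨_, a, ha, b, hb, (hZ a ha b hb).resolve_left hab, rfl⟩
      by_cases hne : Z.Nonempty
      · obtain ⟨z, hz⟩ := hne
        obtain ⟨t1, i, e1⟩ := d1.l3 z (ZA hz)
        obtain ⟨t2, j, e2⟩ := d2.l3 z (ZB hz)
        refine ⟨t1, t2, fun M hM => absurd ⟨M, hM⟩ hl, fun x hx => ?_⟩
        rw [hs hx hz]
        exact ⟨⟨i, e1⟩, j, e2⟩
      · obtain ⟨t1⟩ := d1.tree.connected.nonempty
        obtain ⟨t2⟩ := d2.tree.connected.nonempty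
        exact ⟨t1, t2, fun M hM => absurd ⟨M, hM⟩ hl, fun x hx => absurd ⟨x, hx⟩ hne⟩
  obtain ⟨t1, t2, g1, g2⟩ := hN
  refine ⟨_, _, _, Dc.glue (W := W) d1 d2 t1 t2 ?_ ?_ ?_ ?_ ?_ ?_ ?_ ?_⟩
  · exact fun M h1 h2 => g1 M (common M h1 h2)
  · intro x hxA hxB
    rcases hxA with h | h
    · exact g2 x h
    · exact absurd h hxB.2
  · rintro x hx hxB M ⟨b, hb, b', hb', hbb, rfl⟩ hxM
    have hxS : x ∈ S := by by_contra hxS; exact hxB ⟨hx, hxS⟩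
    have na : x ≠ b := fun e => hxB (e ▸ hb)
    have na' : x ≠ b' := fun e => hxB (e ▸ hb')
    exact ⟨b, Or.inl ((hS x hxS b hb.1 (adj_of_ln hxM na)).resolve_left hb.2), b',
      Or.inl ((hS x hxS b' hb'.1 (adj_of_ln' hxM na')).resolve_left hb'.2), hbb, rfl⟩
  · rintro x hx hxA M ⟨a, ha, a', ha', haa, rfl⟩ hxM
    have na : x ≠ a := fun e => hxA (e ▸ ha)
    have na' : x ≠ a' := fun e => hxA (e ▸ ha')
    have key : ∀ a ∈ Z ∪ S, G.Adj x a → a ∈ W \ S := by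
      intro a ha hxa
      rcases ha with h | h
      · exact ZB h
      · rcases hS a h x hx hxa.symm with e | e
        · exact absurd (Or.inr e) hxA
        · exact absurd (Or.inl e) hxA
    exact ⟨a, key a ha (adj_of_ln hxM na), a', key a' ha' (adj_of_ln' hxM na'), haa, rfl⟩
  · exact Set.union_subset hZW hSW
  · exact Set.diff_subset
  · intro x hx
    by_cases h : x ∈ S
    · exact Or.inl (Or.inr h)
    · exact Or.inr ⟨hx, h⟩
  · rintro M ⟨v, hv, w, hw, vw, rfl⟩
    by_cases h : v ∈ S
    · exact Or.inl ⟨v, Or.inr h, w, (hS v h w hw vw).symm, vw, rfl⟩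
    by_cases h' : w ∈ S
    · exact Or.inl ⟨v, (hS w h' v hv vw.symm).symm, w, Or.inr h', vw, rfl⟩
    · exact Or.inr ⟨v, ⟨hv, h⟩, w, ⟨hw, h'⟩, vw, rfl⟩

end Part18

section Part19
set_option linter.unusedVariables false
variable {V : Type*} {G : SimpleGraph V} {W : Set V}

theorem path_lk {N : ℕ} {S : Set (Fin N)} : ∀ (d : ℕ) (a b : Fin N), b.1 = a.1 + d →
    (∀ c : Fin N, a.1 ≤ c.1 → c.1 ≤ b.1 → c ∈ S) → Lk (pathGraph N) S a b := by
  intro d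
  induction d with
  | zero => intro a b e _; have : a = b := Fin.ext (by omega); subst this; exact Lk.refl
  | succ d ih =>
    intro a b e hS
    let b' : Fin N := ⟨a.1 + d, by omega⟩
    have hb' : b'.1 = a.1 + d := rfl
    refine (ih a b' rfl (fun c h1 h2 => hS c h1 (by omega))).trans (Lk.step ?_ (hS _ (by omega) (by omega)) (hS _ (by omega) (by omega)))
    rw [pathGraph_adj]; omega

theorem path_lk_univ {N : ℕ} {S : Set (Fin N)} (hS : ∀ c, c ∈ S) (a b : Fin N) : Lk (pathGraph N) S a b := by
  rcases le_total a.1 b.1 with h | h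
  · exact path_lk (b.1 - a.1) a b (by omega) (fun c _ _ => hS c)
  · exact (path_lk (a.1 - b.1) b a (by omega) (fun c _ _ => hS c)).symm

theorem Ln.at (hG : InC G) {M : Set V} (h : Ln G W M) {x : V} (hx : x ∈ M) : ∃ w ∈ W, G.Adj x w ∧ M = ln G x w := by
  obtain ⟨a, ha, b, hb, hab, rfl⟩ := h
  by_cases hxa : x = a
  · subst hxa; exact ⟨b, hb, hab, rfl⟩
  · exact ⟨a, ha, adj_of_ln hx hxa, (ln_eq hG hab hx (ln_left hab) hxa).symm⟩

def pl (c0 c1 : Set V) (e f : ℕ → Set V) (N : ℕ) : Fin (N + 1) → Fin 6 → Set V :=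
  fun t => ![c0, c1, e t.1, e (t.1 + 1), f t.1, f (t.1 + 1)]

theorem pl_iff {c0 c1 : Set V} {e f : ℕ → Set V} {N : ℕ} {t : Fin (N + 1)} {M : Set V} :
    (∃ i, pl c0 c1 e f N t i = M) ↔
      c0 = M ∨ c1 = M ∨ e t.1 = M ∨ e (t.1 + 1) = M ∨ f t.1 = M ∨ f (t.1 + 1) = M := by
  simp [pl, Fin.exists_fin_succ]

set_option maxHeartbeats 1000000 in
/-- abstract path decomposition; nodes `0..N`, indices `0..N+1` -/
theorem Dc_path (hG : InC G) {c0 c1 : Set V} {e f : ℕ → Set V} {N : ℕ} (a0 : Ln G W c0) (a1 : Ln G W c1)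
    (ae : ∀ j ≤ N + 1, Ln G W (e j)) (af : ∀ j ≤ N + 1, Ln G W (f j))
    (hb : ∀ M, Ln G W M → c0 = M ∨ c1 = M ∨ ∃ j ≤ N + 1, e j = M ∨ f j = M)
    (hc : ∀ M, c0 ≠ M → c1 ≠ M → ∀ i j k, i ≤ j → j ≤ k → k ≤ N + 1 → (e i = M ∨ f i = M) → (e k = M ∨ f k = M) →
      (e j = M ∨ f j = M))
    (hd : ∀ x ∈ W, (∃ M, Ln G W M ∧ x ∈ M) ∧ (x ∈ c0 ∨ x ∈ c1 ∨ ∃ t, ∀ M, Ln G W M → x ∈ M → ∃ i, pl c0 c1 e f N t i = M)) :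
    Dc G (pathGraph (N + 1)) (pl c0 c1 e f N) W := by
  have l1 : ∀ t i, Ln G W (pl c0 c1 e f N t i) := by
    intro t i
    have := (pl_iff (M := pl c0 c1 e f N t i)).1 ⟨i, rfl⟩
    rcases this with h | h | h | h | h | h <;> rw [← h]
    · exact a0
    · exact a1
    · exact ae _ (by omega)
    · exact ae _ (by omega)
    · exact af _ (by omega)
    · exact af _ (by omega)
  have l2 : ∀ M, Ln G W M → ∃ t i, pl c0 c1 e f N t i = M := by
    intro M hM
    rcases hb M hM with h | h | ⟨j, hj, h⟩
    · exact ⟨0, pl_iff.2 (Or.inl h)⟩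
    · exact ⟨0, pl_iff.2 (Or.inr (Or.inl h))⟩
    · by_cases hjN : j = N + 1
      · refine ⟨⟨N, by omega⟩, pl_iff.2 ?_⟩
        subst hjN
        rcases h with h | h <;> simp [h]
      · refine ⟨⟨j, by omega⟩, pl_iff.2 ?_⟩
        rcases h with h | h <;> simp [h]
  have l2w : ∀ M, Ln G W M → ∀ t s : Fin (N+1), t.1 ≤ s.1 → (∃ i, pl c0 c1 e f N t i = M) → (∃ i, pl c0 c1 e f N s i = M) →
      Lk (pathGraph (N + 1)) {t | ∃ i, pl c0 c1 e f N t i = M} t s := by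
    intro M hM t s hts ht hs
    by_cases h0 : c0 = M
    · exact path_lk_univ (fun c => pl_iff.2 (Or.inl h0)) t s
    by_cases h1 : c1 = M
    · exact path_lk_univ (fun c => pl_iff.2 (Or.inr (Or.inl h1))) t s
    refine path_lk (s.1 - t.1) t s (by omega) ?_
    intro c h1c h2c
    by_cases e1 : c = t
    · subst e1; exact ht
    by_cases e2 : c = s
    · subst e2; exact hs
    have e1' : c.1 ≠ t.1 := fun h => e1 (Fin.ext h)
    have e2' : c.1 ≠ s.1 := fun h => e2 (Fin.ext h)
    have ht' : ∃ a, a ≤ c.1 ∧ (e a = M ∨ f a = M) := by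
      rcases pl_iff.1 ht with h | h | h | h | h | h
      · exact absurd h h0
      · exact absurd h h1
      · exact ⟨t.1, by omega, Or.inl h⟩
      · exact ⟨t.1 + 1, by omega, Or.inl h⟩
      · exact ⟨t.1, by omega, Or.inr h⟩
      · exact ⟨t.1 + 1, by omega, Or.inr h⟩
    have hs' : ∃ a, c.1 ≤ a ∧ a ≤ N + 1 ∧ (e a = M ∨ f a = M) := by
      rcases pl_iff.1 hs with h | h | h | h | h | h
      · exact absurd h h0
      · exact absurd h h1
      · exact ⟨s.1, by omega, by omega, Or.inl h⟩
      · exact ⟨s.1 + 1, by omega, by omega, Or.inl h⟩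
      · exact ⟨s.1, by omega, by omega, Or.inr h⟩
      · exact ⟨s.1 + 1, by omega, by omega, Or.inr h⟩
    obtain ⟨a, ha, ha'⟩ := ht'
    obtain ⟨b, hb, hb', hb''⟩ := hs'
    have := hc M h0 h1 a c.1 b ha hb hb' ha' hb''
    refine pl_iff.2 ?_
    rcases this with h | h <;> simp [h]
  have l2' : ∀ M, Ln G W M → ∀ t s : Fin (N+1), (∃ i, pl c0 c1 e f N t i = M) → (∃ i, pl c0 c1 e f N s i = M) →
      Lk (pathGraph (N + 1)) {t | ∃ i, pl c0 c1 e f N t i = M} t s := by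
    intro M hM t s ht hs
    rcases le_total t.1 s.1 with h | h
    · exact l2w M hM t s h ht hs
    · exact (l2w M hM s t h hs ht).symm
  refine ⟨⟨pathGraph_connected N, path_acyclic _⟩, fun t i => Or.inr (l1 t i), l2, ?_, ?_, ?_⟩
  · exact fun M hM t i s j h h' => l2' M hM t s ⟨i, h⟩ ⟨j, h'⟩
  · intro x hx
    obtain ⟨⟨M, hM, hxM⟩, _⟩ := hd x hx
    obtain ⟨t, i, h⟩ := l2 M hM
    exact ⟨t, i, h ▸ hxM⟩
  · intro x hx t i s j ht hs
    rcases (hd x hx).2 with h | h | ⟨t0, h⟩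
    · exact path_lk_univ (fun c => by obtain ⟨k, hk⟩ := (pl_iff (t := c)).2 (Or.inl rfl); exact ⟨k, by rw [hk]; exact h⟩) t s
    · exact path_lk_univ (fun c => by obtain ⟨k, hk⟩ := (pl_iff (t := c)).2 (Or.inr (Or.inl rfl)); exact ⟨k, by rw [hk]; exact h⟩) t s
    · have key : ∀ t i, x ∈ pl c0 c1 e f N t i → Lk (pathGraph (N + 1)) {t | ∃ i, x ∈ pl c0 c1 e f N t i} t t0 := by
        intro t i ht
        refine (l2' _ (l1 t i) t t0 ⟨i, rfl⟩ (h _ (l1 t i) ht)).mono ?_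
        rintro s ⟨j, hj⟩
        exact ⟨j, by rw [hj]; exact ht⟩
      exact (key t i ht).trans (key s j hs).symm

/-- an indexed ring of length `N + 1` -/
structure Rg (G : SimpleGraph V) (h : ℕ → V) (N : ℕ) : Prop where
  N3 : 3 ≤ N
  wrap : h (N + 1) = h 0
  inj : ∀ i ≤ N, ∀ j ≤ N, h i = h j → i = j
  adj : ∀ i ≤ N, ∀ j ≤ N, G.Adj (h i) (h j) ↔ (j = i + 1 ∨ i = j + 1 ∨ (i = 0 ∧ j = N) ∨ (i = N ∧ j = 0))

theorem Rg_exists {l : List V} (hl : HL G l) {a : V} (ha : a ∈ l) :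
    ∃ h N, Rg G h N ∧ h 0 = a ∧ ∀ x, x ∈ l ↔ ∃ i ≤ N, h i = x := by
  obtain ⟨l', h', hp⟩ := hl.rotTo ha
  have hlen := h'.length
  have hnd := h'.nodup
  set m := a :: l' with hm
  refine ⟨fun i => if hi : i < m.length then m[i] else a, m.length - 1, ?_, ?_, ?_⟩
  · have pos : 0 < m.length := by omega
    have key : ∀ i, ∀ hi : i ≤ m.length - 1, (if hi : i < m.length then m[i] else a) = m[i]'(by omega) := by
      intro i hi; rw [dif_pos]
    refine ⟨by omega, ?_, ?_, ?_⟩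
    · rw [dif_neg (by omega), dif_pos pos]
      simp [hm]
    · intro i hi j hj e
      simp only [key i hi, key j hj] at e
      exact (List.Nodup.getElem_inj_iff hnd).1 e
    · intro i hi j hj
      simp only [key i hi, key j hj]
      rcases lt_trichotomy i j with hij | rfl | hij
      · rw [h'.getElem hij (by omega)]; omega
      · simp; omega
      · rw [G.adj_comm, h'.getElem hij (by omega)]; omega
  · simp [hm]
  · intro x
    rw [← hp.mem_iff, List.mem_iff_getElem]
    constructor
    · rintro ⟨i, hi, e⟩
      exact ⟨i, by omega, by simp only; rw [dif_pos hi]; exact e⟩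
    · rintro ⟨i, hi, e⟩
      have hi' : i < m.length := by omega
      simp only at e
      rw [dif_pos hi'] at e
      exact ⟨i, hi', e⟩

variable {h : ℕ → V} {N : ℕ}

theorem Rg.adj1 (r : Rg G h N) {i : ℕ} (hi : i ≤ N) : G.Adj (h i) (h (i + 1)) := by
  by_cases e : i = N
  · subst e; rw [r.wrap, r.adj i le_rfl 0 (by omega)]; omega
  · rw [r.adj i hi (i + 1) (by omega)]; omega

theorem Rg.mem_e (r : Rg G h N) {i k : ℕ} (hi : i ≤ N) (hk : k ≤ N) (hm : h k ∈ ln G (h i) (h (i + 1))) :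
    k = i ∨ k = i + 1 ∨ (i = N ∧ k = 0) := by
  have h3 := r.N3
  have nr : ∀ a ≤ N, ∀ b ≤ N, Nr G (h a) (h b) → a = b ∨ (b = a + 1 ∨ a = b + 1 ∨ (a = 0 ∧ b = N) ∨ (a = N ∧ b = 0)) := by
    intro a ha b hb hn
    rcases hn with e | e
    · exact Or.inl (r.inj a ha b hb e)
    · exact Or.inr ((r.adj a ha b hb).1 e)
  have h1 := nr k hk i hi hm.1
  by_cases e : i = N
  · have h2 := hm.2
    rw [e, r.wrap] at h2
    have := nr k hk 0 (by omega) h2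
    omega
  · have := nr k hk (i + 1) (by omega) hm.2
    omega

theorem Rg.e_inj (r : Rg G h N) {i k : ℕ} (hi : i ≤ N) (hk : k ≤ N)
    (he : ln G (h i) (h (i + 1)) = ln G (h k) (h (k + 1))) : i = k := by
  have h3 := r.N3
  have m1 : h i ∈ ln G (h k) (h (k + 1)) := he ▸ ln_left (r.adj1 hi)
  have m2 : h (i + 1) ∈ ln G (h k) (h (k + 1)) := he ▸ ln_right (r.adj1 hi)
  have := r.mem_e hk hi m1
  by_cases e : i = N
  · rw [e, r.wrap] at m2
    have := r.mem_e hk (by omega) m2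
    omega
  · have := r.mem_e hk (by omega) m2
    omega

/-- neighbours on the ring give `e`-lines -/
theorem Rg.nbr (r : Rg G h N) {j k : ℕ} (hj : j ≤ N) (hk : k ≤ N) (ha : G.Adj (h j) (h k)) :
    (ln G (h j) (h k) = ln G (h j) (h (j + 1))) ∨
    (1 ≤ j ∧ ln G (h j) (h k) = ln G (h (j - 1)) (h (j - 1 + 1))) ∨ (j = 0 ∧ ln G (h j) (h k) = ln G (h N) (h (N + 1))) := by
  rcases (r.adj j hj k hk).1 ha with e | e | ⟨e, e'⟩ | ⟨e, e'⟩
  · left; rw [e]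
  · right; left
    refine ⟨by omega, ?_⟩
    subst e
    rw [Nat.add_sub_cancel, ln_comm]
  · right; right
    refine ⟨e, ?_⟩
    rw [r.wrap, e, e', ln_comm]
  · left; subst e; rw [r.wrap, e']

set_option maxHeartbeats 1000000 in
theorem Rg.dec (hG : InC G) (r : Rg G h N) (hW : ∀ x, x ∈ W ↔ ∃ i ≤ N, h i = x) : Dec G W := by
  obtain ⟨n, rfl⟩ : ∃ n, N = n + 1 := ⟨N - 1, by have := r.N3; omega⟩
  have h3 := r.N3
  have hm : ∀ i ≤ n + 1 + 1, h i ∈ W := by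
    intro i hi
    by_cases e : i = n + 1 + 1
    · rw [e, r.wrap]; exact (hW _).2 ⟨0, by omega, rfl⟩
    · exact (hW _).2 ⟨i, by omega, rfl⟩
  have le : ∀ j ≤ n + 1, Ln G W (ln G (h j) (h (j + 1))) := fun j hj => ⟨_, hm j (by omega), _, hm (j + 1) (by omega), r.adj1 hj, rfl⟩
  let e : ℕ → Set V := fun j => ln G (h j) (h (j + 1))
  let c0 := e (n + 1)
  have lines : ∀ j ≤ n + 1, ∃ t : Fin (n + 1), ∀ w ∈ W, G.Adj (h j) w → ∃ i, pl c0 c0 e (fun _ => c0) n t i = ln G (h j) w := by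
    intro j hj
    refine ⟨⟨j - 1, by omega⟩, ?_⟩
    intro w hw ha
    obtain ⟨k, hk, rfl⟩ := (hW w).1 hw
    rw [pl_iff]
    rcases r.nbr hj hk ha with q | ⟨q', q⟩ | ⟨q', q⟩
    · rw [q]
      by_cases j0 : j = 0
      · subst j0; exact Or.inr (Or.inr (Or.inl rfl))
      · refine Or.inr (Or.inr (Or.inr (Or.inl ?_)))
        simp only [e]
        rw [Nat.sub_add_cancel (by omega)]
    · rw [q]; exact Or.inr (Or.inr (Or.inl rfl))
    · rw [q]; exact Or.inl rfl
  refine ⟨_, _, pl c0 c0 e (fun _ => c0) n, Dc_path hG (le _ le_rfl) (le _ le_rfl) le (fun j _ => le _ le_rfl) ?_ ?_ ?_, ?_⟩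
  · rintro M ⟨a, ha, b, hb, hab, rfl⟩
    obtain ⟨j, hj, rfl⟩ := (hW a).1 ha
    obtain ⟨k, hk, rfl⟩ := (hW b).1 hb
    rcases r.nbr hj hk hab with q | ⟨q', q⟩ | ⟨q', q⟩ <;> rw [q]
    · exact Or.inr (Or.inr ⟨j, hj, Or.inl rfl⟩)
    · exact Or.inr (Or.inr ⟨j - 1, by omega, Or.inl rfl⟩)
    · exact Or.inl rfl
  · intro M h0 _ i j k hij hjk hk hi' hk'
    have hi := hi'.resolve_right h0
    have hkk := hk'.resolve_right h0
    have : i = k := r.e_inj (by omega) hk (hi.trans hkk.symm)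
    have : j = i := by omega
    subst this
    exact hi'
  · intro x hx
    obtain ⟨j, hj, rfl⟩ := (hW x).1 hx
    refine ⟨⟨_, le j hj, ln_left (r.adj1 hj)⟩, Or.inr (Or.inr ?_)⟩
    obtain ⟨t, ht⟩ := lines j hj
    refine ⟨t, ?_⟩
    intro M hM hxM
    obtain ⟨w, hw, ha, rfl⟩ := hM.at hG hxM
    exact ht w hw ha
  · intro v x y hc
    obtain ⟨j, hj, rfl⟩ := (hW v).1 hc.1
    obtain ⟨t, ht⟩ := lines j hj
    obtain ⟨i, hi⟩ := ht x hc.2.1 hc.2.2.2.1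
    obtain ⟨i', hi'⟩ := ht y hc.2.2.1 hc.2.2.2.2.1
    exact ⟨t, i, i', hi, hi'⟩

end Part19

section Part20
set_option linter.unusedVariables false
variable {V : Type*} {G : SimpleGraph V} {W : Set V} {h : ℕ → V} {N : ℕ}

open Classical in
/-- the last spoke index up to `j` -/
noncomputable def lst (G : SimpleGraph V) (h : ℕ → V) (u : V) (j : ℕ) : ℕ :=
  Nat.findGreatest (fun i => G.Adj u (h i)) j

theorem lst_le {u : V} {j : ℕ} : lst G h u j ≤ j := by
  classical
  exact Nat.findGreatest_le (P := fun i => G.Adj u (h i)) j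
theorem lst_sp {u : V} (h0 : G.Adj u (h 0)) (j : ℕ) : G.Adj u (h (lst G h u j)) := by
  classical
  exact Nat.findGreatest_spec (P := fun i => G.Adj u (h i)) (Nat.zero_le j) h0
theorem lst_ge {u : V} {i j : ℕ} (hij : i ≤ j) (hi : G.Adj u (h i)) : i ≤ lst G h u j := by
  classical
  exact Nat.le_findGreatest (P := fun i => G.Adj u (h i)) hij hi
theorem lst_self {u : V} {j : ℕ} (hj : G.Adj u (h j)) : lst G h u j = j := le_antisymm lst_le (lst_ge le_rfl hj)
theorem lst_mono {u : V} (h0 : G.Adj u (h 0)) {i j : ℕ} (hij : i ≤ j) : lst G h u i ≤ lst G h u j :=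
  lst_ge (lst_le.trans hij) (lst_sp h0 i)
theorem lst_succ {u : V} (h0 : G.Adj u (h 0)) {j : ℕ} (hj : ¬ G.Adj u (h (j + 1))) :
    lst G h u (j + 1) = lst G h u j := by
  refine le_antisymm ?_ (lst_mono h0 (by omega))
  refine lst_ge ?_ (lst_sp h0 _)
  have : lst G h u (j + 1) ≤ j + 1 := lst_le
  have : lst G h u (j + 1) ≠ j + 1 := fun e => hj (by have := lst_sp h0 (j + 1); rwa [e] at this)
  omega

set_option maxHeartbeats 2000000 in
theorem Rg.decW (hG : InC G) (r : Rg G h N) {u : V} (hu : ∀ i ≤ N, h i ≠ u) (h0 : G.Adj u (h 0))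
    (hW : ∀ x, x ∈ W ↔ x = u ∨ ∃ i ≤ N, h i = x) : Dec G W := by
  obtain ⟨n, rfl⟩ : ∃ n, N = n + 1 := ⟨N - 1, by have := r.N3; omega⟩
  have h3 := r.N3
  have uW : u ∈ W := (hW u).2 (Or.inl rfl)
  have hm : ∀ i ≤ n + 1 + 1, h i ∈ W := by
    intro i hi
    by_cases e : i = n + 1 + 1
    · rw [e, r.wrap]; exact (hW _).2 (Or.inr ⟨0, by omega, rfl⟩)
    · exact (hW _).2 (Or.inr ⟨i, by omega, rfl⟩)
  have le : ∀ j ≤ n + 1, Ln G W (ln G (h j) (h (j + 1))) := fun j hj => ⟨_, hm j (by omega), _, hm (j + 1) (by omega), r.adj1 hj, rfl⟩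
  have ll : ∀ j, lst G h u j ≤ j := fun j => lst_le
  have lf : ∀ j ≤ n + 1, Ln G W (ln G u (h (lst G h u j))) := fun j hj => ⟨_, uW, _, hm _ (by have := ll j; omega), lst_sp h0 j, rfl⟩
  let e : ℕ → Set V := fun j => ln G (h j) (h (j + 1))
  let f : ℕ → Set V := fun j => ln G u (h (lst G h u j))
  have fsp : ∀ j, G.Adj u (h j) → f j = ln G u (h j) := fun j hj => by simp only [f]; rw [lst_self hj]
  let c0 := e (n + 1)
  let c1 := f 0
  have lines : ∀ j ≤ n + 1, ∃ t : Fin (n + 1), ∀ w ∈ W, G.Adj (h j) w → ∃ i, pl c0 c1 e f n t i = ln G (h j) w := by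
    intro j hj
    refine ⟨⟨j - 1, by omega⟩, ?_⟩
    intro w hw ha
    rw [pl_iff]
    rcases (hW w).1 hw with rfl | ⟨k, hk, rfl⟩
    · have hf := fsp j ha.symm
      rw [ln_comm, ← hf]
      by_cases j0 : j = 0
      · subst j0; exact Or.inr (Or.inl rfl)
      · refine Or.inr (Or.inr (Or.inr (Or.inr (Or.inr ?_))))
        simp only
        rw [Nat.sub_add_cancel (by omega)]
    rcases r.nbr hj hk ha with q | ⟨q', q⟩ | ⟨q', q⟩
    · rw [q]
      by_cases j0 : j = 0
      · subst j0; exact Or.inr (Or.inr (Or.inl rfl))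
      · refine Or.inr (Or.inr (Or.inr (Or.inl ?_)))
        simp only [e]
        rw [Nat.sub_add_cancel (by omega)]
    · rw [q]; exact Or.inr (Or.inr (Or.inl rfl))
    · rw [q]; exact Or.inl rfl
  refine ⟨_, _, pl c0 c1 e f n, Dc_path hG (le _ le_rfl) (lf _ (by omega)) le lf ?_ ?_ ?_, ?_⟩
  · have key : ∀ j ≤ n + 1, G.Adj u (h j) → c0 = ln G u (h j) ∨ c1 = ln G u (h j) ∨ ∃ i ≤ n + 1, e i = ln G u (h j) ∨ f i = ln G u (h j) :=
      fun j hj ha => Or.inr (Or.inr ⟨j, hj, Or.inr (fsp j ha)⟩)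
    rintro M ⟨a, ha, b, hb, hab, rfl⟩
    rcases (hW a).1 ha with rfl | ⟨j, hj, rfl⟩
    · rcases (hW b).1 hb with rfl | ⟨k, hk, rfl⟩
      · exact absurd hab (G.loopless.irrefl _)
      · exact key k hk hab
    rcases (hW b).1 hb with rfl | ⟨k, hk, rfl⟩
    · rw [ln_comm]; exact key j hj hab.symm
    rcases r.nbr hj hk hab with q | ⟨q', q⟩ | ⟨q', q⟩ <;> rw [q]
    · exact Or.inr (Or.inr ⟨j, hj, Or.inl rfl⟩)
    · exact Or.inr (Or.inr ⟨j - 1, by omega, Or.inl rfl⟩)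
    · exact Or.inl rfl
  · intro M n0 n1 i j k hij hjk hk hi' hk'
    have mij := lst_mono (h := h) h0 hij
    have mjk := lst_mono (h := h) h0 hjk
    have li := ll i
    have lj := ll j
    have lk := ll k
    rcases hi' with hi | hi <;> rcases hk' with hkk | hkk
    · have : i = k := r.e_inj (by omega) hk (hi.trans hkk.symm)
      have : j = i := by omega
      subst this
      exact Or.inl hi
    · -- e i = f k
      have iN : i ≠ n + 1 := by rintro rfl; exact n0 hi
      have heq : e i = f k := hi.trans hkk.symm
      have um : u ∈ e i := by rw [heq]; exact ln_left (lst_sp h0 k)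
      have lm : h (lst G h u k) ∈ e i := by rw [heq]; exact ln_right (lst_sp h0 k)
      have sp : G.Adj u (h (i + 1)) := adj_of_ln' um (fun q => hu (i + 1) (by omega) q.symm)
      have := r.mem_e (by omega) (by omega) lm
      by_cases ji : j = i
      · subst ji; exact Or.inl hi
      · have g1 : i + 1 ≤ lst G h u j := lst_ge (by omega) sp
        have : lst G h u j = lst G h u k := by omega
        right
        rw [← hkk]
        simp only [f]; rw [this]
    · -- f i = e k
      have kN : k ≠ n + 1 := by rintro rfl; exact n0 hkk
      have heq : f i = e k := hi.trans hkk.symm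
      have lm : h (lst G h u i) ∈ e k := by rw [← heq]; exact ln_right (lst_sp h0 i)
      have := r.mem_e (by omega) (by omega) lm
      have : i = j := by omega
      subst this
      exact Or.inr hi
    · have heq : f i = f k := hi.trans hkk.symm
      have i0 : lst G h u i ≠ 0 := by
        intro q
        apply n1
        rw [← hi]
        simp only [f, c1]; rw [q, lst_self h0]
      by_cases q : lst G h u i = lst G h u k
      · have : lst G h u j = lst G h u i := by omega
        right
        rw [← hi]
        simp only [f]; rw [this]
      · have m1 : h (lst G h u i) ∈ f k := by rw [← heq]; exact ln_right (lst_sp h0 i)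
        have m2 : h (lst G h u k) ∈ f k := ln_right (lst_sp h0 k)
        have ad := ln_adj hG (lst_sp h0 k) m1 m2 (fun w => q (r.inj _ (by omega) _ (by omega) w))
        have := (r.adj _ (by omega) _ (by omega)).1 ad
        have : lst G h u j = lst G h u i ∨ lst G h u j = lst G h u k := by omega
        right
        rcases this with w | w
        · rw [← hi]; simp only [f]; rw [w]
        · rw [← hkk]; simp only [f]; rw [w]
  · intro x hx
    rcases (hW x).1 hx with rfl | ⟨j, hj, rfl⟩
    · exact ⟨⟨_, lf 0 (by omega), ln_left (lst_sp h0 0)⟩, Or.inr (Or.inl (ln_left (lst_sp h0 0)))⟩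
    refine ⟨⟨_, le j hj, ln_left (r.adj1 hj)⟩, Or.inr (Or.inr ?_)⟩
    obtain ⟨t, ht⟩ := lines j hj
    refine ⟨t, ?_⟩
    intro M hM hxM
    obtain ⟨w, hw, ha, rfl⟩ := hM.at hG hxM
    exact ht w hw ha
  · intro v x y hc
    rcases (hW v).1 hc.1 with rfl | ⟨j, hj, rfl⟩
    swap
    · obtain ⟨t, ht⟩ := lines j hj
      obtain ⟨i, hi⟩ := ht x hc.2.1 hc.2.2.2.1
      obtain ⟨i', hi'⟩ := ht y hc.2.2.1 hc.2.2.2.2.1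
      exact ⟨t, i, i', hi, hi'⟩
    obtain ⟨_, xW, yW, vx, vy, _, ⟨a, b, aD, hxa, hyb, hab⟩, _⟩ := hc
    have bD : b ∈ Dn G W v := hab.mem aD
    have rep : ∀ d ∈ Dn G W v, ∃ i ≤ n + 1, h i = d ∧ ¬ G.Adj v (h i) := by
      intro d hd
      rcases (hW d).1 hd.1 with q | ⟨i, hi, rfl⟩
      · exact absurd q hd.2.1
      · exact ⟨i, hi, rfl, hd.2.2⟩
    obtain ⟨α, hα, rfl, sα⟩ := rep a aD
    have inv : ∀ d, Lk G (Dn G W v) (h α) d → ∀ β ≤ n + 1, h β = d → lst G h v β = lst G h v α := by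
      intro d hd
      induction hd with
      | refl => intro β hβ q; rw [r.inj β hβ α hα q]
      | @tail c d hc hcd ih =>
        intro β hβ q
        subst q
        obtain ⟨γ, hγ, rfl, sγ⟩ := rep c hcd.2.1
        rw [← ih γ hγ rfl]
        have sβ : ¬ G.Adj v (h β) := hcd.2.2.2.2
        have z1 : γ ≠ 0 := by rintro rfl; exact sγ h0
        have z2 : β ≠ 0 := by rintro rfl; exact sβ h0
        rcases (r.adj γ hγ β hβ).1 hcd.1 with q | q | q | q
        · subst q; exact lst_succ h0 sβ
        · subst q; exact (lst_succ h0 sγ).symm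
        · exact absurd q.1 z1
        · exact absurd q.2 z2
    obtain ⟨β, hβ, rfl, sβ⟩ := rep b bD
    have lab := inv _ hab β hβ rfl
    have cls : ∀ α ≤ n + 1, ¬ G.Adj v (h α) → ∀ x, G.Adj v x → Att G W v x (h α) →
        ln G v x = f α ∨ (α < n + 1 ∧ G.Adj v (h (α + 1)) ∧ ln G v x = f (α + 1)) ∨ (α = n + 1 ∧ ln G v x = c1) := by
      rintro α hα sα x vx ⟨w, hw, vw, wx, aw⟩
      rw [← ln_nr hG vx vw wx]
      rcases (hW w).1 hw with rfl | ⟨k, hk, rfl⟩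
      · exact absurd vw (G.loopless.irrefl _)
      rcases (r.adj α hα k hk).1 aw with q | q | q | q
      · subst q
        right; left
        exact ⟨by omega, vw, (fsp _ vw).symm⟩
      · subst q
        left
        simp only [f]
        rw [lst_succ h0 sα, lst_self vw]
      · exact absurd (q.1 ▸ h0) sα
      · right; right
        refine ⟨q.1, ?_⟩
        rw [q.2]
        exact (fsp 0 h0).symm
    have fe : f α = f β := by simp only [f]; rw [lab]
    -- labels at a node
    have node : ∀ α ≤ n + 1, ∃ t : Fin (n + 1), ∀ M, (M = f α ∨ (α < n + 1 ∧ M = f (α + 1)) ∨ (α = n + 1 ∧ M = c1)) →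
        ∃ i, pl c0 c1 e f n t i = M := by
      intro α hα
      by_cases q : α = n + 1
      · subst q
        refine ⟨⟨n, by omega⟩, ?_⟩
        rintro M (rfl | q | ⟨_, rfl⟩)
        · exact pl_iff.2 (by simp)
        · omega
        · exact pl_iff.2 (by simp)
      · refine ⟨⟨α, by omega⟩, ?_⟩
        rintro M (rfl | ⟨_, rfl⟩ | q)
        · exact pl_iff.2 (by simp)
        · exact pl_iff.2 (by simp)
        · omega
    have X := cls α hα sα x vx hxa
    have Y := cls β hβ sβ y vy hyb
    obtain ⟨tα, nα⟩ := node α hα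
    obtain ⟨tβ, nβ⟩ := node β hβ
    have fin : (∃ t, (∃ i, pl c0 c1 e f n t i = ln G v x) ∧ ∃ j, pl c0 c1 e f n t j = ln G v y) := by
      rcases X with X1 | X
      · refine ⟨tβ, nβ _ (Or.inl (X1.trans fe)), nβ _ ?_⟩
        rcases Y with Y | Y | Y
        · exact Or.inl Y
        · exact Or.inr (Or.inl ⟨Y.1, Y.2.2⟩)
        · exact Or.inr (Or.inr Y)
      have X' : ∃ i, pl c0 c1 e f n tα i = ln G v x := by
        apply nα
        rcases X with X | X
        · exact Or.inr (Or.inl ⟨X.1, X.2.2⟩)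
        · exact Or.inr (Or.inr X)
      rcases Y with Y1 | Y
      · exact ⟨tα, X', nα _ (Or.inl (Y1.trans fe.symm))⟩
      have Y' : ln G v y = f β ∨ (β < n + 1 ∧ ln G v y = f (β + 1)) ∨ (β = n + 1 ∧ ln G v y = c1) := by
        rcases Y with Y | Y
        · exact Or.inr (Or.inl ⟨Y.1, Y.2.2⟩)
        · exact Or.inr (Or.inr Y)
      have ab : α = β := by
        have la := ll α
        have lb := ll β
        rcases lt_trichotomy α β with q | q | q
        · have : G.Adj v (h (α + 1)) := by
            rcases X with X | X
            · exact X.2.1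
            · omega
          have := lst_ge (show α + 1 ≤ β by omega) this
          omega
        · exact q
        · have : G.Adj v (h (β + 1)) := by
            rcases Y with X | X
            · exact X.2.1
            · omega
          have := lst_ge (show β + 1 ≤ α by omega) this
          omega
      subst ab
      exact ⟨tα, X', nα _ Y'⟩
    obtain ⟨t, ⟨i, hi⟩, j, hj⟩ := fin
    exact ⟨t, i, j, hi, hj⟩

end Part20

section Part21
set_option linter.unusedVariables false
variable {V : Type*} {G : SimpleGraph V}

theorem dec_atom [Finite V] (hG : InC G) : ∀ (n : ℕ) (W : Set V), W.ncard = n → Atom G W → Dec G W := by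
  intro n
  induction n using Nat.strong_induction_on with
  | _ n ih =>
    intro W hn hW
    by_cases hD : ∀ u ∈ W, ∀ x ∈ Dn G W u, ∀ y ∈ Dn G W u, Lk G (Dn G W u) x y
    · rcases struct hG hW hD with h | ⟨l, hl, hm⟩
      · exact Dec_clq hG h
      · have := hl.length
        obtain ⟨a, ha⟩ := List.exists_mem_of_length_pos (l := l) (by omega)
        obtain ⟨h, N, r, _, hh⟩ := Rg_exists hl ha
        exact r.dec hG (fun x => (hm x).trans (hh x))
    push Not at hD
    obtain ⟨u, hu, d1, hd1, d2, hd2, hnl⟩ := hD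
    by_cases hall : ∀ x1 x2 P C, Spl G W u x1 x2 P C → ∀ x ∈ W, x ∈ SB G W u x1 x2 P C
    · obtain ⟨l, hl, hul, hm⟩ := wheel_base hG hW hu hd1 hd2 hnl hall
      have hlk := hW ∅ (Set.empty_subset _) (fun x hx => absurd hx (Set.notMem_empty x)) u ⟨hu, Set.notMem_empty _⟩ d1 ⟨hd1.1, Set.notMem_empty _⟩
      obtain ⟨a, ha, b, hb, hab, rfl, hbu⟩ := hlk.cross (p := fun z => z = u) rfl hd1.2.1
      have hbl : b ∈ l := ((hm b).1 hb.1).resolve_left hbu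
      obtain ⟨h, N, r, h0, hh⟩ := Rg_exists hl hbl
      refine r.decW hG (u := a) (fun i hi e => hul ((hh a).2 ⟨i, hi, e⟩)) (h0 ▸ hab) ?_
      intro x
      rw [hm x, hh x]
    · push Not at hall
      obtain ⟨x1, x2, P, C, hs, x, hx, hxB⟩ := hall
      obtain ⟨w, _, _, _, c, hc, _⟩ := hs.y1
      refine hs.dec hG (ih _ ?_ _ rfl (hs.atomA hG)) (ih _ ?_ _ rfl (hs.atomB hG))
      · rw [← hn]
        refine Set.ncard_lt_ncard ⟨Spl.SAW, fun hsub => ?_⟩ (Set.toFinite _)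
        exact (hsub (hs.CW c hc)).2.1 hc
      · rw [← hn]
        exact Set.ncard_lt_ncard ⟨hs.SBW, fun hsub => hxB (hsub hx)⟩ (Set.toFinite _)

theorem dec0_all [Finite V] (hG : InC G) : ∀ (n : ℕ) (W : Set V), W.ncard = n → Dec0 G W := by
  intro n
  induction n using Nat.strong_induction_on with
  | _ n ih =>
    intro W hn
    by_cases hA : Atom G W
    · obtain ⟨ι, T, L, d, _⟩ := dec_atom hG n W hn hA
      exact ⟨ι, T, L, d⟩
    unfold Atom at hA
    push Not at hA
    obtain ⟨Z, hZW, hZ, x, hx, y, hy, hnl⟩ := hA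
    have hS : ∀ e ∈ {e | Lk G (W \ Z) x e}, e ∈ W \ Z := fun e he => Lk.mem he hx
    have hxS : x ∈ {e | Lk G (W \ Z) x e} := Lk.refl
    refine Dec0_cut hG (W := W) (Z := Z) (S := {e | Lk G (W \ Z) x e}) hZW hZ (fun e he => (hS e he).1)
      (fun e he => (hS e he).2) ?_ (ih _ ?_ _ rfl) (ih _ ?_ _ rfl)
    · intro a ha b hb hab
      by_cases hbZ : b ∈ Z
      · exact Or.inr hbZ
      · exact Or.inl (Lk.trans ha (Lk.step hab (hS a ha) ⟨hb, hbZ⟩))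
    · rw [← hn]
      refine Set.ncard_lt_ncard ⟨Set.union_subset hZW (fun e he => (hS e he).1), fun hsub => ?_⟩ (Set.toFinite _)
      rcases hsub hy.1 with h | h
      · exact hy.2 h
      · exact hnl h
    · rw [← hn]
      refine Set.ncard_lt_ncard ⟨fun e he => he.1, fun hsub => ?_⟩ (Set.toFinite _)
      exact (hsub hx.1).2 hxS

theorem induce_conn {ι : Type*} {T : SimpleGraph ι} {S : Set ι} (hne : S.Nonempty)
    (h : ∀ a ∈ S, ∀ b ∈ S, Lk T S a b) : (T.induce S).Connected := by
  have key : ∀ a b, Lk T S a b → ∀ (ha : a ∈ S) (hb : b ∈ S), (T.induce S).Reachable ⟨a, ha⟩ ⟨b, hb⟩ := by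
    intro a b hab ha
    induction hab with
    | refl => intro hb; exact Reachable.refl _
    | tail _ hbc ih => exact fun hc => (ih hbc.2.1).trans (Adj.reachable (by simpa using hbc.1))
  obtain ⟨s, hs⟩ := hne
  haveI : Nonempty S := ⟨⟨s, hs⟩⟩
  exact ⟨fun a b => key a.1 b.1 (h a.1 a.2 b.1 b.2) a.2 b.2⟩

theorem indep_le {S : Set V} (L : Fin 6 → Set V) (hL : ∀ i, Clq G (L i)) (hS : ∀ x ∈ S, ∃ i, x ∈ L i) :
    indepNum (G.induce S) ≤ 6 := by
  unfold indepNum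
  refine csSup_le' ?_
  rintro n ⟨I, hI, rfl⟩
  choose g hg using fun x : I => hS x.1.1 x.1.2
  have inj : Function.Injective g := by
    intro x y e
    by_contra hxy
    have h1 : x.1.1 ∈ L (g x) := hg x
    have h2 : y.1.1 ∈ L (g x) := e ▸ hg y
    have ne : x.1 ≠ y.1 := fun h => hxy (Subtype.ext h)
    rcases hL _ _ h1 _ h2 with q | q
    · exact ne (Subtype.ext q)
    · exact hI x.2 y.2 ne (by simpa using q)
  have := Nat.card_le_card_of_injective g inj
  simpa using this

theorem main6 [Finite V] (hG : InC G) : treeIndepNum G ≤ 6 := by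
  obtain ⟨ι, T, L, d⟩ := dec0_all hG _ Set.univ rfl
  refine Nat.sInf_le ⟨⟨ι, T, d.tree.isAcyclic, d.tree.connected, fun t => {x | ∃ i, x ∈ L t i}, ?_, ?_, ?_⟩, ?_⟩
  · exact fun v => d.l3 v trivial
  · intro u v huv
    obtain ⟨t, i, e⟩ := d.l2 _ ⟨u, trivial, v, trivial, huv, rfl⟩
    exact ⟨t, ⟨i, e ▸ ln_left huv⟩, i, e ▸ ln_right huv⟩
  · intro v
    refine induce_conn ?_ ?_
    · obtain ⟨t, i, e⟩ := d.l3 v trivial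
      exact ⟨t, i, e⟩
    · rintro a ⟨i, ha⟩ b ⟨j, hb⟩
      exact d.l3' v trivial a i b j ha hb
  · intro t
    refine indep_le (L t) ?_ (fun x hx => hx)
    intro i
    rcases d.l1 t i with h | h
    · exact fun x hx y hy => Or.inl (h.2 hx hy)
    · exact h.clq hG

end Part21

theorem statement0 :
    ∃ Γ : ℤ, ∀ (V : Type) [Fintype V] (G : SimpleGraph V),
      InC G → (treeIndepNum G : ℤ) ≤ Γ := by
  refine ⟨6, ?_⟩
  intro V _ G hG
  exact_mod_cast main6 hG

end Paper
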